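/- (Hatcher–Vogtmann homology stability) For every i ≥ 0 and every n ≥ 2i + 2, the natural homomorphism Aut F_n → Aut F_{n+1} induces an isomorphism H_i(Aut F_n;ℤ) → H_i(Aut F_{n+1};ℤ) on group homology. -/

import Mathlib

open scoped BigOperators

noncomputable section

/-- Inhomogeneous group `j`-cochains of `G` with trivial coefficients `ℚ`. -/
abbrev Cochain (G : Type) (j : ℕ) : Type := (Fin j → G) → ℚ

/-- The standard inhomogeneous coboundary
`(δc)(g₀,…,g_j) = c(g₁,…,g_j) + Σ_{i=1}^{j} (−1)^i c(g₀,…,g_{i−1}g_i,…,g_j)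
 + (−1)^{j+1} c(g₀,…,g_{j−1})`. -/
def cb {G : Type} [Group G] {j : ℕ} (c : Cochain G j) : Cochain G (j + 1) :=
  fun g =>
    c (fun i => g i.succ)
    + ∑ i : Fin j, (-1 : ℚ) ^ ((i : ℕ) + 1) * c (Fin.contractNth i.castSucc (· * ·) g)
    + (-1 : ℚ) ^ (j + 1) * c (fun i => g i.castSucc)

/-- Inhomogeneous group `i`-chains of `G` with trivial coefficients `ℤ`. -/
abbrev Chn (G : Type) (i : ℕ) : Type := (Fin i → G) →₀ ℤ

/-- Boundary of a basis chain. -/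
def bword {G : Type} [Group G] {i : ℕ} (t : Fin (i + 1) → G) : Chn G i :=
  Finsupp.single (fun s => t s.succ) 1
    + ∑ q : Fin i, (-1 : ℤ) ^ ((q : ℕ) + 1) • Finsupp.single (Fin.contractNth q.castSucc (· * ·) t) 1
    + (-1 : ℤ) ^ (i + 1) • Finsupp.single (fun s => t s.castSucc) 1

/-- The standard inhomogeneous boundary map (zero in degree `0`). -/
def bdry {G : Type} [Group G] : (i : ℕ) → Chn G i → Chn G (i - 1)
  | 0 => fun _ => 0
  | (_ + 1) => fun x => x.sum fun t c => c • bword t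

/-- `x` is a boundary. -/
def IsBdry {G : Type} [Group G] {i : ℕ} (x : Chn G i) : Prop :=
  ∃ y : Chn G (i + 1), bdry (i + 1) y = x

/-- The map on chains induced by a group homomorphism. -/
def cmap {G H : Type} [Group G] [Group H] (f : G →* H) {i : ℕ} (x : Chn G i) : Chn H i :=
  Finsupp.mapDomain (fun t => fun s => f (t s)) x

/-- The group of inner automorphisms, as a normal subgroup of `MulAut G`
(being normal, it coincides with the normal closure of the image of
`MulAut.conj`). -/
abbrev Inn (G : Type) [Group G] : Subgroup (MulAut G) :=
  Subgroup.normalClosure (Set.range (MulAut.conj : G →* MulAut G))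

/-- The outer automorphism group `Out G = Aut G / Inn G`. -/
abbrev Out (G : Type) [Group G] : Type := MulAut G ⧸ Inn G

/-- The exponent sum of the generator `j` in a word of the free group:
the `j`-th coordinate of the image in the abelianization `H₁(Fₙ;ℤ) ≅ ℤⁿ`. -/
def expSum {n : ℕ} (j : Fin n) (w : FreeGroup (Fin n)) : ℤ :=
  Multiplicative.toAdd
    ((FreeGroup.lift (fun a => if a = j then Multiplicative.ofAdd (1 : ℤ) else 1)) w)

namespace HV

section Framework

variable {X : Type*} {X' : Type*}

/-- The linear extension of a boundary defined on basis elements. -/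
def bdLin (bd : X → X →₀ ℤ) : (X →₀ ℤ) →ₗ[ℤ] (X →₀ ℤ) := Finsupp.linearCombination ℤ bd

@[simp] lemma bdLin_single (bd : X → X →₀ ℤ) (x : X) (c : ℤ) :
    bdLin bd (Finsupp.single x c) = c • bd x := by
  simp [bdLin, Finsupp.linearCombination_single]

lemma bdLin_apply (bd : X → X →₀ ℤ) (z : X →₀ ℤ) (x : X) :
    bdLin bd z x = z.sum fun a c => c * bd a x := by
  simp [bdLin, Finsupp.linearCombination_apply, Finsupp.sum_apply]

lemma exists_of_bdLin_ne_zero {bd : X → X →₀ ℤ} {z : X →₀ ℤ} {x : X}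
    (h : bdLin bd z x ≠ 0) : ∃ a, z a ≠ 0 ∧ bd a x ≠ 0 := by
  rw [bdLin_apply, Finsupp.sum] at h
  obtain ⟨a, -, h2⟩ := Finset.exists_ne_zero_of_sum_ne_zero h
  exact ⟨a, left_ne_zero_of_mul h2, right_ne_zero_of_mul h2⟩

/-- Exactness in degree `m` of the subquotient complex spanned by `S`. -/
def Ex (bd : X → X →₀ ℤ) (deg : X → ℕ) (S : Set X) (m : ℕ) : Prop :=
  ∀ z : X →₀ ℤ, (∀ x, z x ≠ 0 → x ∈ S ∧ deg x = m) → (∀ x ∈ S, bdLin bd z x = 0) →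
    ∃ y : X →₀ ℤ, (∀ x, y x ≠ 0 → x ∈ S ∧ deg x = m + 1) ∧ ∀ x ∈ S, bdLin bd y x = z x

lemma Ex.of_forall_deg_ne {bd : X → X →₀ ℤ} {deg : X → ℕ} {S : Set X} {m : ℕ}
    (h : ∀ x ∈ S, deg x ≠ m) : Ex bd deg S m := by
  intro z hz _
  refine ⟨0, by simp, fun x hx => ?_⟩
  by_contra hne
  have : z x ≠ 0 := by simpa [eq_comm] using hne
  exact h x hx (hz x this).2

theorem Ex.of_filtration {bd : X → X →₀ ℤ} {deg : X → ℕ} {S : Set X} {m : ℕ} {ι : Type*}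
    (p : X → ι) (μ : ι → ℕ)
    (hdeg : ∀ x x', bd x x' ≠ 0 → deg x = deg x' + 1)
    (hDD : ∀ x, bdLin bd (bd x) = 0)
    (hconv : ∀ x ∈ S, ∀ x', bd x x' ≠ 0 → x' ∉ S → ∀ x'', bd x' x'' ≠ 0 → x'' ∉ S)
    (htri : ∀ x ∈ S, ∀ x' ∈ S, bd x x' ≠ 0 → p x' = p x ∨ μ (p x') < μ (p x))
    (hpiece : ∀ i, Ex bd deg (S ∩ p ⁻¹' {i}) m) : Ex bd deg S m := by
  classical
  have hDD' : ∀ y, bdLin bd (bdLin bd y) = 0 := by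
    intro y
    have : (bdLin bd).comp (bdLin bd) = 0 := by
      ext1 x
      ext1
      simp [hDD]
    exact LinearMap.congr_fun this y
  have key : ∀ (k : ℕ) (z : X →₀ ℤ), (∀ x, z x ≠ 0 → x ∈ S ∧ deg x = m) →
      (∀ x, z x ≠ 0 → μ (p x) < k) → (∀ x ∈ S, bdLin bd z x = 0) →
      ∃ y : X →₀ ℤ, (∀ x, y x ≠ 0 → x ∈ S ∧ deg x = m + 1) ∧ ∀ x ∈ S, bdLin bd y x = z x := by
    intro k
    induction k with
    | zero =>
      intro z _ hk _
      have : z = 0 := by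
        ext x
        by_contra h
        exact absurd (hk x h) (by omega)
      exact ⟨0, by simp, by simp [this]⟩
    | succ k ih =>
      intro z hz hk hcyc
      have hY : ∀ i, ∃ y : X →₀ ℤ, (∀ x, y x ≠ 0 → (x ∈ S ∧ p x = i) ∧ deg x = m + 1) ∧
          (μ i = k → ∀ x ∈ S, p x = i → bdLin bd y x = z x) := by
        intro i
        by_cases hi : μ i = k
        swap
        · exact ⟨0, by simp, fun h => absurd h hi⟩
        obtain ⟨y, hy1, hy2⟩ := hpiece i (z.filter fun x => p x = i) (by
          intro x hx
          have hpx : p x = i := by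
            by_contra hne
            exact hx (Finsupp.filter_apply_neg _ _ hne)
          rw [Finsupp.filter_apply, if_pos hpx] at hx
          exact ⟨⟨(hz x hx).1, hpx⟩, (hz x hx).2⟩) (by
          rintro x ⟨hxS, hpx⟩
          have hpx : p x = i := hpx
          have h1 := hcyc x hxS
          rw [← Finsupp.filter_add_filter_not z (fun x => p x = i), map_add,
            Finsupp.add_apply] at h1
          have h2 : bdLin bd (z.filter fun x => ¬ p x = i) x = 0 := by
            by_contra hne
            obtain ⟨a, ha, hb⟩ := exists_of_bdLin_ne_zero hne
            have hpa : ¬ p a = i := by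
              intro h
              exact ha (Finsupp.filter_apply_neg _ _ (not_not.2 h))
            rw [Finsupp.filter_apply, if_pos hpa] at ha
            rcases htri a (hz a ha).1 x hxS hb with h | h
            · exact hpa (h ▸ hpx)
            · have := hk a ha
              rw [hpx] at h
              omega
          rw [h2, add_zero] at h1
          exact h1)
        refine ⟨y, hy1, fun _ x hxS hpx => ?_⟩
        rw [hy2 x ⟨hxS, hpx⟩, Finsupp.filter_apply, if_pos hpx]
      choose Y hY1 hY2 using hY
      set I : Finset ι := (z.support.image p).filter fun i => μ i = k with hI
      set y : X →₀ ℤ := ∑ i ∈ I, Y i with hy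
      have hysupp : ∀ x, y x ≠ 0 → (x ∈ S ∧ deg x = m + 1) ∧ μ (p x) = k := by
        intro x hx
        rw [hy, Finsupp.finsetSum_apply] at hx
        obtain ⟨i, hi, hne⟩ := Finset.exists_ne_zero_of_sum_ne_zero hx
        have := hY1 i x hne
        refine ⟨⟨this.1.1, this.2⟩, ?_⟩
        rw [this.1.2]
        exact (Finset.mem_filter.1 hi).2
      have hDy : ∀ x ∈ S, ¬ μ (p x) < k → bdLin bd y x = z x := by
        intro x hxS hx
        by_cases hxk : μ (p x) = k
        · have hne : ∀ i ∈ I, i ≠ p x → bdLin bd (Y i) x = 0 := by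
            intro i hi hip
            by_contra hne
            obtain ⟨a, ha, hb⟩ := exists_of_bdLin_ne_zero hne
            have h1 := (hY1 i a ha).1
            rcases htri a h1.1 x hxS hb with h | h
            · exact hip (by rw [h, h1.2])
            · have h3 := (Finset.mem_filter.1 hi).2
              rw [h1.2] at h
              omega
          rw [hy, map_sum, Finsupp.finsetSum_apply]
          by_cases hmem : p x ∈ I
          · rw [Finset.sum_eq_single_of_mem _ hmem hne]
            exact hY2 (p x) hxk x hxS rfl
          · rw [Finset.sum_eq_zero (fun i hi => hne i hi (fun h => hmem (h ▸ hi)))]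
            by_contra hzx
            refine hmem (Finset.mem_filter.2 ⟨Finset.mem_image.2 ⟨x, ?_, rfl⟩, hxk⟩)
            exact Finsupp.mem_support_iff.2 (Ne.symm hzx)
        · have h1 : z x = 0 := by
            by_contra h
            have := hk x h
            omega
          rw [h1]
          by_contra hne
          obtain ⟨a, ha, hb⟩ := exists_of_bdLin_ne_zero hne
          have h2 := hysupp a ha
          rcases htri a h2.1.1 x hxS hb with h | h
          · rw [h] at hxk; exact hxk h2.2
          · omega
      set z' : X →₀ ℤ := (z - bdLin bd y).filter (fun x => x ∈ S) with hz'
      have hz'mem : ∀ x, z' x ≠ 0 → x ∈ S := by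
        intro x hx
        by_contra h
        exact hx (Finsupp.filter_apply_neg _ _ h)
      have hz'val : ∀ x ∈ S, z' x = z x - bdLin bd y x := by
        intro x hx
        rw [hz', Finsupp.filter_apply, if_pos hx, Finsupp.sub_apply]
      obtain ⟨y', hy'1, hy'2⟩ := ih z' (by
          intro x hx
          refine ⟨hz'mem x hx, ?_⟩
          rw [hz'val x (hz'mem x hx)] at hx
          by_cases h : z x = 0
          · rw [h, zero_sub, neg_ne_zero] at hx
            obtain ⟨a, ha, hb⟩ := exists_of_bdLin_ne_zero hx
            have := hdeg _ _ hb
            have := (hysupp a ha).1.2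
            omega
          · exact (hz x h).2) (by
          intro x hx
          have hxS := hz'mem x hx
          by_contra h
          rw [hz'val x hxS, hDy x hxS h, sub_self] at hx
          exact hx rfl) (by
          intro x hx
          have h1 : z' = z - bdLin bd y + (bdLin bd y).filter (fun x => ¬ x ∈ S) := by
            ext a
            by_cases ha : a ∈ S
            · rw [hz'val a ha]
              simp [ha]
            · have h0 : z a = 0 := by
                by_contra h
                exact ha (hz a h).1
              have h0' : z' a = 0 := by
                by_contra h
                exact ha (hz'mem a h)
              simp [h0, h0', ha]
          rw [h1, map_add, map_sub, hDD', sub_zero, Finsupp.add_apply, hcyc x hx, zero_add]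
          by_contra hne
          obtain ⟨a, ha, hb⟩ := exists_of_bdLin_ne_zero hne
          have haS : ¬ a ∈ S := by
            intro h
            exact ha (Finsupp.filter_apply_neg _ _ (not_not.2 h))
          rw [Finsupp.filter_apply, if_pos haS] at ha
          obtain ⟨c, hc, hd⟩ := exists_of_bdLin_ne_zero ha
          exact hconv c (hysupp c hc).1.1 a hd haS x hb hx)
      refine ⟨y + y', ?_, ?_⟩
      · intro x hx
        by_cases h : y x = 0
        · rw [Finsupp.add_apply, h, zero_add] at hx
          exact hy'1 x hx
        · exact (hysupp x h).1
      · intro x hx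
        rw [map_add, Finsupp.add_apply, hy'2 x hx, hz'val x hx]
        ring
  intro z hz hcyc
  refine key (z.support.sup (fun x => μ (p x)) + 1) z hz ?_ hcyc
  intro x hx
  exact Nat.lt_succ_of_le (Finset.le_sup (f := fun x => μ (p x)) (Finsupp.mem_support_iff.2 hx))

theorem Ex.transfer {bd : X → X →₀ ℤ} {deg : X → ℕ} {bd' : X' → X' →₀ ℤ} {deg' : X' → ℕ}
    {S : Set X} {S' : Set X'} (j : X → X') (c m : ℕ) (ε : ℤ) (hε : ε * ε = 1)
    (hj : Set.InjOn j S) (hS : ∀ x', x' ∈ S' ↔ ∃ x ∈ S, j x = x')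
    (hdeg : ∀ x ∈ S, deg' (j x) = deg x + c)
    (hbd : ∀ x ∈ S, ∀ y ∈ S, bd' (j x) (j y) = ε * bd x y)
    (h : Ex bd deg S m) : Ex bd' deg' S' (m + c) := by
  classical
  have hD : ∀ z : X →₀ ℤ, (∀ x, z x ≠ 0 → x ∈ S) → ∀ x ∈ S,
      bdLin bd' (Finsupp.mapDomain j z) (j x) = ε * bdLin bd z x := by
    intro z hz x hx
    rw [bdLin_apply, bdLin_apply, Finsupp.sum_mapDomain_index (by simp) (by intros; ring),
      Finsupp.sum, Finsupp.sum, Finset.mul_sum]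
    refine Finset.sum_congr rfl fun a ha => ?_
    rw [hbd a (hz a (Finsupp.mem_support_iff.1 ha)) x hx]
    ring
  have hmap : ∀ z : X →₀ ℤ, (∀ x, z x ≠ 0 → x ∈ S) → ∀ x ∈ S,
      Finsupp.mapDomain j z (j x) = z x := by
    intro z hz x hx
    rw [Finsupp.mapDomain, Finsupp.sum, Finsupp.finsetSum_apply]
    rw [Finset.sum_eq_single x]
    · simp
    · intro b hb hbx
      rw [Finsupp.single_apply, if_neg]
      intro he
      exact hbx (hj (hz b (Finsupp.mem_support_iff.1 hb)) hx he)
    · intro hx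
      simp [Finsupp.notMem_support_iff.1 hx]
  have hne : ∀ z : X →₀ ℤ, ∀ x', Finsupp.mapDomain j z x' ≠ 0 → ∃ x, z x ≠ 0 ∧ j x = x' := by
    intro z x' hx'
    have := Finsupp.mapDomain_support (Finsupp.mem_support_iff.2 hx')
    obtain ⟨a, ha, hb⟩ := Finset.mem_image.1 this
    exact ⟨a, Finsupp.mem_support_iff.1 ha, hb⟩
  intro z' hz' hcyc
  choose g hg using fun x' (hx' : x' ∈ S') => (hS x').1 hx'
  let z : X →₀ ℤ := ∑ x' ∈ z'.support.attach,
    Finsupp.single (g x'.1 (hz' x'.1 (Finsupp.mem_support_iff.1 x'.2)).1) (z' x'.1)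
  have hzS : ∀ x, z x ≠ 0 → x ∈ S ∧ deg x = m := by
    intro x hx
    simp only [z] at hx
    rw [Finsupp.finsetSum_apply] at hx
    obtain ⟨x', -, hn⟩ := Finset.exists_ne_zero_of_sum_ne_zero hx
    have h1 : g x'.1 (hz' x'.1 (Finsupp.mem_support_iff.1 x'.2)).1 = x := by
      by_contra hne
      exact hn (by rw [Finsupp.single_apply, if_neg hne])
    have h2 := hg x'.1 (hz' x'.1 (Finsupp.mem_support_iff.1 x'.2)).1
    have h3 := (hz' x'.1 (Finsupp.mem_support_iff.1 x'.2)).2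
    rw [h1] at h2
    refine ⟨h2.1, ?_⟩
    have := hdeg x h2.1
    rw [h2.2, h3] at this
    omega
  have hz : Finsupp.mapDomain j z = z' := by
    simp only [z]
    rw [Finsupp.mapDomain_finsetSum]
    simp only [Finsupp.mapDomain_single]
    have : ∀ x' ∈ z'.support.attach, Finsupp.single
        (j (g x'.1 (hz' x'.1 (Finsupp.mem_support_iff.1 x'.2)).1)) (z' x'.1) =
        Finsupp.single x'.1 (z' x'.1) := fun x' _ => by rw [(hg _ _).2]
    rw [Finset.sum_congr rfl this, Finset.sum_attach z'.support
      (fun x' => Finsupp.single x' (z' x'))]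
    exact Finsupp.sum_single z'
  obtain ⟨y, hy1, hy2⟩ := h z hzS (by
    intro x hx
    have h1 := hD z (fun x hx => (hzS x hx).1) x hx
    rw [hz, hcyc _ ((hS _).2 ⟨x, hx, rfl⟩)] at h1
    calc bdLin bd z x = ε * ε * bdLin bd z x := by rw [hε, one_mul]
      _ = 0 := by rw [mul_assoc, ← h1, mul_zero])
  refine ⟨ε • Finsupp.mapDomain j y, ?_, ?_⟩
  · intro x' hx'
    rw [Finsupp.smul_apply, smul_eq_mul] at hx'
    obtain ⟨x, hx, rfl⟩ := hne y x' (right_ne_zero_of_mul hx')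
    have := hy1 x hx
    refine ⟨(hS _).2 ⟨x, this.1, rfl⟩, ?_⟩
    rw [hdeg x this.1, this.2]
    ring
  · intro x' hx'
    obtain ⟨x, hx, rfl⟩ := (hS x').1 hx'
    rw [map_smul, Finsupp.smul_apply, hD y (fun x hx => (hy1 x hx).1) x hx, hy2 x hx, smul_eq_mul,
      ← mul_assoc, hε, one_mul, ← hz, hmap z (fun x hx => (hzS x hx).1) x hx]

end Framework

section Words

variable {A : Type*}

/-- The alternating sum of the words obtained by deleting one letter. -/
def lbd : List A → (List A →₀ ℤ)
  | [] => 0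
  | a :: l => Finsupp.single l 1 - Finsupp.mapDomain (List.cons a) (lbd l)

lemma bdLin_mapDomain_cons (a : A) (z : List A →₀ ℤ) :
    bdLin lbd (Finsupp.mapDomain (List.cons a) z) =
      z - Finsupp.mapDomain (List.cons a) (bdLin lbd z) := by
  induction z using Finsupp.induction_linear with
  | zero => simp
  | add f g hf hg =>
    rw [Finsupp.mapDomain_add, map_add, hf, hg, map_add, Finsupp.mapDomain_add]
    abel
  | single l c =>
    rw [Finsupp.mapDomain_single, bdLin_single, bdLin_single, lbd, smul_sub,
      Finsupp.mapDomain_smul, Finsupp.smul_single, smul_eq_mul, mul_one]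

lemma bdLin_lbd (l : List A) : bdLin lbd (lbd l) = 0 := by
  induction l with
  | nil => simp [lbd]
  | cons a l ih =>
    rw [lbd, map_sub, bdLin_mapDomain_cons, ih, bdLin_single]
    simp

lemma mapDomain_cons_apply_cons (a : A) (z : List A →₀ ℤ) (l : List A) :
    Finsupp.mapDomain (List.cons a) z (a :: l) = z l :=
  Finsupp.mapDomain_apply (List.cons_injective) z l

lemma mapDomain_cons_apply_of_ne (a b : A) (h : b ≠ a) (z : List A →₀ ℤ) (l : List A) :
    Finsupp.mapDomain (List.cons a) z (b :: l) = 0 := by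
  apply Finsupp.mapDomain_of_notMem_range
  rintro ⟨l', h'⟩
  exact h (List.cons.inj h').1.symm

lemma mapDomain_cons_apply_nil (a : A) (z : List A →₀ ℤ) :
    Finsupp.mapDomain (List.cons a) z [] = 0 := by
  apply Finsupp.mapDomain_of_notMem_range
  rintro ⟨l', h'⟩
  cases h'

lemma exists_of_lbd_ne_zero {l l' : List A} (h : lbd l l' ≠ 0) :
    ∃ (a : List A) (x : A) (b : List A), l = a ++ x :: b ∧ l' = a ++ b := by
  classical
  induction l generalizing l' with
  | nil => simp [lbd] at h
  | cons c l ih =>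
    rw [lbd, Finsupp.sub_apply] at h
    by_cases h1 : l = l'
    · exact ⟨[], c, l, rfl, h1.symm⟩
    rw [Finsupp.single_apply, if_neg h1, zero_sub, neg_ne_zero] at h
    cases l' with
    | nil => exact absurd (mapDomain_cons_apply_nil c _) h
    | cons d l' =>
      by_cases hd : d = c
      · subst hd
        rw [mapDomain_cons_apply_cons] at h
        obtain ⟨a, x, b, rfl, rfl⟩ := ih h
        exact ⟨d :: a, x, b, rfl, rfl⟩
      · exact absurd (mapDomain_cons_apply_of_ne _ _ hd _ _) h

lemma length_of_lbd_ne_zero (l l' : List A) (h : lbd l l' ≠ 0) : l.length = l'.length + 1 := by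
  obtain ⟨a, x, b, rfl, rfl⟩ := exists_of_lbd_ne_zero h
  simp
  omega

lemma lbd_append_append (w : List A) (r : A) (l l' : List A) (hr : r ∉ l) :
    lbd (w ++ r :: l) (w ++ r :: l') = (-1) ^ (w.length + 1) * lbd l l' := by
  classical
  induction w with
  | nil =>
    rw [List.nil_append, List.nil_append, lbd, Finsupp.sub_apply, mapDomain_cons_apply_cons,
      Finsupp.single_apply, if_neg]
    · simp
    · rintro rfl
      simp at hr
  | cons a w ih =>
    rw [List.cons_append, List.cons_append, lbd, Finsupp.sub_apply, mapDomain_cons_apply_cons, ih,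
      Finsupp.single_apply, if_neg]
    · rw [List.length_cons, pow_succ _ (w.length + 1)]
      ring
    · intro h
      have h2 := congrArg (List.drop (w.length + 1)) h
      have e1 : List.drop (w.length + 1) (w ++ r :: l) = l := by
        rw [show w ++ r :: l = (w ++ [r]) ++ l by simp]
        apply List.drop_left'
        simp
      have e2 : List.drop (w.length + 1) (a :: (w ++ r :: l')) = r :: l' := by
        rw [List.drop_succ_cons, List.drop_left]
      rw [e1, e2] at h2
      rw [h2] at hr
      simp at hr

end Words

section Signed

variable {V : Type*} [DecidableEq V]

/-- Signed injective words in `U ∪ D` which use all letters of `D` and leave an independent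
subset of `U` unused. -/
def SW (Γ : SimpleGraph V) (U D : Finset V) : Set (List (V × Bool)) :=
  {l | (l.map Prod.fst).Nodup ∧ (∀ a ∈ l, a.1 ∈ U ∪ D) ∧ (∀ d ∈ D, d ∈ l.map Prod.fst) ∧
    ∀ u ∈ U, ∀ v ∈ U, u ∉ l.map Prod.fst → v ∉ l.map Prod.fst → ¬ Γ.Adj u v}

lemma SW_convex (Γ : SimpleGraph V) (U D : Finset V) : ∀ x ∈ SW Γ U D, ∀ x', lbd x x' ≠ 0 →
    x' ∉ SW Γ U D → ∀ x'', lbd x' x'' ≠ 0 → x'' ∉ SW Γ U D := by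
  intro x hx x' h hx' x'' h' hx''
  apply hx'
  obtain ⟨a, y, b, rfl, rfl⟩ := exists_of_lbd_ne_zero h
  obtain ⟨a', y', b', hh, rfl⟩ := exists_of_lbd_ne_zero h'
  obtain ⟨h1, h2, h3, h4⟩ := hx
  obtain ⟨k1, k2, k3, k4⟩ := hx''
  have hsub : ∀ v, v ∈ (a' ++ b').map Prod.fst → v ∈ (a ++ b).map Prod.fst := by
    intro v hv
    rw [hh]
    simp only [List.map_append, List.map_cons, List.mem_append, List.mem_cons] at hv ⊢
    tauto
  refine ⟨?_, ?_, ?_, ?_⟩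
  · refine h1.sublist ?_
    exact List.Sublist.map _ ((List.Sublist.refl a).append (List.sublist_cons_self y b))
  · intro c hc
    apply h2
    simp only [List.mem_append, List.mem_cons] at hc ⊢
    tauto
  · intro d hd
    exact hsub d (k3 d hd)
  · intro u hu v hv hu' hv'
    exact k4 u hu v hv (fun h => hu' (hsub u h)) (fun h => hv' (hsub v h))

/-- The underlying set of letters of a signed word. -/
def lset (w : List (V × Bool)) : Finset V := (w.map Prod.fst).toFinset

lemma mem_lset {w : List (V × Bool)} {v : V} : v ∈ lset w ↔ v ∈ w.map Prod.fst :=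
  List.mem_toFinset

lemma mem_SW_append (Γ : SimpleGraph V) (U D : Finset V) (p l l₀ : List (V × Bool))
    (h₀ : p ++ l₀ ∈ SW Γ U D) :
    p ++ l ∈ SW Γ U D ↔ l ∈ SW Γ (U \ lset p) (D \ lset p) := by
  obtain ⟨h1, h2, h3, h4⟩ := h₀
  have hp : ∀ a ∈ p, a.1 ∈ U ∪ D := fun a ha => h2 a (List.mem_append_left _ ha)
  rw [List.map_append, List.nodup_append] at h1
  simp only [SW, Set.mem_ofPred_eq, List.map_append, List.nodup_append, List.mem_append,
    Finset.mem_sdiff, Finset.mem_union, mem_lset]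
  constructor
  · rintro ⟨⟨-, k1, k1'⟩, k2, k3, k4⟩
    refine ⟨k1, ?_, ?_, ?_⟩
    · intro a ha
      have h5 : a.1 ∉ p.map Prod.fst := fun h => k1' _ h _ (List.mem_map_of_mem ha) rfl
      rcases k2 a (Or.inr ha) with h | h
      · exact Or.inl ⟨h, h5⟩
      · exact Or.inr ⟨h, h5⟩
    · rintro d ⟨hd, hd'⟩
      exact (k3 d hd).resolve_left hd'
    · rintro u ⟨hu, hu'⟩ v ⟨hv, hv'⟩ hul hvl
      exact k4 u hu v hv (by tauto) (by tauto)
  · rintro ⟨k1, k2, k3, k4⟩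
    refine ⟨⟨h1.1, k1, ?_⟩, ?_, ?_, ?_⟩
    · rintro a ha b hb rfl
      obtain ⟨c, hc, rfl⟩ := List.mem_map.1 hb
      rcases k2 c hc with h | h
      · exact h.2 ha
      · exact h.2 ha
    · rintro a (ha | ha)
      · simpa using hp a ha
      · rcases k2 a ha with h | h
        · exact Or.inl h.1
        · exact Or.inr h.1
    · intro d hd
      by_cases hdp : d ∈ p.map Prod.fst
      · exact Or.inl hdp
      · exact Or.inr (k3 d ⟨hd, hdp⟩)
    · intro u hu v hv hu' hv'
      push Not at hu' hv'
      exact k4 u ⟨hu, hu'.1⟩ v ⟨hv, hv'.1⟩ hu'.2 hv'.2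

lemma Ex_initial (Γ : SimpleGraph V) (U D : Finset V) (w : List (V × Bool)) (r : V × Bool)
    (l₀ : List (V × Bool)) (h₀ : w ++ r :: l₀ ∈ SW Γ U D) (m : ℕ)
    (h : w.length + 1 ≤ m →
      Ex lbd List.length (SW Γ (U \ lset (w ++ [r])) (D \ lset (w ++ [r]))) (m - (w.length + 1))) :
    Ex lbd List.length {l | l ∈ SW Γ U D ∧ ∃ l', l = w ++ r :: l'} m := by
  by_cases hm : w.length + 1 ≤ m
  swap
  · refine Ex.of_forall_deg_ne ?_
    rintro x ⟨-, l', rfl⟩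
    simp
    omega
  have e : ∀ l, w ++ r :: l = (w ++ [r]) ++ l := by simp
  have key := Ex.transfer (bd' := lbd) (deg' := List.length)
    (S' := {l | l ∈ SW Γ U D ∧ ∃ l', l = w ++ r :: l'}) (fun l => w ++ r :: l)
    (w.length + 1) (m - (w.length + 1)) ((-1) ^ (w.length + 1))
    (by rw [← mul_pow]; simp) (by intro a _ b _ hab; simpa using hab) (by
      intro x'
      constructor
      · rintro ⟨hx, l', rfl⟩
        refine ⟨l', ?_, rfl⟩
        rw [e] at hx h₀
        exact (mem_SW_append Γ U D _ _ _ h₀).1 hx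
      · rintro ⟨l', hl', rfl⟩
        refine ⟨?_, l', rfl⟩
        rw [e] at h₀
        rw [e]
        exact (mem_SW_append Γ U D _ _ _ h₀).2 hl') (by
      intro x _
      simp
      omega) (by
      intro x hx y _
      apply lbd_append_append
      intro hr
      have := hx.2.1 r hr
      simp [mem_lset] at this) (h hm)
  rwa [Nat.sub_add_cancel hm] at key

/-- The initial segment of a word up to the first letter `r` of either sign. -/
def pre (r : V) : List (V × Bool) → List (V × Bool)
  | [] => []
  | a :: l => if a.1 = r then [a] else a :: pre r l

lemma pre_append (r : V) (w : List (V × Bool)) (hw : r ∉ w.map Prod.fst) (a : V × Bool)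
    (ha : a.1 = r) (l : List (V × Bool)) : pre r (w ++ a :: l) = w ++ [a] := by
  induction w with
  | nil => simp [pre, ha]
  | cons b w ih =>
    simp only [List.map_cons, List.mem_cons, not_or] at hw
    simp [pre, Ne.symm hw.1, ih hw.2]

lemma exists_pre (r : V) (l : List (V × Bool)) (h : r ∈ l.map Prod.fst) :
    ∃ w a l', r ∉ w.map Prod.fst ∧ a.1 = r ∧ l = w ++ a :: l' := by
  induction l with
  | nil => simp at h
  | cons b l ih =>
    by_cases hb : b.1 = r
    · exact ⟨[], b, l, by simp, hb, rfl⟩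
    · simp only [List.map_cons, List.mem_cons] at h
      obtain ⟨w, a, l', h1, h2, rfl⟩ := ih (h.resolve_left (Ne.symm hb))
      exact ⟨b :: w, a, l', by simp [h1, Ne.symm hb], h2, rfl⟩

lemma pre_face (r : V) (x x' : List (V × Bool)) (h : lbd x x' ≠ 0)
    (hx : (x.map Prod.fst).Nodup) (hx' : r ∈ x'.map Prod.fst) :
    pre r x' = pre r x ∨ (pre r x').length < (pre r x).length := by
  obtain ⟨a, y, b, rfl, rfl⟩ := exists_of_lbd_ne_zero h
  by_cases hra : r ∈ a.map Prod.fst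
  · obtain ⟨w, c, l', h1, h2, rfl⟩ := exists_pre r a hra
    left
    rw [List.append_assoc, List.append_assoc, List.cons_append, List.cons_append,
      pre_append r w h1 c h2, pre_append r w h1 c h2]
  · have hrb : r ∈ b.map Prod.fst := by
      rw [List.map_append, List.mem_append] at hx'
      exact hx'.resolve_left hra
    have hry : r ≠ y.1 := by
      rintro rfl
      rw [List.map_append, List.map_cons, List.nodup_append] at hx
      exact (List.nodup_cons.1 hx.2.1).1 hrb
    obtain ⟨w, c, l', h1, h2, rfl⟩ := exists_pre r b hrb
    right
    rw [← List.append_assoc, show a ++ y :: (w ++ c :: l') = (a ++ y :: w) ++ c :: l' by simp,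
      pre_append r _ _ c h2, pre_append r _ _ c h2]
    · simp
    · simp only [List.map_append, List.map_cons, List.mem_append, List.mem_cons]
      tauto
    · simp only [List.map_append, List.mem_append]
      tauto

lemma card_lset (w : List (V × Bool)) (h : (w.map Prod.fst).Nodup) : (lset w).card = w.length := by
  rw [lset, List.toFinset_card_of_nodup h, List.length_map]

lemma card_bound_aux (U D L : Finset V) (hUD : Disjoint U D) :
    U.card + 2 * D.card ≤ (U \ L).card + 2 * (D \ L).card + 2 * L.card ∧
    (D = ∅ → U.card ≤ (U \ L).card + L.card) ∧
    ∀ r ∈ L, r ∈ U ∪ D → (U \ L).card + (D \ L).card < U.card + D.card := by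
  have h1 := Finset.card_sdiff_add_card_inter U L
  have h2 := Finset.card_sdiff_add_card_inter D L
  have h3 : (U ∩ L).card + (D ∩ L).card ≤ L.card := by
    rw [← Finset.card_union_of_disjoint
      (Finset.disjoint_of_subset_left Finset.inter_subset_left
        (Finset.disjoint_of_subset_right Finset.inter_subset_left hUD))]
    exact Finset.card_le_card (Finset.union_subset Finset.inter_subset_right
      Finset.inter_subset_right)
  refine ⟨by omega, fun _ => by omega, ?_⟩
  intro r hr hrU
  rcases Finset.mem_union.1 hrU with h | h
  · have := Finset.card_pos.2 ⟨r, Finset.mem_inter.2 ⟨h, hr⟩⟩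
    omega
  · have := Finset.card_pos.2 ⟨r, Finset.mem_inter.2 ⟨h, hr⟩⟩
    omega

lemma Ex_cone (Γ : SimpleGraph V) (U : Finset V) (v : V) (hv : v ∈ U)
    (hΓ : ∀ u ∈ U, ∀ w ∈ U, ¬ Γ.Adj u w) (m : ℕ) :
    Ex lbd List.length {l | l ∈ SW Γ U ∅ ∧ (v ∉ l.map Prod.fst ∨ ∃ l', l = (v, true) :: l')} m := by
  classical
  intro z hz hcyc
  have hSW : ∀ l, l ∈ SW Γ U ∅ ↔ (l.map Prod.fst).Nodup ∧ ∀ a ∈ l, a.1 ∈ U := by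
    intro l
    simp only [SW, Set.mem_ofPred_eq, Finset.union_empty, Finset.notMem_empty, IsEmpty.forall_iff,
      implies_true, true_and, and_congr_right_iff]
    intro _
    exact ⟨fun h => h.1, fun h => ⟨h, fun u hu w hw _ _ => hΓ u hu w hw⟩⟩
  set z₀ := z.filter fun l => v ∉ l.map Prod.fst with hz₀
  have hz₀v : ∀ l, z₀ l ≠ 0 → v ∉ l.map Prod.fst ∧ z l ≠ 0 := by
    intro l hl
    by_cases h : v ∉ l.map Prod.fst
    · rw [hz₀, Finsupp.filter_apply, if_pos h] at hl
      exact ⟨h, hl⟩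
    · rw [hz₀, Finsupp.filter_apply, if_neg h] at hl
      exact absurd rfl hl
  refine ⟨Finsupp.mapDomain (List.cons (v, true)) z₀, ?_, ?_⟩
  · intro x hx
    obtain ⟨l, hl, rfl⟩ := Finset.mem_image.1
      (Finsupp.mapDomain_support (Finsupp.mem_support_iff.2 hx))
    obtain ⟨h1, h2⟩ := hz₀v l (Finsupp.mem_support_iff.1 hl)
    obtain ⟨⟨h3, -⟩, h4⟩ := hz l h2
    rw [hSW] at h3
    refine ⟨⟨(hSW _).2 ⟨?_, ?_⟩, Or.inr ⟨l, rfl⟩⟩, by simp [h4]⟩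
    · simp only [List.map_cons, List.nodup_cons]
      exact ⟨h1, h3.1⟩
    · intro a ha
      rcases List.mem_cons.1 ha with rfl | ha
      · exact hv
      · exact h3.2 a ha
  · rintro x ⟨hx, hxv⟩
    rw [bdLin_mapDomain_cons, Finsupp.sub_apply]
    by_cases hvx : v ∉ x.map Prod.fst
    · rw [Finsupp.mapDomain_of_notMem_range, hz₀, Finsupp.filter_apply, if_pos hvx, sub_zero]
      rintro ⟨l, rfl⟩
      simp at hvx
    · obtain ⟨l, rfl⟩ := hxv.resolve_left hvx
      rw [mapDomain_cons_apply_cons, hz₀, Finsupp.filter_apply, if_neg hvx, zero_sub, ← hz₀]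
      rw [hSW] at hx
      simp only [List.map_cons, List.nodup_cons] at hx
      have hl : l ∈ {l | l ∈ SW Γ U ∅ ∧ (v ∉ l.map Prod.fst ∨ ∃ l', l = (v, true) :: l')} :=
        ⟨(hSW l).2 ⟨hx.1.2, fun a ha => hx.2 a (List.mem_cons_of_mem _ ha)⟩, Or.inl hx.1.1⟩
      have h1 := hcyc l hl
      rw [← Finsupp.filter_add_filter_not z (fun l => v ∉ l.map Prod.fst), map_add,
        Finsupp.add_apply, ← hz₀] at h1
      have h2 : bdLin lbd (z.filter fun l => ¬ v ∉ l.map Prod.fst) l = z ((v, true) :: l) := by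
        rw [bdLin_apply, Finsupp.sum, Finset.sum_eq_single ((v, true) :: l)]
        · rw [Finsupp.filter_apply, if_pos hvx, lbd, Finsupp.sub_apply, Finsupp.single_eq_same,
            Finsupp.mapDomain_of_notMem_range]
          · ring
          · rintro ⟨l', rfl⟩
            simp at hx
        · intro b hb hbl
          have hb := Finsupp.mem_support_iff.1 hb
          have hbv : ¬ v ∉ b.map Prod.fst := by
            intro h
            exact hb (by rw [Finsupp.filter_apply, if_neg (not_not.2 h)])
          rw [Finsupp.filter_apply, if_pos hbv] at hb
          obtain ⟨b', rfl⟩ := (hz b hb).1.2.resolve_left hbv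
          rw [lbd, Finsupp.sub_apply, Finsupp.single_apply, if_neg, Finsupp.mapDomain_of_notMem_range]
          · ring
          · rintro ⟨l', rfl⟩
            simp at hx
          · rintro rfl
            exact hbl rfl
        · intro h
          rw [Finsupp.notMem_support_iff.1 h, zero_mul]
      rw [h2] at h1
      linarith

theorem Ex_SW (Γ : SimpleGraph V) : ∀ (k u : ℕ) (U D : Finset V), U.card + D.card = k →
    U.card = u → Disjoint U D → ∀ m, 2 * m + 1 ≤ U.card + 2 * D.card →
    Ex lbd List.length (SW Γ U D) m := by
  intro k
  induction k using Nat.strong_induction_on with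
  | _ k ihk =>
  intro u
  induction u using Nat.strong_induction_on with
  | _ u ihu =>
  intro U D hk hu hUD m hm
  subst hk hu
  have hpre : ∀ (r : V) (hr : r ∈ U ∪ D) (w : List (V × Bool)) (a : V × Bool) (l₀ : List (V × Bool)),
      w ++ a :: l₀ ∈ SW Γ U D → a.1 = r → r ∉ w.map Prod.fst → (r ∈ D ∨ D = ∅) →
      Ex lbd List.length {l | l ∈ SW Γ U D ∧ ∃ l', l = w ++ a :: l'} m := by
    intro r hr w a l₀ h₀ har hrw hD
    refine Ex_initial Γ U D w a l₀ h₀ m fun hwm => ?_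
    have hnd : ((w ++ [a]).map Prod.fst).Nodup := by
      have := h₀.1
      rw [show w ++ a :: l₀ = (w ++ [a]) ++ l₀ by simp, List.map_append, List.nodup_append] at this
      exact this.1
    have hc := card_lset _ hnd
    rw [List.length_append, List.length_singleton] at hc
    have hrL : r ∈ lset (w ++ [a]) := by
      rw [mem_lset]; simp [har]
    obtain ⟨b1, b2, b3⟩ := card_bound_aux U D (lset (w ++ [a])) hUD
    have b3 := b3 r hrL hr
    refine ihk _ b3 _ _ _ rfl rfl ?_ _ ?_
    · exact Finset.disjoint_of_subset_left Finset.sdiff_subset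
        (Finset.disjoint_of_subset_right Finset.sdiff_subset hUD)
    · rcases hD with hD | hD
      · omega
      · have := b2 hD
        subst hD
        simp only [Finset.card_empty, Finset.empty_sdiff] at *
        omega
  rcases D.eq_empty_or_nonempty with rfl | ⟨r, hr⟩
  swap
  · refine Ex.of_filtration (pre r) List.length length_of_lbd_ne_zero bdLin_lbd
      (SW_convex Γ U D) ?_ ?_
    · intro x hx x' hx' h
      exact pre_face r x x' h hx.1 (hx'.2.2.1 r hr)
    · intro P
      by_cases hP : ∃ l₀ ∈ SW Γ U D, pre r l₀ = P
      swap
      · refine Ex.of_forall_deg_ne ?_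
        rintro x ⟨hx, hxP⟩
        exact absurd ⟨x, hx, hxP⟩ hP
      obtain ⟨l₀, hl₀, rfl⟩ := hP
      obtain ⟨w, a, l₁, h1, h2, rfl⟩ := exists_pre r l₀ (hl₀.2.2.1 r hr)
      rw [pre_append r w h1 a h2]
      convert hpre r (Finset.mem_union_right _ hr) w a l₁ hl₀ h2 h1 (Or.inl hr) using 1
      ext l
      simp only [Set.mem_inter_iff, Set.mem_preimage, Set.mem_singleton_iff, Set.mem_ofPred_eq,
        and_congr_right_iff]
      intro hl
      constructor
      · intro h
        obtain ⟨w', a', l', h1', h2', rfl⟩ := exists_pre r l (hl.2.2.1 r hr)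
        rw [pre_append r w' h1' a' h2'] at h
        refine ⟨l', ?_⟩
        rw [show w' ++ a' :: l' = (w' ++ [a']) ++ l' by simp, h]
        simp
      · rintro ⟨l', rfl⟩
        exact pre_append r w h1 a h2 l'
  by_cases hE : ∀ u ∈ U, ∀ w ∈ U, ¬ Γ.Adj u w
  · -- edgeless
    obtain ⟨v, hv⟩ : U.Nonempty := by
      rw [← Finset.card_pos]
      simp at hm
      omega
    classical
    refine Ex.of_filtration
      (fun l => if v ∉ l.map Prod.fst ∨ ∃ l', l = (v, true) :: l' then [] else pre v l)
      List.length length_of_lbd_ne_zero bdLin_lbd (SW_convex Γ U ∅) ?_ ?_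
    · intro x hx x' hx' h
      by_cases h1 : v ∉ x.map Prod.fst ∨ ∃ l', x = (v, true) :: l'
      · rw [if_pos h1, if_pos]
        · exact Or.inl rfl
        · obtain ⟨a, y, b, rfl, rfl⟩ := exists_of_lbd_ne_zero h
          rcases h1 with h1 | ⟨l', h1⟩
          · left
            simp only [List.map_append, List.map_cons, List.mem_append, List.mem_cons] at h1 ⊢
            tauto
          · cases a with
            | nil =>
              left
              simp only [List.nil_append, List.cons.injEq] at h1
              have := hx.1
              simp only [List.nil_append, List.map_cons, List.nodup_cons, h1.1] at this
              exact this.1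
            | cons c a =>
              right
              simp only [List.cons_append, List.cons.injEq] at h1
              exact ⟨a ++ b, by simp [h1.1]⟩
      · rw [if_neg h1]
        push Not at h1
        by_cases h2 : v ∉ x'.map Prod.fst ∨ ∃ l', x' = (v, true) :: l'
        · rw [if_pos h2]
          right
          obtain ⟨w, a, l₁, k1, k2, rfl⟩ := exists_pre v x h1.1
          rw [pre_append v w k1 a k2]
          simp
        · rw [if_neg h2]
          push Not at h2
          exact pre_face v x x' h hx.1 h2.1
    · intro P
      by_cases hP0 : P = []
      · subst hP0
        convert Ex_cone Γ U v hv hE m using 1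
        ext l
        simp only [Set.mem_inter_iff, Set.mem_preimage, Set.mem_singleton_iff, Set.mem_ofPred_eq,
          and_congr_right_iff]
        intro hl
        constructor
        · intro h
          by_contra h1
          rw [if_neg h1] at h
          push Not at h1
          obtain ⟨w, a, l₁, k1, k2, rfl⟩ := exists_pre v l h1.1
          rw [pre_append v w k1 a k2] at h
          simp at h
        · intro h
          rw [if_pos h]
      · by_cases hP : ∃ l₀ ∈ SW Γ U ∅, ¬ (v ∉ l₀.map Prod.fst ∨ ∃ l', l₀ = (v, true) :: l') ∧
            pre v l₀ = P
        swap
        · refine Ex.of_forall_deg_ne ?_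
          rintro x ⟨hx, hxP⟩
          simp only [Set.mem_preimage, Set.mem_singleton_iff] at hxP
          by_cases h : v ∉ x.map Prod.fst ∨ ∃ l', x = (v, true) :: l'
          · rw [if_pos h] at hxP
            exact absurd hxP.symm hP0
          · rw [if_neg h] at hxP
            exact absurd ⟨x, hx, h, hxP⟩ hP
        obtain ⟨l₀, hl₀, hl₁, rfl⟩ := hP
        push Not at hl₁
        obtain ⟨w, a, l₁, h1, h2, rfl⟩ := exists_pre v l₀ hl₁.1
        rw [pre_append v w h1 a h2]
        convert hpre v (Finset.mem_union_left _ hv) w a l₁ hl₀ h2 h1 (Or.inr rfl) using 1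
        ext l
        simp only [Set.mem_inter_iff, Set.mem_preimage, Set.mem_singleton_iff, Set.mem_ofPred_eq,
          and_congr_right_iff]
        intro hl
        constructor
        · intro h
          by_cases h3 : v ∉ l.map Prod.fst ∨ ∃ l', l = (v, true) :: l'
          · rw [if_pos h3] at h
            simp at h
          rw [if_neg h3] at h
          push Not at h3
          obtain ⟨w', a', l', h1', h2', rfl⟩ := exists_pre v l h3.1
          rw [pre_append v w' h1' a' h2'] at h
          refine ⟨l', ?_⟩
          rw [show w' ++ a' :: l' = (w' ++ [a']) ++ l' by simp, h]
          simp
        · rintro ⟨l', rfl⟩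
          rw [if_neg, pre_append v w h1 a h2 l']
          rintro (h | ⟨l'', h⟩)
          · simp [h2] at h
          · cases w with
            | nil =>
              simp only [List.nil_append, List.cons.injEq] at h
              exact hl₁.2 l₁ (by simp [h.1])
            | cons c w =>
              simp only [List.cons_append, List.cons.injEq] at h
              simp [h.1] at h1
  · push Not at hE
    obtain ⟨v, hv, v', hv', hadj⟩ := hE
    classical
    refine Ex.of_filtration (fun l => if v ∈ l.map Prod.fst then 1 else 0) id
      length_of_lbd_ne_zero bdLin_lbd (SW_convex Γ U ∅) ?_ ?_
    · intro x hx x' hx' h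
      by_cases h1 : v ∈ x.map Prod.fst
      · rw [if_pos h1]
        split_ifs
        · left; rfl
        · right; simp
      · rw [if_neg h1, if_neg]
        · exact Or.inl rfl
        · obtain ⟨a, y, b, rfl, rfl⟩ := exists_of_lbd_ne_zero h
          simp only [List.map_append, List.map_cons, List.mem_append, List.mem_cons] at h1 ⊢
          tauto
    · intro i
      simp only [Finset.card_empty, mul_zero, add_zero] at hm
      by_cases hi1 : i = 1
      · subst hi1
        have hc := Finset.card_erase_of_mem hv
        have hc' := Finset.card_pos.2 ⟨v, hv⟩
        convert ihu (U.erase v).card (by omega) (U.erase v) {v}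
          (by rw [Finset.card_singleton, Finset.card_empty]; omega) rfl (by simp) m
          (by rw [Finset.card_singleton]; omega) using 1
        ext l
        simp only [SW, Set.mem_inter_iff, Set.mem_preimage, Set.mem_singleton_iff, Set.mem_ofPred_eq,
          Finset.union_empty, Finset.notMem_empty, IsEmpty.forall_iff, implies_true, true_and,
          Finset.mem_union, Finset.mem_erase, Finset.mem_singleton, forall_eq]
        have hite : (if v ∈ l.map Prod.fst then 1 else 0) = 1 ↔ v ∈ l.map Prod.fst := by
          split_ifs with h <;> simp [h]
        rw [hite]
        constructor
        · rintro ⟨⟨h1, h2, h3⟩, h4⟩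
          refine ⟨h1, ?_, h4, fun u hu w hw => h3 u hu.2 w hw.2⟩
          intro a ha
          by_cases hav : a.1 = v
          · exact Or.inr hav
          · exact Or.inl ⟨hav, h2 a ha⟩
        · rintro ⟨h1, h2, h3, h4⟩
          refine ⟨⟨h1, ?_, ?_⟩, h3⟩
          · intro a ha
            rcases h2 a ha with h | h
            · exact h.2
            · rw [h]; exact hv
          · intro u hu w hw hul hwl
            refine h4 u ⟨?_, hu⟩ w ⟨?_, hw⟩ hul hwl
            · rintro rfl; exact hul h3
            · rintro rfl; exact hwl h3
      · by_cases hi0 : i = 0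
        swap
        · refine Ex.of_forall_deg_ne ?_
          rintro x ⟨-, hx⟩
          simp only [Set.mem_preimage, Set.mem_singleton_iff] at hx
          split_ifs at hx
          · exact absurd hx.symm hi1
          · exact absurd hx.symm hi0
        subst hi0
        set Nv := U.filter fun u => Γ.Adj v u with hNv
        have hNsub : Nv ⊆ U.erase v := by
          intro u hu
          rw [hNv, Finset.mem_filter] at hu
          exact Finset.mem_erase.2 ⟨fun h => Γ.loopless.irrefl v (h ▸ hu.2), hu.1⟩
        have hc := Finset.card_erase_of_mem hv
        have hc' := Finset.card_pos.2 ⟨v, hv⟩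
        have hc2 := Finset.card_sdiff_add_card_eq_card hNsub
        have hc3 : 0 < Nv.card := Finset.card_pos.2 ⟨v', by simp [hNv, hv', hadj]⟩
        convert ihk (((U.erase v) \ Nv).card + Nv.card) (by simp; omega) _ _ _ rfl rfl
          (Finset.sdiff_disjoint) m (by omega) using 1
        ext l
        simp only [SW, Set.mem_inter_iff, Set.mem_preimage, Set.mem_singleton_iff, Set.mem_ofPred_eq,
          Finset.union_empty, Finset.notMem_empty, IsEmpty.forall_iff, implies_true, true_and,
          Finset.sdiff_union_of_subset hNsub, Finset.mem_erase, Finset.mem_sdiff]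
        have hite : (if v ∈ l.map Prod.fst then 1 else 0) = 0 ↔ v ∉ l.map Prod.fst := by
          split_ifs with h <;> simp [h]
        rw [hite]
        constructor
        · rintro ⟨⟨h1, h2, h3⟩, h4⟩
          refine ⟨h1, ?_, ?_, fun u hu w hw => h3 u hu.1.2 w hw.1.2⟩
          · intro a ha
            refine ⟨?_, h2 a ha⟩
            rintro rfl
            exact h4 (List.mem_map_of_mem ha)
          · intro d hd
            rw [hNv, Finset.mem_filter] at hd
            by_contra hdl
            exact h3 v hv d hd.1 h4 hdl hd.2
        · rintro ⟨h1, h2, h3, h4⟩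
          have hvl : v ∉ l.map Prod.fst := by
            intro h
            obtain ⟨a, ha, rfl⟩ := List.mem_map.1 h
            exact (h2 a ha).1 rfl
          refine ⟨⟨h1, fun a ha => (h2 a ha).2, ?_⟩, hvl⟩
          intro u hu w hw hul hwl hadj'
          have huN : u ∉ Nv := fun h => hul (h3 u h)
          have hwN : w ∉ Nv := fun h => hwl (h3 w h)
          by_cases huv : u = v
          · subst huv
            exact hwN (by simp [hNv, hw, hadj'])
          by_cases hwv : w = v
          · subst hwv
            exact huN (by simp [hNv, hu, hadj'.symm])
          exact h4 u ⟨⟨huv, hu⟩, huN⟩ w ⟨⟨hwv, hw⟩, hwN⟩ hul hwl hadj'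

end Signed

section Nielsen

open FreeGroup

variable {N : ℕ}

/-- The digit of a letter. -/
def dg (a : Fin N × Bool) : ℕ := 2 * a.1 + a.2.toNat + 1

lemma dg_pos (a : Fin N × Bool) : 0 < dg a := by simp [dg]

lemma dg_lt (a : Fin N × Bool) : dg a < 2 * N + 3 := by
  have := a.1.2
  have := Bool.toNat_lt a.2
  unfold dg
  omega

lemma dg_inj {a b : Fin N × Bool} (h : dg a = dg b) : a = b := by
  obtain ⟨a1, a2⟩ := a
  obtain ⟨b1, b2⟩ := b
  unfold dg at h
  have h1 := Bool.toNat_lt a2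
  have h2 := Bool.toNat_lt b2
  simp only at h
  ext1
  · ext
    simp only
    omega
  · cases a2 <;> cases b2 <;> simp at * <;> omega

/-- The number whose digits are the letters of a word. -/
def code : List (Fin N × Bool) → ℕ
  | [] => 0
  | a :: l => dg a * (2 * N + 3) ^ l.length + code l

lemma code_append (p m : List (Fin N × Bool)) :
    code (p ++ m) = code p * (2 * N + 3) ^ m.length + code m := by
  induction p with
  | nil => simp [code]
  | cons a p ih =>
    simp only [List.cons_append, code, ih, List.length_append, pow_add]
    ring

lemma code_lt (m : List (Fin N × Bool)) : code m < (2 * N + 3) ^ m.length := by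
  induction m with
  | nil => simp [code]
  | cons a m ih =>
    simp only [code, List.length_cons]
    have h1 := dg_lt a
    calc dg a * (2 * N + 3) ^ m.length + code m
        < dg a * (2 * N + 3) ^ m.length + (2 * N + 3) ^ m.length := by omega
      _ = (dg a + 1) * (2 * N + 3) ^ m.length := by ring
      _ ≤ (2 * N + 3) * (2 * N + 3) ^ m.length := Nat.mul_le_mul_right _ h1
      _ = (2 * N + 3) ^ (m.length + 1) := by ring

lemma code_lt_of_length_lt {p q : List (Fin N × Bool)} (h : p.length < q.length) :
    code p < code q := by
  cases q with
  | nil => simp at h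
  | cons a q =>
    simp only [List.length_cons] at h
    calc code p < (2 * N + 3) ^ p.length := code_lt p
      _ ≤ (2 * N + 3) ^ q.length := Nat.pow_le_pow_right (by omega) (by omega)
      _ ≤ dg a * (2 * N + 3) ^ q.length := Nat.le_mul_of_pos_left _ (dg_pos a)
      _ ≤ code (a :: q) := by simp [code]

lemma length_le_of_code_le {p q : List (Fin N × Bool)} (h : code p ≤ code q) :
    p.length ≤ q.length := by
  by_contra hh
  have := code_lt_of_length_lt (not_le.1 hh)
  omega

lemma code_inj {p q : List (Fin N × Bool)} (h : code p = code q) : p = q := by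
  have hlen : p.length = q.length :=
    le_antisymm (length_le_of_code_le h.le) (length_le_of_code_le h.ge)
  induction p generalizing q with
  | nil => exact (List.length_eq_zero_iff.1 hlen.symm).symm
  | cons a p ih =>
    cases q with
    | nil => simp at hlen
    | cons b q =>
      simp only [List.length_cons, add_left_inj] at hlen
      simp only [code, hlen] at h
      have h1 := code_lt p
      have h2 := code_lt q
      rw [hlen] at h1
      have hab : dg a = dg b := by
        have e1 : (dg a * (2 * N + 3) ^ q.length + code p) / (2 * N + 3) ^ q.length = dg a := by
          rw [mul_comm, Nat.mul_add_div (by positivity), Nat.div_eq_of_lt h1, add_zero]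
        have e2 : (dg b * (2 * N + 3) ^ q.length + code q) / (2 * N + 3) ^ q.length = dg b := by
          rw [mul_comm, Nat.mul_add_div (by positivity), Nat.div_eq_of_lt h2, add_zero]
        rw [← e1, ← e2, h]
      rw [hab] at h
      rw [dg_inj hab, ih (by omega) hlen]

lemma code_append_le {p q : List (Fin N × Bool)} (h : code p ≤ code q) (m : List (Fin N × Bool)) :
    code (p ++ m) ≤ code (q ++ m) := by
  rw [code_append, code_append]
  gcongr

lemma code_append_lt {p q : List (Fin N × Bool)} (h : code p < code q) (m : List (Fin N × Bool)) :
    code (p ++ m) < code (q ++ m) := by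
  rw [code_append, code_append]
  gcongr

/-- The code of the initial major half of a word. -/
def half (L : List (Fin N × Bool)) : ℕ := code (L.take ((L.length + 1) / 2))

/-- A quadratic pairing function which is symmetric and strictly monotone. -/
def sq (A B : ℕ) : ℕ := max A B ^ 2 + min A B

lemma sq_comm (A B : ℕ) : sq A B = sq B A := by simp [sq, max_comm, min_comm]

lemma sq_le {A A' B B' : ℕ} (h : A ≤ A') (h' : B ≤ B') : sq A B ≤ sq A' B' := by
  unfold sq
  gcongr

lemma sq_lt {A A' B B' : ℕ} (h : A < A') (h' : B ≤ B') : sq A B < sq A' B' := by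
  refine lt_of_lt_of_le ?_ (sq_le le_rfl h')
  unfold sq
  rcases le_total A B with h1 | h1
  · rw [max_eq_right h1, min_eq_left h1]
    rcases le_total A' B with h2 | h2
    · rw [max_eq_right h2, min_eq_left h2]
      omega
    · rw [max_eq_left h2, min_eq_right h2]
      have : B ^ 2 ≤ A' ^ 2 := Nat.pow_le_pow_left h2 2
      rcases h1.lt_or_eq with h3 | h3
      · omega
      · subst h3
        have : A ^ 2 < A' ^ 2 := Nat.pow_lt_pow_left h (by norm_num)
        omega
  · rw [max_eq_left h1, min_eq_right h1, max_eq_left (h1.trans h.le), min_eq_right (h1.trans h.le)]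
    have : A ^ 2 < A' ^ 2 := Nat.pow_lt_pow_left h (by norm_num)
    omega

lemma sq_lt_pow {A B M : ℕ} (hA : A < M) (hB : B < M) : sq A B < M ^ 2 := by
  have : sq A B ≤ sq (M - 1) (M - 1) := sq_le (by omega) (by omega)
  refine this.trans_lt ?_
  obtain ⟨M, rfl⟩ : ∃ k, M = k + 1 := ⟨M - 1, by omega⟩
  simp only [sq, Nat.add_sub_cancel, max_self, min_self]
  nlinarith

lemma sq_inj {A B A' B' : ℕ} (h : sq A B = sq A' B') : (A = A' ∧ B = B') ∨ (A = B' ∧ B = A') := by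
  have key : max A B = max A' B' := by
    by_contra hne
    rcases lt_or_gt_of_ne hne with h1 | h1
    · have : sq A B < sq A' B' := by
        unfold sq
        have : min A B ≤ max A B := min_le_max
        have := Nat.pow_le_pow_left (Nat.succ_le_of_lt h1) 2
        simp only [Nat.succ_eq_add_one, add_sq] at this
        omega
      omega
    · have : sq A' B' < sq A B := by
        unfold sq
        have : min A' B' ≤ max A' B' := min_le_max
        have := Nat.pow_le_pow_left (Nat.succ_le_of_lt h1) 2
        simp only [Nat.succ_eq_add_one, add_sq] at this
        omega
      omega
  have key2 : min A B = min A' B' := by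
    unfold sq at h
    rw [key] at h
    omega
  omega

/-- The weight of a word. -/
def wtw (L : List (Fin N × Bool)) : ℕ :=
  (2 * N + 3) ^ (L.length + 1) + sq (half L) (half (invRev L))

lemma half_sq_lt (L : List (Fin N × Bool)) :
    sq (half L) (half (invRev L)) < (2 * N + 3) ^ (L.length + 1) := by
  have h1 : half L < (2 * N + 3) ^ ((L.length + 1) / 2) := by
    refine (code_lt _).trans_le (Nat.pow_le_pow_right (by omega) (by simp))
  have h2 : half (invRev L) < (2 * N + 3) ^ ((L.length + 1) / 2) := by
    refine (code_lt _).trans_le (Nat.pow_le_pow_right (by omega) (by simp))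
  refine (sq_lt_pow h1 h2).trans_le ?_
  rw [← pow_mul]
  exact Nat.pow_le_pow_right (by omega) (by omega)

lemma wtw_invRev (L : List (Fin N × Bool)) : wtw (invRev L) = wtw L := by
  unfold wtw
  rw [invRev_invRev, invRev_length, sq_comm]

lemma wtw_lt_of_length_lt {L L' : List (Fin N × Bool)} (h : L.length < L'.length) :
    wtw L < wtw L' := by
  have h1 := half_sq_lt L
  have h2 : (2 * N + 3) ^ (L.length + 1 + 1) ≤ (2 * N + 3) ^ (L'.length + 1) :=
    Nat.pow_le_pow_right (by omega) (by omega)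
  rw [pow_succ _ (L.length + 1)] at h2
  unfold wtw
  have h3 : 0 < (2 * N + 3) ^ (L.length + 1) := by positivity
  nlinarith

lemma length_le_of_wtw_le {L L' : List (Fin N × Bool)} (h : wtw L ≤ wtw L') :
    L.length ≤ L'.length := by
  by_contra hh
  have := wtw_lt_of_length_lt (not_le.1 hh)
  omega

lemma eq_of_half_eq {L L' : List (Fin N × Bool)} (hl : L.length = L'.length)
    (h1 : half L = half L') (h2 : half (invRev L) = half (invRev L')) : L = L' := by
  have h1 := code_inj h1
  have h2 := code_inj h2
  rw [invRev_length, invRev_length, ← hl] at h2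
  rw [← hl] at h1
  have h3 : L.drop ((L.length + 1) / 2) = L'.drop ((L.length + 1) / 2) := by
    have e : ∀ K : List (Fin N × Bool), K.length = L.length →
        K.drop ((L.length + 1) / 2) =
        (invRev ((invRev K).take ((L.length + 1) / 2))).drop (2 * ((L.length + 1) / 2) - L.length) := by
      intro K hK
      have e1 : invRev ((invRev K).take ((L.length + 1) / 2)) =
          K.drop (L.length - (L.length + 1) / 2) := by
        have : invRev K = invRev (K.drop (L.length - (L.length + 1) / 2)) ++
            invRev (K.take (L.length - (L.length + 1) / 2)) := by
          rw [← invRev_append, List.take_append_drop]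
        rw [this, List.take_left', invRev_invRev]
        rw [invRev_length, List.length_drop, hK]
        omega
      rw [e1, List.drop_drop]
      congr 1
      omega
    rw [e L rfl, e L' hl.symm, h2]
  rw [← List.take_append_drop ((L.length + 1) / 2) L, h1, h3, List.take_append_drop]

lemma wtw_inj {L L' : List (Fin N × Bool)} (h : wtw L = wtw L') : L = L' ∨ L = invRev L' := by
  have hl : L.length = L'.length :=
    le_antisymm (length_le_of_wtw_le h.le) (length_le_of_wtw_le h.ge)
  have hs : sq (half L) (half (invRev L)) = sq (half L') (half (invRev L')) := by
    unfold wtw at h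
    rw [hl] at h
    omega
  rcases sq_inj hs with ⟨h1, h2⟩ | ⟨h1, h2⟩
  · exact Or.inl (eq_of_half_eq hl h1 h2)
  · right
    refine eq_of_half_eq (by rw [hl, invRev_length]) h1 ?_
    rw [h2, invRev_invRev]

lemma wtw_compare {p p' d r r' : List (Fin N × Bool)} (hp : code p ≤ code p')
    (hr : code r ≤ code r') (h1 : 2 * p.length ≤ (p ++ d ++ invRev r).length)
    (h2 : 2 * r.length ≤ (p ++ d ++ invRev r).length) :
    wtw (p ++ d ++ invRev r) ≤ wtw (p' ++ d ++ invRev r') ∧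
      (code p < code p' → wtw (p ++ d ++ invRev r) < wtw (p' ++ d ++ invRev r')) := by
  have hpl := length_le_of_code_le hp
  have hrl := length_le_of_code_le hr
  simp only [List.length_append, invRev_length] at h1 h2
  by_cases hlt : p.length + d.length + r.length < p'.length + d.length + r'.length
  · have := wtw_lt_of_length_lt (L := p ++ d ++ invRev r) (L' := p' ++ d ++ invRev r') (by simp; omega)
    exact ⟨this.le, fun _ => this⟩
  have hpe : p.length = p'.length := by omega
  have hre : r.length = r'.length := by omega
  have hhalf : ∀ q s : List (Fin N × Bool), q.length = p.length → s.length = r.length →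
      half (q ++ d ++ invRev s) =
        code (q ++ d.take ((p.length + d.length + r.length + 1) / 2 - p.length)) := by
    intro q s hq hs
    unfold half
    have e : (q ++ d ++ invRev s).length = p.length + d.length + r.length := by
      simp [hq, hs]; omega
    rw [e, List.take_append_of_le_length (by simp; omega), List.take_append,
      List.take_of_length_le (by omega), hq]
  have hhalf' : ∀ q s : List (Fin N × Bool), q.length = p.length → s.length = r.length →
      half (invRev (q ++ d ++ invRev s)) =
        code (s ++ (invRev d).take ((p.length + d.length + r.length + 1) / 2 - r.length)) := by
    intro q s hq hs
    unfold half
    have e : (invRev (q ++ d ++ invRev s)).length = p.length + d.length + r.length := by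
      simp [hq, hs]; omega
    rw [e, invRev_append, invRev_append, invRev_invRev, ← List.append_assoc,
      List.take_append_of_le_length (by simp; omega), List.take_append,
      List.take_of_length_le (by omega), hs]
  unfold wtw
  rw [hhalf p r rfl rfl, hhalf p' r' hpe.symm hre.symm, hhalf' p r rfl rfl,
    hhalf' p' r' hpe.symm hre.symm]
  have e : (p ++ d ++ invRev r).length = (p' ++ d ++ invRev r').length := by
    simp [hpe, hre]
  rw [e]
  constructor
  · exact Nat.add_le_add_left (sq_le (code_append_le hp _) (code_append_le hr _)) _
  · intro hlt
    exact Nat.add_lt_add_left (sq_lt (code_append_lt hlt _) (code_append_le hr _)) _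

lemma wtw_replace_le {p q t : List (Fin N × Bool)} (h : code p ≤ code q)
    (hp : 2 * p.length ≤ (p ++ t).length) : wtw (p ++ t) ≤ wtw (q ++ t) := by
  have := (wtw_compare (d := t) (r := []) (r' := []) h le_rfl (by simpa using hp) (by simp)).1
  simpa using this

lemma wtw_replace_lt {p q t : List (Fin N × Bool)} (h : code p < code q)
    (hp : 2 * p.length ≤ (p ++ t).length) : wtw (p ++ t) < wtw (q ++ t) := by
  have := (wtw_compare (d := t) (r := []) (r' := []) h.le le_rfl (by simpa using hp)
    (by simp)).2 h
  simpa using this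

/-- The weight of an element of the free group. -/
def wt (g : FreeGroup (Fin N)) : ℕ := wtw g.toWord

lemma wt_inv (g : FreeGroup (Fin N)) : wt g⁻¹ = wt g := by
  rw [wt, wt, toWord_inv, wtw_invRev]

lemma wt_inj {g h : FreeGroup (Fin N)} (e : wt g = wt h) : g = h ∨ g = h⁻¹ := by
  rcases wtw_inj e with h1 | h1
  · exact Or.inl (toWord_injective h1)
  · right
    apply toWord_injective
    rw [toWord_inv, h1]

section Words

variable {α : Type*} [DecidableEq α]

lemma toWord_of_isReduced {L : List (α × Bool)} (h : FreeGroup.IsReduced L) : (mk L).toWord = L := by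
  rw [toWord_mk, h.reduce_eq]

lemma IsReduced_invRev {L : List (α × Bool)} (h : FreeGroup.IsReduced L) : FreeGroup.IsReduced (invRev L) := by
  have := isReduced_toWord (x := (mk L)⁻¹)
  rwa [toWord_inv, toWord_of_isReduced h] at this

lemma isReduced_of_isInfix {β : Type*} {L L' : List (β × Bool)} (h : FreeGroup.IsReduced L)
    (h' : L' <:+: L) : FreeGroup.IsReduced L' := by
  obtain ⟨p, q, rfl⟩ := h'
  exact (List.IsChain.left_of_append h).right_of_append

lemma invRev_singleton {β : Type*} (a : β × Bool) : invRev [a] = [(a.1, !a.2)] := by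
  simp [invRev]

lemma exists_cancellation (L₁ L₂ : List (α × Bool)) (h₁ : FreeGroup.IsReduced L₁) (h₂ : FreeGroup.IsReduced L₂) :
    ∃ u q t, L₁ = u ++ invRev q ∧ L₂ = q ++ t ∧ FreeGroup.IsReduced (u ++ t) := by
  induction L₁ using List.reverseRecOn generalizing L₂ with
  | nil => exact ⟨[], [], L₂, by simp, by simp, by simpa using h₂⟩
  | append_singleton L a ih =>
    have hL : FreeGroup.IsReduced L := isReduced_of_isInfix h₁ ⟨[], [a], by simp⟩
    cases L₂ with
    | nil => exact ⟨L ++ [a], [], [], by simp, by simp, by simpa using h₁⟩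
    | cons c L₂ =>
      by_cases hc : a.1 = c.1 → a.2 = c.2
      · refine ⟨L ++ [a], [], c :: L₂, by simp, by simp, ?_⟩
        have : FreeGroup.IsReduced ([a] ++ c :: L₂) := by
          rw [FreeGroup.IsReduced, List.singleton_append, List.isChain_cons_cons]
          exact ⟨hc, h₂⟩
        have := h₁.append_overlap this (by simp)
        simpa using this
      · push Not at hc
        obtain ⟨u, q, t, rfl, rfl, h3⟩ := ih L₂ hL (isReduced_of_isInfix h₂ ⟨[c], [], by simp⟩)
        refine ⟨u, c :: q, t, ?_, by simp, h3⟩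
        rw [invRev_cons, List.append_assoc, invRev_singleton]
        congr 3
        ext
        · exact hc.1
        · have := hc.2
          revert this
          cases a.2 <;> cases c.2 <;> simp

lemma cancellation_square (q L t u : List (α × Bool)) (hL : FreeGroup.IsReduced L) (hne : L ≠ [])
    (h1 : L = q ++ t) (h2 : L = u ++ invRev q) : 2 * q.length < L.length := by
  induction q generalizing L t u with
  | nil =>
    simpa using List.length_pos_iff.2 hne
  | cons a q ih =>
    rw [invRev_cons, invRev_singleton] at h2
    have hl1 := congrArg List.length h1
    have hl2 := congrArg List.length h2
    simp only [List.length_cons, List.length_append, invRev_length, List.length_nil] at hl1 hl2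
    -- strip the last letter of `t`
    rcases List.eq_nil_or_concat t with rfl | ⟨t', c, rfl⟩
    · -- then `u = []` and `q` is its own inverse
      exfalso
      have hu : u = [] := by
        apply List.length_eq_zero_iff.1
        simp at hl1
        omega
      subst hu
      have h3 : mk (a :: q) = (mk (a :: q))⁻¹ := by
        rw [inv_mk, invRev_cons, invRev_singleton]
        rw [h1] at h2
        simpa using congrArg mk h2
      have h4 : mk (a :: q) = 1 := by
        have h5 : mk (a :: q) * mk (a :: q) = 1 := by
          nth_rewrite 1 [h3]
          exact inv_mul_cancel _
        have h6 : (mk (a :: q)) ^ 2 = 1 := by rw [pow_two, h5]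
        by_contra hne
        exact (by norm_num : (2 : ℕ) ≠ 0) ((pow_eq_one_iff_right hne).1 h6)
      have h5 := toWord_of_isReduced hL
      rw [h1, List.append_nil, h4] at h5
      simp at h5
    · have e : (a :: (q ++ t')) ++ [c] = (u ++ invRev q) ++ [(a.1, !a.2)] := by
        rw [h1] at h2
        simpa using h2
      obtain ⟨e1, e2⟩ := List.append_inj' e rfl
      simp only [List.cons.injEq, and_true] at e2
      cases u with
      | nil =>
        -- then the word has length `|q| + 1`
        exfalso
        simp at hl1 hl2
        omega
      | cons b u =>
        simp only [List.cons_append, List.cons.injEq] at e1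
        obtain ⟨rfl, e1⟩ := e1
        have hL' : L = a :: ((q ++ t') ++ [(a.1, !a.2)]) := by
          rw [h1, e2]
          simp
        by_cases hn : q ++ t' = []
        · exfalso
          rw [hL', hn] at hL
          have := hL.rel
          simp at this
        · have := ih (q ++ t') t' u (isReduced_of_isInfix hL ⟨[a], [(a.1, !a.2)], by simp [hL']⟩) hn rfl e1
          rw [hL']
          simp only [List.length_append, List.length_cons, List.length_nil] at this ⊢
          omega

end Words

/-- The invariant of the product `h` of a reduced word whose last letter is `z`. -/
def NInv (h z : FreeGroup (Fin N)) : Prop :=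
  ∃ p m p', z.toWord = p ++ m ∧ h.toWord = p' ++ m ∧ 2 * p.length ≤ (p ++ m).length ∧
    code p ≤ code p' ∧ (p ≠ [] → 2 * p.length = (p ++ m).length → code p < code (invRev m))

lemma NInv.base (z : FreeGroup (Fin N)) : NInv z z :=
  ⟨[], z.toWord, [], by simp, by simp, by simp, by simp, fun h => absurd rfl h⟩

lemma NInv.step {h z t : FreeGroup (Fin N)} (H : NInv h z) (hz : z ≠ 1)
    (hzt : (wt z < wt (z * t) ∧ wt t < wt (z * t)) ∨ z = t) : NInv (h * t) t := by
  obtain ⟨p, m, p', e1, e2, hp, hpp', hst⟩ := H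
  have hzne : z.toWord ≠ [] := fun h => hz (toWord_eq_nil_iff.1 h)
  obtain ⟨u, q, t', c1, c2, hred⟩ := exists_cancellation z.toWord t.toWord
    isReduced_toWord isReduced_toWord
  have hzt' : (z * t).toWord = u ++ t' := by
    have : z * t = mk (u ++ t') := by
      rw [← mk_toWord (x := z), ← mk_toWord (x := t), c1, c2, ← mul_mk, ← mul_mk, ← inv_mk,
        ← mul_mk]
      group
    rw [this, toWord_of_isReduced hred]
  have hlz := congrArg List.length c1
  have hlt := congrArg List.length c2
  simp only [List.length_append, invRev_length] at hlz hlt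
  have hlen : 2 * q.length ≤ z.toWord.length ∧ 2 * q.length ≤ t.toWord.length ∧
      ((2 * q.length = z.toWord.length ∨ 2 * q.length = t.toWord.length) →
        (wt z < wt (z * t) ∧ wt t < wt (z * t))) := by
    rcases hzt with ⟨h1, h2⟩ | rfl
    · have h1' := length_le_of_wtw_le h1.le
      have h2' := length_le_of_wtw_le h2.le
      rw [hzt', List.length_append] at h1' h2'
      exact ⟨by omega, by omega, fun _ => ⟨h1, h2⟩⟩
    · have := cancellation_square q z.toWord t' u isReduced_toWord hzne c2 c1
      exact ⟨by omega, by omega, fun h => by omega⟩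
  obtain ⟨hq1, hq2, hq3⟩ := hlen
  have hlz' := congrArg List.length e1
  rw [List.length_append] at hlz' hp
  obtain ⟨m', rfl⟩ : ∃ m', u = p ++ m' := by
    have : p <+: u ++ invRev q := ⟨m, by rw [← c1, e1]⟩
    obtain ⟨m', hm'⟩ := List.prefix_of_prefix_length_le this (List.prefix_append u _) (by omega)
    exact ⟨m', hm'.symm⟩
  have hm : m = m' ++ invRev q := by
    rw [e1, List.append_assoc] at c1
    exact List.append_cancel_left c1
  rw [List.length_append] at hlz
  have hm' : m' ≠ [] := by
    rintro rfl
    simp only [List.nil_append] at hm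
    simp only [List.length_nil] at hlz
    have hp0 : p ≠ [] := by
      rintro rfl
      simp only [List.length_nil] at hlz
      have := List.length_pos_iff.2 hzne
      omega
    have h1 := hst hp0 (by rw [List.length_append]; omega)
    rw [hm, invRev_invRev] at h1
    have h2 := (hq3 (by omega)).2
    rw [wt, wt, hzt', c2, List.append_nil] at h2
    have h3 := wtw_replace_lt (t := t') h1 (by
      rw [List.length_append]
      omega)
    omega
  have hht : (h * t).toWord = p' ++ m' ++ t' := by
    have hr : FreeGroup.IsReduced (p' ++ m' ++ t') := by
      refine FreeGroup.IsReduced.append_overlap (isReduced_of_isInfix (isReduced_toWord (x := h)) ⟨[], invRev q, ?_⟩)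
        (isReduced_of_isInfix hred ⟨p, [], by simp⟩) hm'
      rw [e2, hm]
      simp
    have : h * t = mk (p' ++ m' ++ t') := by
      rw [← mk_toWord (x := h), ← mk_toWord (x := t), e2, hm, c2]
      simp only [← mul_mk, ← inv_mk]
      group
    rw [this, toWord_of_isReduced hr]
  refine ⟨q, t', p' ++ m', c2, hht, by rw [List.length_append]; omega, ?_, ?_⟩
  · have hl := length_le_of_code_le hpp'
    by_cases hlt' : q.length < (p' ++ m').length
    · exact (code_lt_of_length_lt hlt').le
    rw [List.length_append] at hlt'
    refine le_trans ?_ (code_append_le hpp' m')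
    by_contra hlt''
    have h2 := (hq3 (by omega)).2
    rw [wt, wt, hzt', c2] at h2
    have h3 := wtw_replace_lt (t := t') (not_le.1 hlt'') (by
      simp only [List.length_append]
      omega)
    omega
  · intro hq0 hqt
    rw [List.length_append] at hqt
    by_contra hcode
    have h2 := (hq3 (by omega)).1
    rw [← wt_inv z, ← wt_inv (z * t), wt, wt, toWord_inv, toWord_inv, hzt', c1] at h2
    have h3 := wtw_replace_le (t := invRev (p ++ m')) (not_lt.1 hcode) (by
      simp only [List.length_append, invRev_length]
      omega)
    simp only [invRev_append, invRev_invRev] at h2 h3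
    omega

lemma NInv.combine {h₁ h₂ z : FreeGroup (Fin N)} (hz : z ≠ 1) (H₁ : NInv h₁ z)
    (H₂ : NInv h₂ z⁻¹) : wt z ≤ wt (h₁ * z⁻¹ * h₂⁻¹) := by
  have hzne : z.toWord ≠ [] := fun h => hz (toWord_eq_nil_iff.1 h)
  obtain ⟨p, m, p', e1, e2, hp, hpp', hst⟩ := H₁
  obtain ⟨r, n, r', f1, f2, hr, hrr', hst'⟩ := H₂
  rw [toWord_inv] at f1
  have f1' : z.toWord = invRev n ++ invRev r := by
    rw [← invRev_append, ← f1, invRev_invRev]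
  have hl1 := congrArg List.length e1
  have hl2 := congrArg List.length f1'
  simp only [List.length_append, invRev_length] at hl1 hl2 hp hr
  obtain ⟨d, hd⟩ : ∃ d, invRev n = p ++ d := by
    have : p <+: invRev n ++ invRev r := ⟨m, by rw [← f1', e1]⟩
    obtain ⟨d, hd⟩ := List.prefix_of_prefix_length_le this (List.prefix_append _ _)
      (by rw [invRev_length]; omega)
    exact ⟨d, hd.symm⟩
  have hzw : z.toWord = p ++ d ++ invRev r := by rw [f1', hd]
  have hm : m = d ++ invRev r := by
    rw [e1, List.append_assoc] at hzw
    exact List.append_cancel_left hzw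
  have hn : n = invRev d ++ invRev p := by
    rw [← invRev_append, ← hd, invRev_invRev]
  have hl3 := congrArg List.length hzw
  simp only [List.length_append, invRev_length] at hl3
  have hd0 : d ≠ [] := by
    rintro rfl
    simp only [List.length_nil] at hl3
    have hpos := List.length_pos_iff.2 hzne
    have h1 := hst (by rintro rfl; simp at hl3 hp; omega) (by rw [List.length_append]; omega)
    have h2 := hst' (by rintro rfl; simp at hl3 hr; omega) (by rw [List.length_append]; omega)
    rw [hm] at h1
    rw [hn] at h2
    simp only [List.nil_append, invRev_invRev, invRev_empty] at h1 h2
    omega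
  have hw : (h₁ * z⁻¹ * h₂⁻¹).toWord = p' ++ d ++ invRev r' := by
    have hred : FreeGroup.IsReduced (p' ++ d ++ invRev r') := by
      refine FreeGroup.IsReduced.append_overlap (isReduced_of_isInfix (isReduced_toWord (x := h₁)) ⟨[], invRev r, ?_⟩)
        (isReduced_of_isInfix (IsReduced_invRev (isReduced_toWord (x := h₂))) ⟨p, [], ?_⟩) hd0
      · rw [e2, hm]
        simp
      · rw [f2, invRev_append, hd]
        simp
    have : h₁ * z⁻¹ * h₂⁻¹ = mk (p' ++ d ++ invRev r') := by
      rw [← mk_toWord (x := h₁), ← mk_toWord (x := h₂), ← mk_toWord (x := z), e2, f2, hzw, hm, hn]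
      simp only [← mul_mk, ← inv_mk]
      group
    rw [this, toWord_of_isReduced hred]
  rw [wt, wt, hw, hzw]
  refine (wtw_compare hpp' hrr' ?_ ?_).1
  · simp only [List.length_append, invRev_length]
    omega
  · simp only [List.length_append, invRev_length]
    omega

/-- Two elements whose products with arbitrary signs are heavier than the factors. -/
def Good (x y : FreeGroup (Fin N)) : Prop :=
  ∀ x' y', (x' = x ∨ x' = x⁻¹) → (y' = y ∨ y' = y⁻¹) → wt x < wt (x' * y') ∧ wt y < wt (x' * y')

lemma Good.symm {x y : FreeGroup (Fin N)} (h : Good x y) : Good y x := by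
  intro y' x' hy hx
  have := h x'⁻¹ y'⁻¹ (by rcases hx with rfl | rfl <;> simp) (by rcases hy with rfl | rfl <;> simp)
  rw [← mul_inv_rev, wt_inv] at this
  exact this.symm

variable {ι : Type*}

/-- The value of a letter. -/
def lv (b : ι → FreeGroup (Fin N)) (x : ι × Bool) : FreeGroup (Fin N) :=
  cond x.2 (b x.1) (b x.1)⁻¹

lemma lv_or (b : ι → FreeGroup (Fin N)) (x : ι × Bool) : lv b x = b x.1 ∨ lv b x = (b x.1)⁻¹ := by
  unfold lv
  cases x.2 <;> simp

lemma lv_neg (b : ι → FreeGroup (Fin N)) (x : ι × Bool) : lv b (x.1, !x.2) = (lv b x)⁻¹ := by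
  unfold lv
  cases x.2 <;> simp

lemma wt_lv (b : ι → FreeGroup (Fin N)) (x : ι × Bool) : wt (lv b x) = wt (b x.1) := by
  rcases lv_or b x with h | h <;> simp [h, wt_inv]

lemma lift_mk_eq (b : ι → FreeGroup (Fin N)) (L : List (ι × Bool)) :
    lift b (mk L) = (L.map (lv b)).prod := by
  rw [lift_mk]
  rfl

lemma NInv_prod (b : ι → FreeGroup (Fin N)) (hb : ∀ i j, i ≠ j → Good (b i) (b j))
    (hb1 : ∀ i, b i ≠ 1) (L : List (ι × Bool)) (s : ι × Bool) (hL : FreeGroup.IsReduced (L ++ [s])) :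
    NInv (lift b (mk (L ++ [s]))) (lv b s) := by
  induction L using List.reverseRecOn generalizing s with
  | nil =>
    simp only [List.nil_append, lift_mk_eq, List.map_cons, List.map_nil, List.prod_singleton]
    exact NInv.base _
  | append_singleton L a ih =>
    have h1 := ih a (isReduced_of_isInfix hL ⟨[], [s], by simp⟩)
    have e : lift b (mk (L ++ [a] ++ [s])) = lift b (mk (L ++ [a])) * lv b s := by
      rw [← mul_mk, _root_.map_mul, lift_mk_eq b [s]]
      simp
    rw [e]
    refine h1.step ?_ ?_
    · rcases lv_or b a with h | h <;> simp [h, hb1]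
    · by_cases has : a.1 = s.1
      · right
        have h2 : FreeGroup.IsReduced [a, s] := isReduced_of_isInfix hL ⟨L, [], by simp⟩
        have h3 := h2.rel has
        rw [Prod.ext has h3]
      · left
        have := hb _ _ has _ _ (lv_or b a) (lv_or b s)
        rwa [wt_lv, wt_lv]

theorem wt_le_of_mem [DecidableEq ι] (b : ι → FreeGroup (Fin N))
    (hb : ∀ i j, i ≠ j → Good (b i) (b j)) (hb1 : ∀ i, b i ≠ 1) (u : FreeGroup ι) (s : ι × Bool)
    (hs : s ∈ u.toWord) : wt (b s.1) ≤ wt (lift b u) := by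
  obtain ⟨L, R, hLR⟩ := List.append_of_mem hs
  have hred := isReduced_toWord (x := u)
  rw [hLR] at hred
  have h1 := NInv_prod b hb hb1 L s (isReduced_of_isInfix hred ⟨[], R, by simp⟩)
  have hinv : invRev (s :: R) = invRev R ++ [(s.1, !s.2)] := by
    rw [invRev_cons, invRev_singleton]
  have h2 := NInv_prod b hb hb1 (invRev R) (s.1, !s.2) (by
    rw [← hinv]
    exact IsReduced_invRev (isReduced_of_isInfix hred ⟨L, [], by simp⟩))
  rw [← hinv, lv_neg, ← inv_mk, _root_.map_inv] at h2
  have h3 := h1.combine (by rcases lv_or b s with h | h <;> simp [h, hb1]) h2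
  rw [wt_lv] at h3
  convert h3 using 2
  rw [← mk_toWord (x := u), hLR, ← mul_mk, ← mul_mk, _root_.map_mul, _root_.map_mul, inv_inv]
  have e : mk (s :: R) = mk [s] * mk R := by rw [mul_mk]; rfl
  rw [e, _root_.map_mul, lift_mk_eq b [s]]
  simp only [List.map_cons, List.map_nil, List.prod_singleton]
  group

/-- The elements of a subgroup that are not products of lighter elements. -/
def minGen (H : Subgroup (FreeGroup (Fin N))) : Set (FreeGroup (Fin N)) :=
  {h | h ∈ H ∧ h ∉ Subgroup.closure {h' | h' ∈ H ∧ wt h' < wt h}}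

lemma mem_closure_range_iff (b : ι → FreeGroup (Fin N)) (h : FreeGroup (Fin N)) :
    h ∈ Subgroup.closure (Set.range b) ↔ ∃ u, lift b u = h := by
  rw [← FreeGroup.range_lift_eq_closure, MonoidHom.mem_range]

theorem image_minGen (b : ι → FreeGroup (Fin N))
    (hb : ∀ i j, i ≠ j → Good (b i) (b j)) (hinj : Function.Injective (lift b)) :
    wt '' minGen (Subgroup.closure (Set.range b)) = Set.range fun i => wt (b i) := by
  classical
  have hb1 : ∀ i, b i ≠ 1 := by
    intro i h
    have : lift b (of i) = lift b 1 := by simp [h]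
    exact of_ne_one i (hinj this)
  have hsub : ∀ (u : FreeGroup ι) (T : Set (FreeGroup (Fin N))),
      (∀ s ∈ u.toWord, b s.1 ∈ T) → lift b u ∈ Subgroup.closure T := by
    intro u T hT
    rw [← mk_toWord (x := u), lift_mk_eq]
    apply Subgroup.list_prod_mem
    intro x hx
    obtain ⟨s, hs, rfl⟩ := List.mem_map.1 hx
    have : b s.1 ∈ Subgroup.closure T := Subgroup.subset_closure (hT s hs)
    rcases lv_or b s with h | h <;> simp [h, this]
  ext x
  constructor
  · rintro ⟨h, ⟨hH, hmin⟩, rfl⟩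
    obtain ⟨u, rfl⟩ := (mem_closure_range_iff b h).1 hH
    by_contra hne
    apply hmin
    apply hsub
    intro s hs
    refine ⟨Subgroup.subset_closure ⟨s.1, rfl⟩, lt_of_le_of_ne (wt_le_of_mem b hb hb1 u s hs) ?_⟩
    intro heq
    exact hne ⟨s.1, heq⟩
  · rintro ⟨i, rfl⟩
    refine ⟨b i, ⟨Subgroup.subset_closure ⟨i, rfl⟩, ?_⟩, rfl⟩
    intro hmem
    have h1 : Subgroup.closure {h' | h' ∈ Subgroup.closure (Set.range b) ∧ wt h' < wt (b i)} ≤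
        (MonoidHom.ker (lift fun j => if j = i then (of i : FreeGroup ι) else 1)).map (lift b) := by
      rw [Subgroup.closure_le]
      rintro h ⟨hH, hlt⟩
      obtain ⟨u, rfl⟩ := (mem_closure_range_iff b h).1 hH
      refine ⟨u, ?_, rfl⟩
      rw [SetLike.mem_coe, MonoidHom.mem_ker, ← mk_toWord (x := u), lift_mk]
      apply List.prod_eq_one
      intro x hx
      obtain ⟨s, hs, rfl⟩ := List.mem_map.1 hx
      have hsi : s.1 ≠ i := by
        rintro rfl
        have := wt_le_of_mem b hb hb1 u s hs
        omega
      simp [hsi]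
    obtain ⟨u, hu, hui⟩ := h1 hmem
    have : u = of i := hinj (by simpa using hui)
    subst this
    rw [SetLike.mem_coe, MonoidHom.mem_ker] at hu
    simp at hu

end Nielsen

section LBD

variable {A B : Type*}

lemma lbd_map (f : A → B) (l : List A) :
    lbd (l.map f) = Finsupp.mapDomain (List.map f) (lbd l) := by
  induction l with
  | nil => simp [lbd]
  | cons a l ih =>
    rw [List.map_cons, lbd, lbd, ih, Finsupp.mapDomain_sub, Finsupp.mapDomain_single,
      ← Finsupp.mapDomain_comp, ← Finsupp.mapDomain_comp]
    rfl

lemma mem_of_lbd_ne_zero {l l' : List A} (h : lbd l l' ≠ 0) : ∀ x ∈ l', x ∈ l := by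
  obtain ⟨a, y, b, rfl, rfl⟩ := exists_of_lbd_ne_zero h
  intro x hx
  simp only [List.mem_append, List.mem_cons] at hx ⊢
  tauto

lemma nodup_of_lbd_ne_zero {l l' : List A} (f : A → B) (h : lbd l l' ≠ 0)
    (hl : (l.map f).Nodup) : (l'.map f).Nodup := by
  obtain ⟨a, y, b, rfl, rfl⟩ := exists_of_lbd_ne_zero h
  exact hl.sublist (List.Sublist.map _ ((List.Sublist.refl a).append (List.sublist_cons_self y b)))

end LBD

section Complex

open FreeGroup

variable {F : Type*} [Group F]

/-- The vertex deletion boundary; deleted vertices are moved to the subgroup. -/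
def bdW (τ : List F × Subgroup F) : (List F × Subgroup F) →₀ ℤ :=
  Finsupp.mapDomain (fun l' => (l', τ.2 ⊔ Subgroup.closure {x | x ∈ τ.1 ∧ x ∉ l'})) (lbd τ.1)

lemma exists_of_bdW_ne_zero {τ τ' : List F × Subgroup F} (h : bdW τ τ' ≠ 0) :
    lbd τ.1 τ'.1 ≠ 0 ∧ τ'.2 = τ.2 ⊔ Subgroup.closure {x | x ∈ τ.1 ∧ x ∉ τ'.1} := by
  classical
  have h1 : τ' ∈ (bdW τ).support := by simpa using h
  have h2 := Finsupp.mapDomain_support h1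
  obtain ⟨l', hl', rfl⟩ := Finset.mem_image.1 h2
  exact ⟨by simpa using hl', rfl⟩

lemma length_of_bdW_ne_zero (τ τ' : List F × Subgroup F) (h : bdW τ τ' ≠ 0) :
    τ.1.length = τ'.1.length + 1 :=
  length_of_lbd_ne_zero _ _ (exists_of_bdW_ne_zero h).1

lemma bdLin_bdW (τ : List F × Subgroup F) : bdLin bdW (bdW τ) = 0 := by
  classical
  obtain ⟨l, H⟩ := τ
  rw [bdW, bdLin, Finsupp.linearCombination_mapDomain, Finsupp.linearCombination_apply]
  have : ((lbd l).sum fun i a => a • (bdW ∘ fun l' : List F =>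
      (l', H ⊔ Subgroup.closure {x | x ∈ l ∧ x ∉ l'})) i) =
      Finsupp.mapDomain (fun l' => (l', H ⊔ Subgroup.closure {x | x ∈ l ∧ x ∉ l'}))
        (bdLin lbd (lbd l)) := by
    rw [bdLin, Finsupp.linearCombination_apply, Finsupp.sum, Finsupp.sum,
      Finsupp.mapDomain_finsetSum]
    refine Finset.sum_congr rfl fun l' hl' => ?_
    rw [Finsupp.mapDomain_smul]
    congr 1
    rw [Function.comp, bdW]
    refine Finsupp.mapDomain_congr fun l'' hl'' => ?_
    have h1 := mem_of_lbd_ne_zero (by simpa using hl')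
    have h2 := mem_of_lbd_ne_zero (by simpa using hl'')
    rw [Prod.mk.injEq]
    refine ⟨rfl, ?_⟩
    simp only
    rw [sup_assoc, ← Subgroup.closure_union]
    congr 2
    ext x
    simp only [Set.mem_union, Set.mem_ofPred_eq]
    have := h1 x
    have := h2 x
    tauto
  rw [this, bdLin_lbd, Finsupp.mapDomain_zero]

end Complex

section Bases

open FreeGroup

variable {N : ℕ}

/-- Bases of a free group. -/
def IsBas {ι : Type*} {F : Type*} [Group F] (y : ι → F) : Prop :=
  Function.Bijective (FreeGroup.lift y)

lemma IsBas.comp_lift {ι : Type*} {F : Type*} [Group F] {y : ι → F} (hy : IsBas y)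
    {c : ι → FreeGroup ι} (hc : IsBas c) : IsBas fun i => lift y (c i) := by
  have : lift (fun i => lift y (c i)) = (lift y).comp (lift c) := by
    ext
    simp
  rw [IsBas, this, MonoidHom.coe_comp]
  exact Function.Bijective.comp hy hc

lemma isBas_of_inverse {ι : Type*} {c d : ι → FreeGroup ι} (h1 : ∀ i, lift c (d i) = of i)
    (h2 : ∀ i, lift d (c i) = of i) : IsBas c := by
  rw [IsBas, Function.bijective_iff_has_inverse]
  refine ⟨lift d, fun x => ?_, fun x => ?_⟩
  · have : (lift d).comp (lift c) = MonoidHom.id _ := by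
      ext
      simp [h2]
    exact DFunLike.congr_fun this x
  · have : (lift c).comp (lift d) = MonoidHom.id _ := by
      ext
      simp [h1]
    exact DFunLike.congr_fun this x

lemma isBas_update {ι : Type*} [DecidableEq ι] (i j : ι) (hij : i ≠ j) (e d : Bool) :
    IsBas (Function.update (of : ι → FreeGroup ι) i
      (cond e (of i) (of i)⁻¹ * cond d (of j) (of j)⁻¹)) := by
  refine isBas_of_inverse (d := Function.update (of : ι → FreeGroup ι) i
    (cond e (of i * cond d (of j)⁻¹ (of j)) (cond d (of j) (of j)⁻¹ * (of i)⁻¹))) ?_ ?_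
  · intro k
    by_cases hk : k = i
    · subst hk
      cases e <;> cases d <;> simp [hij.symm]
    · simp [hk]
  · intro k
    by_cases hk : k = i
    · subst hk
      cases e <;> cases d <;> simp [hij.symm]
    · simp [hk]

lemma IsBas.update {ι : Type*} [DecidableEq ι] {y : ι → FreeGroup (Fin N)} (hy : IsBas y) (i j : ι)
    (hij : i ≠ j) (e d : Bool) :
    IsBas (Function.update y i (lv y (i, e) * lv y (j, d))) := by
  convert hy.comp_lift (isBas_update i j hij e d) using 1
  ext k
  by_cases hk : k = i
  · subst hk
    cases e <;> cases d <;> simp [lv]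
  · simp [hk]

/-- The coordinate homomorphism to the integers. -/
def coord {ι : Type*} [DecidableEq ι] (i : ι) : FreeGroup ι →* Multiplicative ℤ :=
  lift fun j => if j = i then Multiplicative.ofAdd 1 else 1

lemma IsBas.eq_of_lv_eq {ι : Type*} {y : ι → FreeGroup (Fin N)} (hy : IsBas y) {a b : ι × Bool}
    (h : lv y a = lv y b) : a = b := by
  classical
  obtain ⟨i, e⟩ := a
  obtain ⟨j, d⟩ := b
  have h' : cond e (of i) (of i)⁻¹ = cond d (of j) (of j)⁻¹ := by
    apply hy.1
    cases e <;> cases d <;> simpa [lv] using h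
  have h2 := congrArg (coord i) h'
  by_cases hij : j = i
  · subst hij
    cases e <;> cases d <;> simp [coord] at h2 ⊢ <;> exact absurd h2 (by decide)
  · cases e <;> cases d <;> simp [coord, hij] at h2

lemma wt_eq_iff_lv {ι : Type*} {y y' : ι → FreeGroup (Fin N)} {i j : ι} (h : wt (y i) = wt (y' j)) :
    ∃ b, y i = lv y' (j, b) := by
  rcases wt_inj h with h | h
  · exact ⟨true, h⟩
  · exact ⟨false, h⟩

lemma IsBas.wt_injective {ι : Type*} {y : ι → FreeGroup (Fin N)} (hy : IsBas y) :
    Function.Injective fun i => wt (y i) := by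
  intro i j h
  obtain ⟨b, hb⟩ := wt_eq_iff_lv (y := y) (y' := y) h
  have : lv y (i, true) = lv y (j, b) := hb
  exact congrArg Prod.fst (hy.eq_of_lv_eq this)

lemma Good.lv {ι : Type*} {y : ι → FreeGroup (Fin N)} {a b : ι × Bool}
    (h : Good (y a.1) (y b.1)) : Good (HV.lv y a) (HV.lv y b) := by
  intro x' y' hx hy
  rw [wt_lv, wt_lv]
  refine h x' y' ?_ ?_
  · rcases lv_or y a with e | e <;> rw [e] at hx <;> simpa [or_comm] using hx
  · rcases lv_or y b with e | e <;> rw [e] at hy <;> simpa [or_comm] using hy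

lemma Good.of_lv {ι : Type*} {y : ι → FreeGroup (Fin N)} {a b : ι × Bool}
    (h : Good (HV.lv y a) (HV.lv y b)) : Good (y a.1) (y b.1) := by
  intro x' y' hx hy
  rw [← wt_lv y a, ← wt_lv y b]
  refine h x' y' ?_ ?_
  · rcases lv_or y a with e | e <;> rw [e] <;> simpa [or_comm] using hx
  · rcases lv_or y b with e | e <;> rw [e] <;> simpa [or_comm] using hy

lemma exists_lower {ι : Type*} {y : ι → FreeGroup (Fin N)} (hy : IsBas y) {i j : ι} (hij : i ≠ j)
    (h : ¬ Good (y i) (y j)) : ∃ k l : ι, ((k = i ∧ l = j) ∨ (k = j ∧ l = i)) ∧ ∃ e d,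
      wt (lv y (k, e) * lv y (l, d)) < wt (y k) := by
  classical
  have key : ∀ (k l : ι) (e d : Bool), k ≠ l → wt (lv y (k, e) * lv y (l, d)) ≠ wt (y k) := by
    intro k l e d hkl heq
    have h' : ∃ b, lv y (k, e) * lv y (l, d) = lv y (k, b) := by
      rcases wt_inj heq with h | h
      · exact ⟨true, h⟩
      · exact ⟨false, h⟩
    obtain ⟨b, hb⟩ := h'
    have h' : cond e (of k) (of k)⁻¹ * cond d (of l) (of l)⁻¹ = cond b (of k) (of k)⁻¹ := by
      apply hy.1
      cases e <;> cases d <;> cases b <;> simpa [lv] using hb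
    have h2 := congrArg (coord l) h'
    cases e <;> cases d <;> cases b <;> simp [coord, hkl] at h2
  unfold Good at h
  push Not at h
  obtain ⟨x', y', hx, hy', hle⟩ := h
  obtain ⟨e, rfl⟩ : ∃ e, x' = lv y (i, e) := by
    rcases hx with rfl | rfl
    exacts [⟨true, rfl⟩, ⟨false, rfl⟩]
  obtain ⟨d, rfl⟩ : ∃ d, y' = lv y (j, d) := by
    rcases hy' with rfl | rfl
    exacts [⟨true, rfl⟩, ⟨false, rfl⟩]
  by_cases h1 : wt (y i) < wt (lv y (i, e) * lv y (j, d))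
  · refine ⟨j, i, Or.inr ⟨rfl, rfl⟩, !d, !e, lt_of_le_of_ne ?_ (key _ _ _ _ hij.symm)⟩
    have := hle h1
    rwa [← wt_inv, mul_inv_rev, ← lv_neg, ← lv_neg] at this
  · exact ⟨i, j, Or.inl ⟨rfl, rfl⟩, e, d, lt_of_le_of_ne (not_lt.1 h1) (key _ _ _ _ hij)⟩

/-- The simplex determined by a basis and a signed word of indices. -/
def ev {ι : Type*} (y : ι → FreeGroup (Fin N)) (w : List (ι × Bool)) :
    List (FreeGroup (Fin N)) × Subgroup (FreeGroup (Fin N)) :=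
  (w.map (lv y), Subgroup.closure (y '' {i | i ∉ w.map Prod.fst}))

lemma IsBas.ev_injOn {ι : Type*} {y : ι → FreeGroup (Fin N)} (hy : IsBas y) :
    Function.Injective (ev y) := by
  intro w w' h
  exact List.map_injective_iff.2 (fun a b h => hy.eq_of_lv_eq h) (congrArg Prod.fst h)

lemma bdW_ev {ι : Type*} {y : ι → FreeGroup (Fin N)} (hy : IsBas y) {w : List (ι × Bool)}
    (hw : (w.map Prod.fst).Nodup) : bdW (ev y w) = Finsupp.mapDomain (ev y) (lbd w) := by
  rw [bdW, ev, lbd_map, ← Finsupp.mapDomain_comp]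
  refine Finsupp.mapDomain_congr fun w' hw' => ?_
  replace hw' : lbd w w' ≠ 0 := by simpa using hw'
  have h2 := nodup_of_lbd_ne_zero Prod.fst hw' hw
  rw [Function.comp, ev, Prod.mk.injEq]
  refine ⟨rfl, ?_⟩
  rw [← Subgroup.closure_union]
  have hsub := mem_of_lbd_ne_zero hw'
  have hinj := List.inj_on_of_nodup_map hw
  apply le_antisymm
  · rw [Subgroup.closure_le]
    rintro x (⟨i, hi, rfl⟩ | ⟨hx, hx'⟩)
    · apply Subgroup.subset_closure
      refine ⟨i, fun hi' => hi ?_, rfl⟩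
      obtain ⟨a, ha, rfl⟩ := List.mem_map.1 hi'
      exact List.mem_map_of_mem (hsub _ ha)
    · obtain ⟨a, ha, rfl⟩ := List.mem_map.1 hx
      have hmem : y a.1 ∈ Subgroup.closure (y '' {i | i ∉ w'.map Prod.fst}) := by
        apply Subgroup.subset_closure
        refine ⟨a.1, fun hi' => hx' ?_, rfl⟩
        obtain ⟨b, hb, hba⟩ := List.mem_map.1 hi'
        rw [← hinj (hsub _ hb) ha hba]
        exact List.mem_map_of_mem hb
      rcases lv_or y a with e | e <;> rw [e]
      · exact hmem
      · exact inv_mem hmem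
  · rw [Subgroup.closure_le]
    rintro x ⟨i, hi, rfl⟩
    by_cases hiw : i ∈ w.map Prod.fst
    · obtain ⟨a, ha, rfl⟩ := List.mem_map.1 hiw
      have hmem : lv y a ∈ Subgroup.closure (y '' {i | i ∉ w.map Prod.fst} ∪
          {x | x ∈ w.map (lv y) ∧ x ∉ w'.map (lv y)}) := by
        apply Subgroup.subset_closure
        right
        refine ⟨List.mem_map_of_mem ha, fun hh => hi ?_⟩
        obtain ⟨b, hb, hba⟩ := List.mem_map.1 hh
        rw [← hy.eq_of_lv_eq hba]
        exact List.mem_map_of_mem hb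
      rcases lv_or y a with e | e <;> rw [e] at hmem
      · exact hmem
      · exact inv_mem_iff.1 hmem
    · exact Subgroup.subset_closure (Or.inl ⟨i, hiw, rfl⟩)

/-- The partial bases with a complementary free factor. -/
def Valid (N : ℕ) : Set (List (FreeGroup (Fin N)) × Subgroup (FreeGroup (Fin N))) :=
  {τ | ∃ (y : Fin N → FreeGroup (Fin N)) (w : List (Fin N × Bool)), IsBas y ∧
    (w.map Prod.fst).Nodup ∧ ev y w = τ}

lemma Valid.face {τ τ' : List (FreeGroup (Fin N)) × Subgroup (FreeGroup (Fin N))}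
    (h : τ ∈ Valid N) (h' : bdW τ τ' ≠ 0) : τ' ∈ Valid N := by
  classical
  obtain ⟨y, w, hy, hw, rfl⟩ := h
  rw [bdW_ev hy hw] at h'
  have h2 := Finsupp.mapDomain_support (Finsupp.mem_support_iff.2 h')
  obtain ⟨w', hw', rfl⟩ := Finset.mem_image.1 h2
  exact ⟨y, w', hy, nodup_of_lbd_ne_zero _ (by simpa using hw') hw, rfl⟩

lemma exists_reduction (w : List (Fin N × Bool)) :
    ∀ (k : ℕ) (y : Fin N → FreeGroup (Fin N)), IsBas y → ∑ i, wt (y i) = k →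
      ∃ y', IsBas y' ∧ ev y' w = ev y w ∧
        (∀ i j, i ∉ w.map Prod.fst → j ∉ w.map Prod.fst → i ≠ j → Good (y' i) (y' j)) ∧
        (y' = y ∨ ∑ i, wt (y' i) < ∑ i, wt (y i)) := by
  intro k
  induction k using Nat.strong_induction_on with
  | _ k ih =>
  intro y hy hk
  by_cases hgood : ∀ i j, i ∉ w.map Prod.fst → j ∉ w.map Prod.fst → i ≠ j → Good (y i) (y j)
  · exact ⟨y, hy, rfl, hgood, Or.inl rfl⟩
  push Not at hgood
  obtain ⟨i, j, hi, hj, hij, hng⟩ := hgood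
  obtain ⟨a, b, hab, e, d, hlt⟩ := exists_lower hy hij hng
  have ha : a ∉ w.map Prod.fst := by rcases hab with ⟨rfl, rfl⟩ | ⟨rfl, rfl⟩ <;> assumption
  have hb : b ∉ w.map Prod.fst := by rcases hab with ⟨rfl, rfl⟩ | ⟨rfl, rfl⟩ <;> assumption
  have hne : a ≠ b := by rcases hab with ⟨rfl, rfl⟩ | ⟨rfl, rfl⟩ <;> [exact hij; exact hij.symm]
  clear hi hj hij hng hab
  set y₁ := Function.update y a (lv y (a, e) * lv y (b, d)) with hy₁
  have hy₁b : IsBas y₁ := hy.update a b hne e d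
  have hne1 : ∀ c, c ≠ a → y₁ c = y c := fun c hc => by simp [hy₁, hc]
  have hy₁a : y₁ a = lv y (a, e) * lv y (b, d) := by simp [hy₁]
  have hsum : ∑ i, wt (y₁ i) < ∑ i, wt (y i) := by
    refine Finset.sum_lt_sum (fun c _ => ?_) ⟨a, Finset.mem_univ _, by rwa [hy₁a]⟩
    by_cases hc : c = a
    · subst hc
      rw [hy₁a]
      exact hlt.le
    · rw [hne1 c hc]
  have hev : ev y₁ w = ev y w := by
    unfold ev
    congr 1
    · refine List.map_congr_left fun c hc => ?_
      have : c.1 ≠ a := by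
        rintro rfl
        exact ha (List.mem_map_of_mem hc)
      simp [lv, hne1 _ this]
    · set C := {i | i ∉ w.map Prod.fst}
      have hyC : ∀ c ∈ C, ∀ f, lv y (c, f) ∈ Subgroup.closure (y '' C) := by
        intro c hc f
        have : y c ∈ Subgroup.closure (y '' C) := Subgroup.subset_closure ⟨c, hc, rfl⟩
        rcases lv_or y (c, f) with h | h <;> rw [h]
        · exact this
        · exact inv_mem this
      apply le_antisymm
      · rw [Subgroup.closure_le]
        rintro x ⟨c, hc, rfl⟩
        by_cases hca : c = a
        · subst hca
          rw [hy₁a]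
          exact mul_mem (hyC _ ha _) (hyC _ hb _)
        · rw [hne1 c hca]
          exact Subgroup.subset_closure ⟨c, hc, rfl⟩
      · rw [Subgroup.closure_le]
        rintro x ⟨c, hc, rfl⟩
        have hb' : lv y (b, d) ∈ Subgroup.closure (y₁ '' C) := by
          have : y₁ b ∈ Subgroup.closure (y₁ '' C) := Subgroup.subset_closure ⟨b, hb, rfl⟩
          rw [hne1 b hne.symm] at this
          rcases lv_or y (b, d) with h | h <;> rw [h]
          · exact this
          · exact inv_mem this
        by_cases hca : c = a
        · subst hca
          have h1 : y₁ c ∈ Subgroup.closure (y₁ '' C) := Subgroup.subset_closure ⟨c, hc, rfl⟩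
          rw [hy₁a] at h1
          have h2 := (Subgroup.mul_mem_cancel_right _ hb').1 h1
          rcases lv_or y (c, e) with h | h <;> rw [h] at h2
          · exact h2
          · exact inv_mem_iff.1 h2
        · rw [← hne1 c hca]
          exact Subgroup.subset_closure ⟨c, hc, rfl⟩
  obtain ⟨y₂, h1, h2, h3, h4⟩ := ih _ (hk ▸ hsum) y₁ hy₁b rfl
  refine ⟨y₂, h1, h2.trans hev, h3, Or.inr ?_⟩
  rcases h4 with rfl | h4
  · exact hsum
  · exact h4.trans hsum

/-- The weights of a minimal basis compatible with a simplex. -/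
def wset (τ : List (FreeGroup (Fin N)) × Subgroup (FreeGroup (Fin N))) : Set ℕ :=
  wt '' {x | x ∈ τ.1} ∪ wt '' minGen τ.2

lemma wset_ev {y : Fin N → FreeGroup (Fin N)} (hy : IsBas y) (w : List (Fin N × Bool))
    (hg : ∀ i j, i ∉ w.map Prod.fst → j ∉ w.map Prod.fst → i ≠ j → Good (y i) (y j)) :
    wset (ev y w) = Set.range fun i => wt (y i) := by
  have h1 : y '' {i | i ∉ w.map Prod.fst} =
      Set.range fun i : {i // i ∉ w.map Prod.fst} => y i := by
    ext x
    simp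
  have hinj : Function.Injective (lift fun i : {i // i ∉ w.map Prod.fst} => y i) := by
    have : lift (fun i : {i // i ∉ w.map Prod.fst} => y i) =
        (lift y).comp (FreeGroup.map Subtype.val) := by
      ext
      simp
    rw [this, MonoidHom.coe_comp]
    exact hy.1.comp (FreeGroup.map_injective Subtype.val_injective)
  have h2 := image_minGen (fun i : {i // i ∉ w.map Prod.fst} => y i)
    (fun i j hij => hg i j i.2 j.2 fun h => hij (Subtype.ext h)) hinj
  rw [wset, ev, h1, h2]
  ext x
  constructor
  · rintro (⟨g, hg, rfl⟩ | ⟨i, rfl⟩)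
    · obtain ⟨a, ha, rfl⟩ := List.mem_map.1 hg
      exact ⟨a.1, (wt_lv y a).symm⟩
    · exact ⟨i, rfl⟩
  · rintro ⟨i, rfl⟩
    by_cases hi : i ∈ w.map Prod.fst
    · obtain ⟨a, ha, rfl⟩ := List.mem_map.1 hi
      exact Or.inl ⟨lv y a, List.mem_map_of_mem ha, wt_lv y a⟩
    · exact Or.inr ⟨⟨i, hi⟩, rfl⟩

lemma Valid.exists_good {τ : List (FreeGroup (Fin N)) × Subgroup (FreeGroup (Fin N))}
    (h : τ ∈ Valid N) : ∃ (y : Fin N → FreeGroup (Fin N)) (w : List (Fin N × Bool)), IsBas y ∧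
      (w.map Prod.fst).Nodup ∧ ev y w = τ ∧
      (∀ i j, i ∉ w.map Prod.fst → j ∉ w.map Prod.fst → i ≠ j → Good (y i) (y j)) := by
  obtain ⟨y, w, hy, hw, rfl⟩ := h
  obtain ⟨y', h1, h2, h3, -⟩ := exists_reduction w _ y hy rfl
  exact ⟨y', w, h1, hw, h2, h3⟩

lemma Ex_piece (P : Set ℕ) (m : ℕ) (hm : 2 * m + 1 ≤ N) :
    Ex bdW (fun τ => τ.1.length) (Valid N ∩ wset ⁻¹' {P}) m := by
  classical
  by_cases hP : (Valid N ∩ wset ⁻¹' {P}).Nonempty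
  swap
  · refine Ex.of_forall_deg_ne fun x hx => ?_
    exact absurd ⟨x, hx⟩ hP
  obtain ⟨τ₀, hτ₀, hτP⟩ := hP
  obtain ⟨y, w₀, hy, -, rfl, hg⟩ := Valid.exists_good hτ₀
  have hPy : P = Set.range fun i => wt (y i) := by
    rw [← wset_ev hy w₀ hg]
    exact hτP.symm
  let Γ : SimpleGraph (Fin N) :=
    { Adj := fun i j => i ≠ j ∧ ¬ Good (y i) (y j)
      symm := ⟨fun i j h => ⟨h.1.symm, fun hg => h.2 hg.symm⟩⟩
      loopless := ⟨fun i h => h.1 rfl⟩ }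
  have hmem : ∀ w, w ∈ SW Γ Finset.univ ∅ ↔ (w.map Prod.fst).Nodup ∧
      ∀ i j, i ∉ w.map Prod.fst → j ∉ w.map Prod.fst → i ≠ j → Good (y i) (y j) := by
    intro w
    constructor
    · rintro ⟨h1, -, -, h4⟩
      refine ⟨h1, fun i j hi hj hij => ?_⟩
      by_contra hh
      exact h4 i (Finset.mem_univ _) j (Finset.mem_univ _) hi hj ⟨hij, hh⟩
    · rintro ⟨h1, h2⟩
      exact ⟨h1, by simp, by simp, fun i _ j _ hi hj hadj => hadj.2 (h2 i j hi hj hadj.1)⟩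
  have hex := Ex_SW Γ _ _ Finset.univ ∅ rfl rfl (Finset.disjoint_empty_right _) m (by simpa using hm)
  refine Ex.transfer (ev y) 0 m 1 (by norm_num) hy.ev_injOn.injOn ?_ ?_ ?_ hex
  · intro τ
    constructor
    · rintro ⟨hτ, hτw⟩
      obtain ⟨y', w', hy', hw', rfl, hg'⟩ := Valid.exists_good hτ
      have hr : (Set.range fun i => wt (y' i)) = Set.range fun i => wt (y i) := by
        rw [← hPy, ← wset_ev hy' w' hg']
        exact hτw
      have hex : ∀ i, ∃ a : Fin N × Bool, y' i = lv y a := by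
        intro i
        obtain ⟨j, hj⟩ : wt (y' i) ∈ Set.range fun i => wt (y i) := hr ▸ ⟨i, rfl⟩
        obtain ⟨b, hb⟩ := wt_eq_iff_lv (y := y') (y' := y) hj.symm
        exact ⟨(j, b), hb⟩
      choose σ hσ using hex
      have hσinj : Function.Injective fun i => (σ i).1 := by
        intro i j hij
        apply hy'.wt_injective
        simp only [hσ, wt_lv]
        simp only at hij
        rw [hij]
      have hσsurj := Finite.injective_iff_surjective.1 hσinj
      have hlv : ∀ a, lv y' a = lv y ((σ a.1).1, (σ a.1).2 == a.2) := by
        rintro ⟨i, b⟩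
        unfold lv
        simp only [hσ]
        unfold lv
        cases (σ i).2 <;> cases b <;> simp
      let w := w'.map fun a => ((σ a.1).1, (σ a.1).2 == a.2)
      have hwfst : w.map Prod.fst = (w'.map Prod.fst).map fun i => (σ i).1 := by
        simp [w, Function.comp_def]
      have hnot : ∀ i, (σ i).1 ∉ w.map Prod.fst ↔ i ∉ w'.map Prod.fst := by
        intro i
        rw [hwfst, List.mem_map_of_injective hσinj]
      refine ⟨w, (hmem w).2 ⟨?_, ?_⟩, ?_⟩
      · rw [hwfst]
        exact hw'.map hσinj
      · intro i j hi hj hij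
        obtain ⟨i, rfl⟩ := hσsurj i
        obtain ⟨j, rfl⟩ := hσsurj j
        have := hg' i j ((hnot i).1 hi) ((hnot j).1 hj) (fun h => hij (by rw [h]))
        rw [hσ i, hσ j] at this
        exact this.of_lv
      · unfold ev
        congr 1
        · simp only [w, List.map_map]
          exact List.map_congr_left fun a _ => (hlv a).symm
        · apply le_antisymm
          · rw [Subgroup.closure_le]
            rintro _ ⟨i, hi, rfl⟩
            obtain ⟨i, rfl⟩ := hσsurj i
            have : y' i ∈ Subgroup.closure (y' '' {i | i ∉ w'.map Prod.fst}) :=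
              Subgroup.subset_closure ⟨i, (hnot i).1 hi, rfl⟩
            rw [hσ i] at this
            rcases lv_or y (σ i) with h | h <;> rw [h] at this
            · exact this
            · exact inv_mem_iff.1 this
          · rw [Subgroup.closure_le]
            rintro _ ⟨i, hi, rfl⟩
            have : y (σ i).1 ∈ Subgroup.closure (y '' {i | i ∉ w.map Prod.fst}) :=
              Subgroup.subset_closure ⟨_, (hnot i).2 hi, rfl⟩
            rw [hσ i]
            rcases lv_or y (σ i) with h | h <;> rw [h]
            · exact this
            · exact inv_mem this
    · rintro ⟨w, hw, rfl⟩
      obtain ⟨h1, h2⟩ := (hmem w).1 hw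
      exact ⟨⟨y, w, hy, h1, rfl⟩, by rw [Set.mem_preimage, wset_ev hy w h2, hPy]; rfl⟩
  · intro w _
    simp [ev]
  · intro w hw w' _
    rw [bdW_ev hy hw.1, Finsupp.mapDomain_apply hy.ev_injOn, one_mul]

theorem Ex_Valid (m : ℕ) (hm : 2 * m + 1 ≤ N) :
    Ex bdW (fun τ => τ.1.length) (Valid N) m := by
  classical
  refine Ex.of_filtration wset (fun P => ∑ᶠ x ∈ P, x) (fun τ τ' h => length_of_bdW_ne_zero τ τ' h)
    bdLin_bdW ?_ ?_ fun P => Ex_piece P m hm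
  · intro x hx x' h h'
    exact absurd (Valid.face hx h) h'
  · intro τ hτ τ' _ hne
    obtain ⟨y, w, hy, hw, rfl, hg⟩ := Valid.exists_good hτ
    rw [bdW_ev hy hw] at hne
    have h2 := Finsupp.mapDomain_support (Finsupp.mem_support_iff.2 hne)
    obtain ⟨w', hw', rfl⟩ := Finset.mem_image.1 h2
    obtain ⟨y', h1, h2, h3, h4⟩ := exists_reduction w' _ y hy rfl
    rw [← h2, wset_ev hy w hg, wset_ev h1 w' h3]
    rcases h4 with rfl | h4
    · exact Or.inl rfl
    · right
      rw [finsum_mem_range hy.wt_injective, finsum_mem_range h1.wt_injective,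
        finsum_eq_sum_of_fintype, finsum_eq_sum_of_fintype]
      exact h4

end Bases

section Lists

variable {A B C : Type*}

/-- The linear extension of a map into a free abelian group. -/
abbrev lx {X Y : Type*} (f : X → Y →₀ ℤ) : (X →₀ ℤ) →ₗ[ℤ] (Y →₀ ℤ) :=
  Finsupp.linearCombination ℤ f

lemma lx_single {X Y : Type*} (f : X → Y →₀ ℤ) (x : X) :
    lx f (Finsupp.single x 1) = f x := by
  simp [lx, Finsupp.linearCombination_single]

lemma lx_mapDomain {X Y Z : Type*} (f : Y → Z →₀ ℤ) (g : X → Y) (z : X →₀ ℤ) :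
    lx f (Finsupp.mapDomain g z) = lx (fun x => f (g x)) z :=
  Finsupp.linearCombination_mapDomain _ _ _

lemma mapDomain_lx {X Y Z : Type*} (f : X → Y →₀ ℤ) (g : Y → Z) (z : X →₀ ℤ) :
    Finsupp.mapDomain g (lx f z) = lx (fun x => Finsupp.mapDomain g (f x)) z := by
  change Finsupp.lmapDomain ℤ ℤ g (lx f z) = _
  rw [lx, Finsupp.apply_linearCombination]
  rfl

lemma mapDomain_eq_lx {X Y : Type*} (g : X → Y) (z : X →₀ ℤ) :
    Finsupp.mapDomain g z = lx (fun x => Finsupp.single (g x) 1) z := by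
  rw [lx, Finsupp.linearCombination_apply, Finsupp.mapDomain]
  simp

lemma lx_lx {X Y Z : Type*} (f : Y → Z →₀ ℤ) (g : X → Y →₀ ℤ) (z : X →₀ ℤ) :
    lx f (lx g z) = lx (fun x => lx f (g x)) z := by
  rw [lx, lx, Finsupp.apply_linearCombination]
  rfl

lemma lx_sub {X Y : Type*} (f g : X → Y →₀ ℤ) (z : X →₀ ℤ) :
    lx (fun x => f x - g x) z = lx f z - lx g z := by
  simp [lx, Finsupp.linearCombination_apply, Finsupp.sum, smul_sub]

lemma lx_add {X Y : Type*} (f g : X → Y →₀ ℤ) (z : X →₀ ℤ) :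
    lx (fun x => f x + g x) z = lx f z + lx g z := by
  simp [lx, Finsupp.linearCombination_apply, Finsupp.sum, smul_add, Finset.sum_add_distrib]

lemma lx_zero {X Y : Type*} (z : X →₀ ℤ) : lx (fun _ : X => (0 : Y →₀ ℤ)) z = 0 := by
  simp [lx, Finsupp.linearCombination_apply]

/-- The prism operator on words. -/
def prl (f f' : A → B) : List A → (List B →₀ ℤ)
  | [] => 0
  | v :: l => Finsupp.single (f' v :: f v :: l.map f) 1 -
      Finsupp.mapDomain (List.cons (f' v)) (prl f f' l)

lemma lx_lbd_cons (a : A) (z : List A →₀ ℤ) :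
    lx lbd (Finsupp.mapDomain (List.cons a) z) =
      z - Finsupp.mapDomain (List.cons a) (lx lbd z) := bdLin_mapDomain_cons a z

lemma lx_lbd_lbd (l : List A) : lx lbd (lbd l) = 0 := bdLin_lbd l

lemma lx_prl_cons (f f' : A → B) (a : A) (z : List A →₀ ℤ) :
    lx (prl f f') (Finsupp.mapDomain (List.cons a) z) =
      Finsupp.mapDomain (fun l => f' a :: f a :: l.map f) z -
      Finsupp.mapDomain (List.cons (f' a)) (lx (prl f f') z) := by
  rw [lx_mapDomain, mapDomain_lx, mapDomain_eq_lx, ← lx_sub]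
  rfl

theorem prl_homotopy (f f' : A → B) (l : List A) :
    lx lbd (prl f f' l) + lx (prl f f') (lbd l) =
      Finsupp.single (l.map f) 1 - Finsupp.single (l.map f') 1 := by
  induction l with
  | nil => simp [prl, lbd]
  | cons v l ih =>
    have e1 : lbd (f' v :: f v :: l.map f) = Finsupp.single (f v :: l.map f) 1 -
        Finsupp.single (f' v :: l.map f) 1 +
        Finsupp.mapDomain (fun l => f' v :: f v :: l.map f) (lbd l) := by
      rw [lbd, lbd, lbd_map, Finsupp.mapDomain_sub, Finsupp.mapDomain_single,
        ← Finsupp.mapDomain_comp, ← Finsupp.mapDomain_comp]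
      rw [sub_sub_eq_add_sub, sub_add_eq_add_sub]
      rfl
    have e2 : lbd (v :: l) = Finsupp.single l 1 - Finsupp.mapDomain (List.cons v) (lbd l) := rfl
    rw [e2, prl, map_sub, lx_single, lx_lbd_cons, e1, map_sub, lx_single, lx_prl_cons,
      eq_sub_of_add_eq ih, Finsupp.mapDomain_sub, Finsupp.mapDomain_sub,
      Finsupp.mapDomain_single, Finsupp.mapDomain_single]
    simp only [List.map_cons]
    abel

lemma prl_map (f f' : B → C) (u : A → B) (l : List A) :
    prl f f' (l.map u) = prl (fun a => f (u a)) (fun a => f' (u a)) l := by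
  induction l with
  | nil => rfl
  | cons a l ih => simp [prl, ih, Function.comp_def]

lemma map_prl (f f' : A → B) (u : B → C) (l : List A) :
    Finsupp.mapDomain (List.map u) (prl f f' l) =
      prl (fun a => u (f a)) (fun a => u (f' a)) l := by
  induction l with
  | nil => simp [prl]
  | cons a l ih =>
    rw [prl, prl, ← ih, Finsupp.mapDomain_sub, Finsupp.mapDomain_single, ← Finsupp.mapDomain_comp,
      ← Finsupp.mapDomain_comp]
    simp [Function.comp_def]

/-- The head and tail of a word. -/
def hd : List A → (A × List A →₀ ℤ)
  | [] => 0
  | a :: l => Finsupp.single (a, l) 1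

/-- The boundary on nonempty words, truncated so that no empty word appears. -/
def tb (p : A × List A) : A × List A →₀ ℤ :=
  hd p.2 - Finsupp.mapDomain (Prod.mk p.1) (lbd p.2)

/-- The prism operator on nonempty words. -/
def prt (f g : A → B) (p : A × List A) : B × List B →₀ ℤ :=
  Finsupp.single (g p.1, f p.1 :: p.2.map f) 1 - Finsupp.mapDomain (Prod.mk (g p.1)) (prl f g p.2)

/-- Applying a map to all letters. -/
def pmp (f : A → B) (p : A × List A) : B × List B := (f p.1, p.2.map f)

lemma hd_map (f : A → B) (l : List A) : hd (l.map f) = Finsupp.mapDomain (pmp f) (hd l) := by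
  cases l <;> simp [hd, pmp, Finsupp.mapDomain_single]

lemma tb_pmp (f : A → B) (p : A × List A) : tb (pmp f p) = Finsupp.mapDomain (pmp f) (tb p) := by
  rw [tb, tb, Finsupp.mapDomain_sub, ← hd_map, ← Finsupp.mapDomain_comp, pmp, lbd_map,
    ← Finsupp.mapDomain_comp]
  rfl

lemma prt_pmp (f f' : B → C) (u : A → B) (p : A × List A) :
    prt f f' (pmp u p) = prt (fun a => f (u a)) (fun a => f' (u a)) p := by
  simp [prt, pmp, prl_map, Function.comp_def]

lemma pmp_prt (f f' : A → B) (u : B → C) (p : A × List A) :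
    Finsupp.mapDomain (pmp u) (prt f f' p) = prt (fun a => u (f a)) (fun a => u (f' a)) p := by
  rw [prt, prt, Finsupp.mapDomain_sub, Finsupp.mapDomain_single, ← Finsupp.mapDomain_comp,
    ← map_prl, ← Finsupp.mapDomain_comp]
  simp [Function.comp_def, pmp]

lemma lx_tb_mk (a : A) (z : List A →₀ ℤ) :
    lx tb (Finsupp.mapDomain (Prod.mk a) z) =
      lx hd z - Finsupp.mapDomain (Prod.mk a) (lx lbd z) := by
  rw [lx_mapDomain, mapDomain_lx, ← lx_sub]
  rfl

lemma lx_hd_cons (a : A) (z : List A →₀ ℤ) :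
    lx hd (Finsupp.mapDomain (List.cons a) z) = Finsupp.mapDomain (Prod.mk a) z := by
  rw [lx_mapDomain, mapDomain_eq_lx]
  rfl

lemma tb_hd (l : List A) : lx tb (hd l) = lx hd (lbd l) := by
  cases l with
  | nil => simp [hd, lbd]
  | cons b l => rw [hd, lx_single, lbd, map_sub, lx_single, lx_hd_cons, tb]

lemma lx_tb_tb (p : A × List A) : lx tb (tb p) = 0 := by
  rw [tb, map_sub, tb_hd, lx_tb_mk, lx_lbd_lbd, Finsupp.mapDomain_zero]
  abel

lemma hd_prl (f f' : A → B) (l : List A) : lx hd (prl f f' l) = lx (prt f f') (hd l) := by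
  cases l with
  | nil => simp [hd, prl]
  | cons b l => rw [hd, lx_single, prl, map_sub, lx_single, lx_hd_cons, hd, prt]

theorem prt_homotopy (f f' : A → B) (p : A × List A) :
    lx tb (prt f f' p) + lx (prt f f') (tb p) =
      Finsupp.single (pmp f p) 1 - Finsupp.single (pmp f' p) 1 := by
  obtain ⟨a, l⟩ := p
  have h1 : lx (prt f f') (Finsupp.mapDomain (Prod.mk a) (lbd l)) =
      Finsupp.mapDomain (fun l => (f' a, f a :: l.map f)) (lbd l) -
        Finsupp.mapDomain (Prod.mk (f' a)) (lx (prl f f') (lbd l)) := by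
    rw [lx_mapDomain, mapDomain_lx, mapDomain_eq_lx, ← lx_sub]
    rfl
  have h2 : tb (f' a, f a :: l.map f) = Finsupp.single (f a, l.map f) 1 -
      Finsupp.single (f' a, l.map f) 1 +
        Finsupp.mapDomain (fun l => (f' a, f a :: l.map f)) (lbd l) := by
    rw [tb, hd, lbd, lbd_map, Finsupp.mapDomain_sub, Finsupp.mapDomain_single,
      ← Finsupp.mapDomain_comp, ← Finsupp.mapDomain_comp, sub_sub_eq_add_sub, sub_add_eq_add_sub]
    rfl
  have e2 : tb (a, l) = hd l - Finsupp.mapDomain (Prod.mk a) (lbd l) := rfl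
  have e3 : prt f f' (a, l) = Finsupp.single (f' a, f a :: l.map f) 1 -
    Finsupp.mapDomain (Prod.mk (f' a)) (prl f f' l) := rfl
  rw [e3, map_sub, lx_single, lx_tb_mk, e2, map_sub, h1, h2, ← hd_prl,
    eq_sub_of_add_eq (prl_homotopy f f' l), Finsupp.mapDomain_sub, Finsupp.mapDomain_sub,
    Finsupp.mapDomain_single, Finsupp.mapDomain_single]
  simp only [pmp]
  abel

end Lists

section Equivariant

variable {G K L S S' S'' : Type*} [Group G] [Group K] [Group L] [MulAction K S']
  [MulAction L S''] [MulAction G S]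

/-- The normalized representative of the orbit of a simplex. -/
def nm (s : S) (p : G × List G) : S × List G := (p.1⁻¹ • s, p.2.map (p.1⁻¹ * ·))

lemma nm_smul (g : G) (s : S) (p : G × List G) : nm (g • s) (pmp (g * ·) p) = nm s p := by
  simp [nm, pmp, smul_smul, Function.comp_def, mul_assoc]

/-- The operator on normalized chains given by an operator on homogeneous chains. -/
def op (σ : S → S') (θ : S → G × List G → (K × List K →₀ ℤ)) :
    (S × List G →₀ ℤ) →ₗ[ℤ] (S' × List K →₀ ℤ) :=
  lx fun x => Finsupp.mapDomain (nm (σ x.1)) (θ x.1 (1, x.2))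

/-- Equivariance of the data of an operator. -/
def Equi (j : G → K) (σ : S → S') (θ : S → G × List G → (K × List K →₀ ℤ)) : Prop :=
  (∀ g s, σ (g • s) = j g • σ s) ∧
    ∀ g s p, θ (g • s) (pmp (g * ·) p) = Finsupp.mapDomain (pmp (j g * ·)) (θ s p)

lemma op_nm {j : G → K} {σ : S → S'} {θ : S → G × List G → (K × List K →₀ ℤ)} (h : Equi j σ θ)
    (s : S) (z : G × List G →₀ ℤ) :
    op σ θ (Finsupp.mapDomain (nm s) z) = Finsupp.mapDomain (nm (σ s)) (lx (θ s) z) := by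
  rw [op, lx_mapDomain, mapDomain_lx]
  congr 2
  ext1 p
  have e : ((1 : G), (nm s p).2) = pmp (p.1⁻¹ * ·) p := by simp [nm, pmp]
  rw [e]
  simp only [nm]
  rw [h.1, h.2, ← Finsupp.mapDomain_comp]
  congr 1
  ext1 x
  exact nm_smul _ _ _

lemma op_comp {j : K → L} {σ : S → S'} {θ : S → G × List G → (K × List K →₀ ℤ)}
    {σ' : S' → S''} {θ' : S' → K × List K → (L × List L →₀ ℤ)} (h : Equi j σ' θ')
    (z : S × List G →₀ ℤ) :
    op σ' θ' (op σ θ z) = op (fun s => σ' (σ s)) (fun s p => lx (θ' (σ s)) (θ s p)) z := by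
  conv_lhs => rw [op.eq_1 σ θ]
  rw [← LinearMap.comp_apply, op.eq_1 (fun s => σ' (σ s))]
  congr 1
  ext1 x
  ext1
  simp only [LinearMap.comp_apply, Finsupp.lsingle_apply, lx_single, op_nm h]

/-- The group-direction boundary. -/
def dl : (S × List G →₀ ℤ) →ₗ[ℤ] (S × List G →₀ ℤ) := op id fun _ => tb

lemma equi_dl : Equi (id : G → G) (id : S → S) fun _ => tb :=
  ⟨fun _ _ => rfl, fun _ _ _ => tb_pmp _ _⟩

lemma dl_dl (z : S × List G →₀ ℤ) : dl (dl z) = 0 := by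
  rw [dl, op_comp equi_dl]
  simp only [lx_tb_tb, op, Finsupp.mapDomain_zero, lx_zero]

/-- The chain map given by maps on vertices. -/
def vm (σ : S → S') (f : S → G → K) : (S × List G →₀ ℤ) →ₗ[ℤ] (S' × List K →₀ ℤ) :=
  op σ fun s p => Finsupp.single (pmp (f s) p) 1

lemma vm_eq_mapDomain (σ : S → S') (f : S → G → K) (z : S × List G →₀ ℤ) :
    vm σ f z = Finsupp.mapDomain (fun x : S × List G =>
      ((f x.1 1)⁻¹ • σ x.1, x.2.map fun v => (f x.1 1)⁻¹ * f x.1 v)) z := by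
  rw [mapDomain_eq_lx, vm, op]
  congr 2
  ext1 x
  rw [Finsupp.mapDomain_single]
  simp [nm, pmp, Function.comp_def]

/-- Equivariance of the data of a chain map. -/
def VEqui (j : G → K) (σ : S → S') (f : S → G → K) : Prop :=
  (∀ g s, σ (g • s) = j g • σ s) ∧ ∀ g s v, f (g • s) (g * v) = j g * f s v

lemma VEqui.equi {j : G → K} {σ : S → S'} {f : S → G → K} (h : VEqui j σ f) :
    Equi j σ fun s p => Finsupp.single (pmp (f s) p) 1 := by
  refine ⟨h.1, fun g s p => ?_⟩
  rw [Finsupp.mapDomain_single]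
  simp [pmp, h.2, Function.comp_def]

lemma dl_vm {j : G → K} {σ : S → S'} {f : S → G → K} (h : VEqui j σ f) (z : S × List G →₀ ℤ) :
    dl (vm σ f z) = vm σ f (dl z) := by
  rw [dl, dl, vm, op_comp equi_dl, op_comp h.equi]
  congr 2
  ext1 s
  ext1 p
  simp only [lx_single, tb_pmp, mapDomain_eq_lx, id]

/-- The homotopy between chain maps. -/
def hm (σ : S → S') (f f' : S → G → K) : (S × List G →₀ ℤ) →ₗ[ℤ] (S' × List K →₀ ℤ) :=
  op σ fun s => prt (f s) (f' s)

theorem hm_homotopy {j : G → K} {σ : S → S'} {f f' : S → G → K} (h : VEqui j σ f)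
    (h' : VEqui j σ f') (z : S × List G →₀ ℤ) :
    dl (hm σ f f' z) + hm σ f f' (dl z) = vm σ f z - vm σ f' z := by
  have he : Equi j σ fun s => prt (f s) (f' s) := by
    refine ⟨h.1, fun g s p => ?_⟩
    change prt (f (g • s)) (f' (g • s)) (pmp _ p) = Finsupp.mapDomain _ (prt (f s) (f' s) p)
    rw [prt_pmp, pmp_prt]
    simp only [h.2, h'.2]
  rw [dl, dl, hm, op_comp equi_dl, op_comp he, vm, vm]
  simp only [op]
  rw [← lx_sub, ← lx_add]
  congr 2
  ext1 x
  simp only [id]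
  rw [← Finsupp.mapDomain_add, prt_homotopy, Finsupp.mapDomain_sub]

/-- The boundary in the direction of the simplices. -/
def pd (bd : S → S →₀ ℤ) : (S × List G →₀ ℤ) →ₗ[ℤ] (S × List G →₀ ℤ) :=
  lx fun x => Finsupp.mapDomain (fun s => (s, x.2)) (bd x.1)

lemma pd_pd (bd : S → S →₀ ℤ) (h : ∀ s, bdLin bd (bd s) = 0) (z : S × List G →₀ ℤ) :
    pd bd (pd bd z) = 0 := by
  rw [pd, lx_lx, ← lx_zero z]
  congr 2
  ext1 x
  rw [lx_mapDomain]
  have := congrArg (Finsupp.mapDomain fun s => (s, x.2)) (h x.1)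
  rw [bdLin, mapDomain_lx, Finsupp.mapDomain_zero] at this
  exact this

lemma dl_pd (bd : S → S →₀ ℤ) (h : ∀ (g : G) s, bd (g • s) = Finsupp.mapDomain (g • ·) (bd s))
    (z : S × List G →₀ ℤ) : dl (pd bd z) = pd bd (dl z) := by
  rw [dl, op, pd, lx_lx, lx_lx]
  congr 2
  ext1 x
  rw [lx_mapDomain, lx_mapDomain]
  have h1 : ∀ p : G × List G, (Finsupp.mapDomain (fun s => (s, (nm x.1 p).2)) (bd (nm x.1 p).1)) =
      lx (fun s => Finsupp.single (nm s p) 1) (bd x.1) := by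
    intro p
    simp only [nm, h, ← mapDomain_eq_lx, ← Finsupp.mapDomain_comp]
    rfl
  simp only [id, h1]
  simp only [mapDomain_eq_lx, lx, Finsupp.linearCombination_apply, Finsupp.smul_sum]
  rw [Finsupp.sum_comm]
  simp only [smul_smul, mul_comm]

end Equivariant

section Supports

variable {A B : Type*}

/-- Chains supported on a set. -/
abbrev Sp {X : Type*} (T : Set X) : Submodule ℤ (X →₀ ℤ) := Finsupp.supported ℤ ℤ T

lemma single_mem_Sp {X : Type*} {T : Set X} {x : X} (h : x ∈ T) : Finsupp.single x (1 : ℤ) ∈ Sp T :=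
  Finsupp.single_mem_supported ℤ 1 h

lemma mem_Sp {X : Type*} {T : Set X} {z : X →₀ ℤ} : z ∈ Sp T ↔ ∀ x, z x ≠ 0 → x ∈ T := by
  rw [Sp, Finsupp.mem_supported, Set.subset_def]
  simp

lemma lx_mem_Sp {X Y : Type*} {T : Set X} {T' : Set Y} {f : X → Y →₀ ℤ} (h : ∀ x ∈ T, f x ∈ Sp T')
    {z : X →₀ ℤ} (hz : z ∈ Sp T) : lx f z ∈ Sp T' := by
  rw [lx, Finsupp.linearCombination_apply]
  exact Submodule.sum_mem _ fun x hx =>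
    Submodule.smul_mem _ _ (h x (mem_Sp.1 hz x (Finsupp.mem_support_iff.1 hx)))

lemma mapDomain_mem_Sp {X Y : Type*} {T : Set X} {T' : Set Y} {f : X → Y} (h : ∀ x ∈ T, f x ∈ T')
    {z : X →₀ ℤ} (hz : z ∈ Sp T) : Finsupp.mapDomain f z ∈ Sp T' := by
  rw [mapDomain_eq_lx]
  exact lx_mem_Sp (fun x hx => single_mem_Sp (h x hx)) hz

lemma lx_congr {X Y : Type*} {T : Set X} {f g : X → Y →₀ ℤ} (h : ∀ x ∈ T, f x = g x)
    {z : X →₀ ℤ} (hz : z ∈ Sp T) : lx f z = lx g z := by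
  rw [lx, lx, Finsupp.linearCombination_apply, Finsupp.linearCombination_apply]
  exact Finsupp.sum_congr fun x hx => by
    rw [h x (mem_Sp.1 hz x (Finsupp.mem_support_iff.1 hx))]

lemma mapDomain_congr_Sp {X Y : Type*} {T : Set X} {f g : X → Y} (h : ∀ x ∈ T, f x = g x)
    {z : X →₀ ℤ} (hz : z ∈ Sp T) : Finsupp.mapDomain f z = Finsupp.mapDomain g z := by
  rw [mapDomain_eq_lx, mapDomain_eq_lx]
  exact lx_congr (fun x hx => by rw [h x hx]) hz

lemma lbd_mem (l : List A) {q : ℕ} (h : l.length = q + 1) :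
    lbd l ∈ Sp {l : List A | l.length = q} := by
  rw [mem_Sp]
  intro x hx
  have := length_of_lbd_ne_zero l x hx
  change x.length = q
  omega

lemma hd_mem (l : List A) {q : ℕ} (h : l.length = q + 1) :
    hd l ∈ Sp {p : A × List A | p.2.length = q} := by
  cases l with
  | nil => simp at h
  | cons a l => exact single_mem_Sp (by simpa using h)

lemma tb_mem (p : A × List A) {q : ℕ} (h : p.2.length = q + 1) :
    tb p ∈ Sp {p : A × List A | p.2.length = q} :=
  Submodule.sub_mem _ (hd_mem _ h) (by
    refine mapDomain_mem_Sp ?_ (lbd_mem _ h)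
    exact fun x hx => hx)

lemma tb_nil (a : A) : tb (a, ([] : List A)) = 0 := by
  simp [tb, hd, lbd]

lemma prl_mem (f f' : A → B) (l : List A) :
    prl f f' l ∈ Sp {l' : List B | l'.length = l.length + 1} := by
  induction l with
  | nil => exact Submodule.zero_mem _
  | cons a l ih =>
    refine Submodule.sub_mem _ (single_mem_Sp (by simp)) (mapDomain_mem_Sp (fun x h => ?_) ih)
    simpa using h

lemma prt_mem (f f' : A → B) (p : A × List A) :
    prt f f' p ∈ Sp {p' : B × List B | p'.2.length = p.2.length + 1} := by
  refine Submodule.sub_mem _ (single_mem_Sp (by simp)) (mapDomain_mem_Sp (fun x h => ?_)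
    (prl_mem f f' p.2))
  simpa using h

end Supports

section EquivariantSupports

variable {G K S S' : Type*} [Group G] [Group K] [MulAction K S'] [MulAction G S]

/-- Chains of group degree `q` on simplices from `T`. -/
abbrev Ch (G : Type*) {S : Type*} (T : Set S) (q : ℕ) : Submodule ℤ (S × List G →₀ ℤ) :=
  Sp {p | p.1 ∈ T ∧ p.2.length = q}

lemma op_mem {σ : S → S'} {θ : S → G × List G → (K × List K →₀ ℤ)} {T : Set S} {T' : Set S'}
    {q q' : ℕ} (hT' : ∀ (g : K), ∀ s ∈ T', g • s ∈ T') (hσ : ∀ s ∈ T, σ s ∈ T')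
    (hθ : ∀ s p, p.2.length = q → θ s p ∈ Sp {p : K × List K | p.2.length = q'})
    {z : S × List G →₀ ℤ} (hz : z ∈ Ch G T q) : op σ θ z ∈ Ch K T' q' := by
  refine lx_mem_Sp (fun x hx => ?_) hz
  refine mapDomain_mem_Sp ?_ (hθ x.1 (1, x.2) hx.2)
  intro y hy
  exact ⟨hT' _ _ (hσ _ hx.1), by simpa [nm] using hy⟩

lemma dl_mem {T : Set S} {q : ℕ} (hT : ∀ (g : G), ∀ s ∈ T, g • s ∈ T) {z : S × List G →₀ ℤ}
    (hz : z ∈ Ch G T (q + 1)) : dl z ∈ Ch G T q :=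
  op_mem hT (fun _ h => h) (fun _ p h => tb_mem p h) hz

lemma dl_zero {T : Set S} {z : S × List G →₀ ℤ} (hz : z ∈ Ch G T 0) : dl z = 0 := by
  rw [dl, op, lx_congr (g := fun _ => 0) _ hz, lx_zero]
  intro x hx
  rw [List.length_eq_zero_iff.1 hx.2, tb_nil, Finsupp.mapDomain_zero]

lemma hm_mem {σ : S → S'} {f f' : S → G → K} {T : Set S} {T' : Set S'} {q : ℕ}
    (hT' : ∀ (g : K), ∀ s ∈ T', g • s ∈ T') (hσ : ∀ s ∈ T, σ s ∈ T')
    {z : S × List G →₀ ℤ} (hz : z ∈ Ch G T q) : hm σ f f' z ∈ Ch K T' (q + 1) :=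
  op_mem hT' hσ (fun s p h => h ▸ prt_mem (f s) (f' s) p) hz

lemma pd_mem {bd : S → S →₀ ℤ} {T T' : Set S} {q : ℕ} (h : ∀ s ∈ T, bd s ∈ Sp T')
    {z : S × List G →₀ ℤ} (hz : z ∈ Ch G T q) : pd bd z ∈ Ch G T' q :=
  lx_mem_Sp (fun x hx => by
    refine mapDomain_mem_Sp ?_ (h x.1 hx.1)
    exact fun _ hy => ⟨hy, hx.2⟩) hz

lemma exists_section (H : Subgroup G) : ∃ ρ : G → G, (∀ k ∈ H, ∀ v, ρ (k * v) = k * ρ v) ∧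
    (∀ v, ρ v ∈ H) ∧ ρ 1 = 1 := by
  let r : G → G := fun v => v * Quotient.out ((v⁻¹ : G) : G ⧸ H)
  have hr : ∀ v, r v ∈ H := by
    intro v
    obtain ⟨h, hh⟩ := QuotientGroup.mk_out_eq_mul H (v⁻¹ : G)
    change v * Quotient.out ((v⁻¹ : G) : G ⧸ H) ∈ H
    rw [hh, mul_inv_cancel_left]
    exact h.2
  refine ⟨fun v => r v * (r 1)⁻¹, fun k hk v => ?_, fun v => H.mul_mem (hr v) (H.inv_mem (hr 1)),
    mul_inv_cancel _⟩
  have : (((k * v)⁻¹ : G) : G ⧸ H) = ((v⁻¹ : G) : G ⧸ H) := by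
    rw [mul_inv_rev]
    exact QuotientGroup.mk_mul_of_mem _ (H.inv_mem hk)
  simp only [r, this, mul_assoc]

/-- The inclusion of the chains of a subgroup fixing a simplex. -/
def io (x₀ : S) (j : K →* G) : (PUnit.{1} × List K →₀ ℤ) →ₗ[ℤ] (S × List G →₀ ℤ) :=
  vm (fun _ => x₀) fun _ => j

lemma io_eq (x₀ : S) (j : K →* G) (z : PUnit.{1} × List K →₀ ℤ) :
    io x₀ j z = Finsupp.mapDomain (fun x => (x₀, x.2.map j)) z := by
  rw [io, vm_eq_mapDomain]
  simp

lemma io_injective (x₀ : S) {j : K →* G} (hj : Function.Injective j) :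
    Function.Injective (io x₀ j) := by
  have : ⇑(io x₀ j) = Finsupp.mapDomain (fun x => (x₀, x.2.map j)) := funext fun z => io_eq _ _ z
  rw [this]
  refine Finsupp.mapDomain_injective fun x y h => ?_
  exact Prod.ext rfl (List.map_injective_iff.2 hj (Prod.ext_iff.1 h).2)

lemma vequi_io {x₀ : S} {j : K →* G} (hx : ∀ k, j k • x₀ = x₀) :
    VEqui (S := PUnit.{1}) j (fun _ => x₀) fun _ => j :=
  ⟨fun g _ => (hx g).symm, fun g _ v => map_mul j g v⟩

lemma dl_io {x₀ : S} {j : K →* G} (hx : ∀ k, j k • x₀ = x₀) (z : PUnit.{1} × List K →₀ ℤ) :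
    dl (io x₀ j z) = io x₀ j (dl z) :=
  dl_vm (vequi_io hx) z

lemma exists_retraction (x₀ : S) (j : K →* G) (hx : ∀ g : G, g • x₀ = x₀ ↔ g ∈ j.range) :
    ∃ f : S → G → G, VEqui id id f ∧
      (∀ s, (∃ g : G, g • x₀ = s) → (f s 1)⁻¹ • s = x₀ ∧ ∀ v, (f s 1)⁻¹ * f s v ∈ j.range) ∧
      ∀ v ∈ j.range, (f x₀ 1)⁻¹ * f x₀ v = v := by
  classical
  obtain ⟨ρ, h1, h2, h3⟩ := exists_section j.range
  let a : S → G := fun s => if h : ∃ g : G, g • x₀ = s then h.choose else 1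
  have ha : ∀ s, (∃ g : G, g • x₀ = s) → a s • x₀ = s := by
    intro s h
    simp only [a, dif_pos h]
    exact h.choose_spec
  refine ⟨fun s v => if (∃ g : G, g • x₀ = s) then a s * ρ ((a s)⁻¹ * v) else v,
    ⟨fun _ _ => rfl, fun g s v => ?_⟩, fun s hs => ?_, fun v hv => ?_⟩
  · have hiff : (∃ g' : G, g' • x₀ = g • s) ↔ ∃ g' : G, g' • x₀ = s := by
      constructor
      · rintro ⟨g', h⟩
        exact ⟨g⁻¹ * g', by rw [mul_smul, h, inv_smul_smul]⟩
      · rintro ⟨g', h⟩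
        exact ⟨g * g', by rw [mul_smul, h]⟩
    by_cases hs : ∃ g : G, g • x₀ = s
    · have hs' := hiff.2 hs
      simp only [if_pos hs, if_pos hs', id]
      have hk : (a (g • s))⁻¹ * g * a s ∈ j.range := by
        rw [← hx, mul_smul, mul_smul, ha s hs, inv_smul_eq_iff, ha _ hs']
      have : (a (g • s))⁻¹ * (g * v) = ((a (g • s))⁻¹ * g * a s) * ((a s)⁻¹ * v) := by group
      rw [this, h1 _ hk]
      group
    · simp only [if_neg hs, if_neg (mt hiff.1 hs), id]
  · simp only [if_pos hs]
    have hk := h2 ((a s)⁻¹ * 1)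
    constructor
    · rw [mul_inv_rev, mul_smul, inv_smul_eq_iff, inv_smul_eq_iff, (hx _).2 hk, ha s hs]
    · intro v
      have : (a s * ρ ((a s)⁻¹ * 1))⁻¹ * (a s * ρ ((a s)⁻¹ * v)) =
        (ρ ((a s)⁻¹ * 1))⁻¹ * ρ ((a s)⁻¹ * v) := by group
      rw [this]
      exact mul_mem (inv_mem hk) (h2 _)
  · have hs : ∃ g : G, g • x₀ = x₀ := ⟨1, one_smul _ _⟩
    have hk : a x₀ ∈ j.range := (hx _).1 (ha x₀ hs)
    simp only [if_pos hs]
    rw [h1 _ (inv_mem hk), h1 _ (inv_mem hk)]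
    have h4 := h1 v hv 1
    rw [mul_one, h3, mul_one] at h4
    rw [h4, h3]
    group

section Shapiro

variable {x₀ : S} {j : K →* G} {T : Set S}

lemma exists_retract_chain (hT' : ∀ s ∈ T, ∃ g : G, g • x₀ = s) {f : S → G → G}
    (h : ∀ s, (∃ g : G, g • x₀ = s) → (f s 1)⁻¹ • s = x₀ ∧ ∀ v, (f s 1)⁻¹ * f s v ∈ j.range)
    {q : ℕ} {t : S × List G →₀ ℤ} (ht : t ∈ Ch G T q) :
    ∃ c ∈ Ch K (Set.univ : Set PUnit.{1}) q, io x₀ j c = vm id f t := by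
  let u : G → K := Function.invFun j
  have hu : ∀ v ∈ j.range, j (u v) = v := fun v hv => Function.invFun_eq hv
  refine ⟨Finsupp.mapDomain (fun x => (PUnit.unit, x.2.map fun v => u ((f x.1 1)⁻¹ * f x.1 v))) t,
    ?_, ?_⟩
  · refine mapDomain_mem_Sp ?_ ht
    exact fun x hx => ⟨trivial, by simpa using hx.2⟩
  rw [io_eq, ← Finsupp.mapDomain_comp, vm_eq_mapDomain]
  refine mapDomain_congr_Sp (fun x hx => ?_) ht
  obtain ⟨h1, h2⟩ := h x.1 (hT' _ hx.1)
  simp only [Function.comp_apply, id, h1, List.map_map]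
  congr 1
  refine List.map_congr_left fun v _ => ?_
  simp only [Function.comp_apply]
  exact hu _ (h2 v)

theorem shapiro_surj (hx : ∀ g : G, g • x₀ = x₀ ↔ g ∈ j.range)
    (hj : Function.Injective j) (hT : ∀ (g : G), ∀ s ∈ T, g • s ∈ T)
    (hT' : ∀ s ∈ T, ∃ g : G, g • x₀ = s) {q : ℕ} {t : S × List G →₀ ℤ} (ht : t ∈ Ch G T q) (hd : dl t = 0) :
    ∃ c ∈ Ch K (Set.univ : Set PUnit.{1}) q, dl c = 0 ∧ ∃ v ∈ Ch G T (q + 1), t = io x₀ j c + dl v := by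
  obtain ⟨f, hf, h1, h2⟩ := exists_retraction x₀ j hx
  obtain ⟨c, hc, hct⟩ := exists_retract_chain hT' h1 ht
  have hx' : ∀ k, j k • x₀ = x₀ := fun k => (hx _).2 ⟨k, rfl⟩
  refine ⟨c, hc, io_injective x₀ hj ?_, hm id (fun _ v => v) f t, hm_mem hT (fun _ h => h) ht, ?_⟩
  · rw [← dl_io hx', hct, dl_vm hf, hd, map_zero, map_zero]
  · have h3 := hm_homotopy (G := G) (K := G) (S := S) (S' := S) (j := id) (σ := id)
      (f := fun _ v => v) (f' := f) ⟨fun _ _ => rfl, fun _ _ _ => rfl⟩ hf t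
    rw [hd, map_zero, add_zero] at h3
    have h4 : vm id (fun _ v => v) t = t := by
      rw [vm_eq_mapDomain]
      simp only [inv_one, one_smul, one_mul, List.map_id_fun', id]
      exact Finsupp.mapDomain_id
    rw [h3, hct, h4, add_sub_cancel]

theorem shapiro_inj (hx : ∀ g : G, g • x₀ = x₀ ↔ g ∈ j.range)
    (hj : Function.Injective j) (hT' : ∀ s ∈ T, ∃ g : G, g • x₀ = s) {q : ℕ} {c : PUnit.{1} × List K →₀ ℤ}
    (hc : ∃ v ∈ Ch G T (q + 1), io x₀ j c = dl v) :
    ∃ c' ∈ Ch K (Set.univ : Set PUnit.{1}) (q + 1), c = dl c' := by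
  obtain ⟨v, hv, hcv⟩ := hc
  obtain ⟨f, hf, h1, h2⟩ := exists_retraction x₀ j hx
  obtain ⟨c', hc', hct⟩ := exists_retract_chain hT' h1 hv
  have hx' : ∀ k, j k • x₀ = x₀ := fun k => (hx _).2 ⟨k, rfl⟩
  refine ⟨c', hc', io_injective x₀ hj ?_⟩
  rw [← dl_io hx', hct, dl_vm hf, ← hcv, io_eq, vm_eq_mapDomain, ← Finsupp.mapDomain_comp]
  congr 1
  ext1 x
  simp only [Function.comp_apply, id, (h1 x₀ ⟨1, one_smul _ _⟩).1, List.map_map]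
  congr 1
  refine List.map_congr_left fun v _ => ?_
  simp only [Function.comp_apply]
  exact (h2 _ ⟨v, rfl⟩).symm

end Shapiro

end EquivariantSupports

section Action

/-- Automorphisms act on pairs of words and subgroups. -/
instance simplexAction {F : Type*} [Group F] : MulAction (MulAut F) (List F × Subgroup F) where
  smul g τ := (τ.1.map g, τ.2.map (MulEquiv.toMonoidHom g))
  one_smul τ := by
    refine Prod.ext ?_ ?_
    · change τ.1.map (fun x => x) = τ.1
      simp
    · change τ.2.map (MonoidHom.id F) = τ.2
      exact Subgroup.map_id _
  mul_smul g g' τ := by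
    refine Prod.ext ?_ ?_
    · change τ.1.map (fun x => g (g' x)) = (τ.1.map g').map g
      simp
    · change τ.2.map ((MulEquiv.toMonoidHom g).comp (MulEquiv.toMonoidHom g')) = _
      exact (Subgroup.map_map _ _ _).symm

lemma smul_simplex {F : Type*} [Group F] (g : MulAut F) (τ : List F × Subgroup F) :
    g • τ = (τ.1.map g, τ.2.map (MulEquiv.toMonoidHom g)) := rfl

lemma bdW_smul {F : Type*} [Group F] (g : MulAut F) (τ : List F × Subgroup F) :
    bdW (g • τ) = Finsupp.mapDomain (g • ·) (bdW τ) := by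
  rw [bdW, bdW, smul_simplex, lbd_map, ← Finsupp.mapDomain_comp, ← Finsupp.mapDomain_comp]
  congr 1
  ext1 l
  simp only [Function.comp_apply, smul_simplex, Subgroup.map_sup]
  congr 2
  rw [MonoidHom.map_closure]
  congr 1
  ext x
  simp only [Set.mem_image, List.mem_map, Set.mem_ofPred_eq]
  constructor
  · rintro ⟨⟨a, ha, rfl⟩, h⟩
    exact ⟨a, ⟨ha, fun h' => h ⟨a, h', rfl⟩⟩, rfl⟩
  · rintro ⟨a, ⟨ha, h⟩, rfl⟩
    refine ⟨⟨a, ha, rfl⟩, ?_⟩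
    rintro ⟨b, hb, hba⟩
    exact h (g.injective hba ▸ hb)

variable {N : ℕ}

lemma lv_map {ι : Type*} (y : ι → FreeGroup (Fin N)) (g : MulAut (FreeGroup (Fin N)))
    (p : ι × Bool) : g (lv y p) = lv (fun i => g (y i)) p := by
  rcases p with ⟨i, _ | _⟩ <;> simp [lv]

lemma smul_ev {ι : Type*} (y : ι → FreeGroup (Fin N)) (w : List (ι × Bool))
    (g : MulAut (FreeGroup (Fin N))) : g • ev y w = ev (fun i => g (y i)) w := by
  rw [smul_simplex, ev, ev, MonoidHom.map_closure, Set.image_image, List.map_map]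
  congr 1
  exact List.map_congr_left fun p _ => lv_map y g p

lemma isBas_smul {ι : Type*} {y : ι → FreeGroup (Fin N)} (hy : IsBas y)
    (g : MulAut (FreeGroup (Fin N))) : IsBas fun i => g (y i) := by
  have : FreeGroup.lift (fun i => g (y i)) = (MulEquiv.toMonoidHom g).comp (FreeGroup.lift y) := by
    ext
    simp
  rw [IsBas, this, MonoidHom.coe_comp]
  exact Function.Bijective.comp g.bijective hy

lemma Valid.smul {τ : List (FreeGroup (Fin N)) × Subgroup (FreeGroup (Fin N))} (h : τ ∈ Valid N)
    (g : MulAut (FreeGroup (Fin N))) : g • τ ∈ Valid N := by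
  obtain ⟨y, w, hy, hw, rfl⟩ := h
  exact ⟨_, w, isBas_smul hy g, hw, (smul_ev y w g).symm⟩

lemma aut_ext {g g' : MulAut (FreeGroup (Fin N))}
    (h : ∀ i, g (FreeGroup.of i) = g' (FreeGroup.of i)) : g = g' := by
  have : MulEquiv.toMonoidHom g = MulEquiv.toMonoidHom g' := FreeGroup.ext_hom _ _ h
  exact MulEquiv.ext fun x => DFunLike.congr_fun this x

end Action

section Stabilization

open FreeGroup

variable {k N : ℕ}

/-- The inclusion of the first generators. -/
def inc (h : k ≤ N) : FreeGroup (Fin k) →* FreeGroup (Fin N) := FreeGroup.map (Fin.castLE h)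

lemma inc_of (h : k ≤ N) (a : Fin k) : inc h (of a) = of (Fin.castLE h a) := by
  simp [inc]

lemma inc_injective (h : k ≤ N) : Function.Injective (inc h) :=
  FreeGroup.map_injective (Fin.castLE_injective h)

/-- Extension of an endomorphism by the identity on the remaining generators. -/
def stab (h : k ≤ N) (φ : FreeGroup (Fin k) →* FreeGroup (Fin k)) :
    FreeGroup (Fin N) →* FreeGroup (Fin N) :=
  lift fun i => if hi : i.1 < k then inc h (φ (of ⟨i, hi⟩)) else of i

lemma stab_castLE (h : k ≤ N) (φ : FreeGroup (Fin k) →* FreeGroup (Fin k)) (a : Fin k) :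
    stab h φ (of (Fin.castLE h a)) = inc h (φ (of a)) := by
  simp [stab]

lemma stab_inc (h : k ≤ N) (φ : FreeGroup (Fin k) →* FreeGroup (Fin k)) (x : FreeGroup (Fin k)) :
    stab h φ (inc h x) = inc h (φ x) := by
  have : (stab h φ).comp (inc h) = (inc h).comp φ := by
    ext a
    simp [inc_of, stab_castLE]
  exact DFunLike.congr_fun this x

lemma stab_of_le (h : k ≤ N) (φ : FreeGroup (Fin k) →* FreeGroup (Fin k)) {i : Fin N}
    (hi : k ≤ i.1) : stab h φ (of i) = of i := by
  simp [stab, hi]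

lemma fin_cases_castLE (h : k ≤ N) (i : Fin N) : (∃ a : Fin k, i = Fin.castLE h a) ∨ k ≤ i.1 := by
  by_cases hi : i.1 < k
  · exact Or.inl ⟨⟨i, hi⟩, rfl⟩
  · exact Or.inr (not_lt.1 hi)

lemma stab_comp (h : k ≤ N) (φ ψ : FreeGroup (Fin k) →* FreeGroup (Fin k)) :
    (stab h φ).comp (stab h ψ) = stab h (φ.comp ψ) := by
  ext i
  rcases fin_cases_castLE h i with ⟨a, rfl⟩ | hi
  · simp [stab_castLE, stab_inc]
  · simp [stab_of_le, hi]

lemma stab_id (h : k ≤ N) : stab h (MonoidHom.id _) = MonoidHom.id _ := by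
  ext i
  rcases fin_cases_castLE h i with ⟨a, rfl⟩ | hi
  · simp [stab_castLE, inc_of]
  · simp [stab_of_le, hi]

/-- The stabilization homomorphism between automorphism groups of free groups. -/
def jj (h : k ≤ N) : MulAut (FreeGroup (Fin k)) →* MulAut (FreeGroup (Fin N)) :=
  MonoidHom.mk' (fun φ => MonoidHom.toMulEquiv (stab h (MulEquiv.toMonoidHom φ))
    (stab h (MulEquiv.toMonoidHom φ⁻¹))
    (by
      rw [stab_comp, ← stab_id h]
      congr 1
      ext1 x
      exact φ.symm_apply_apply (of x))
    (by
      rw [stab_comp, ← stab_id h]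
      congr 1
      ext1 x
      exact φ.apply_symm_apply (of x)))
    fun φ ψ => MulEquiv.ext fun x => (DFunLike.congr_fun (stab_comp h (MulEquiv.toMonoidHom φ)
      (MulEquiv.toMonoidHom ψ)) x).symm

lemma jj_inc (h : k ≤ N) (φ : MulAut (FreeGroup (Fin k))) (x : FreeGroup (Fin k)) :
    jj h φ (inc h x) = inc h (φ x) := stab_inc h (MulEquiv.toMonoidHom φ) x

lemma jj_castLE (h : k ≤ N) (φ : MulAut (FreeGroup (Fin k))) (a : Fin k) :
    jj h φ (of (Fin.castLE h a)) = inc h (φ (of a)) := stab_castLE h (MulEquiv.toMonoidHom φ) a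

lemma jj_of_le (h : k ≤ N) (φ : MulAut (FreeGroup (Fin k))) {i : Fin N} (hi : k ≤ i.1) :
    jj h φ (of i) = of i := stab_of_le h (MulEquiv.toMonoidHom φ) hi

lemma jj_injective (h : k ≤ N) : Function.Injective (jj h) := by
  intro φ ψ e
  refine aut_ext fun i => inc_injective h ?_
  rw [← jj_inc, ← jj_inc, e]

lemma jj_jj {m : ℕ} (h : k ≤ m) (h' : m ≤ N) (φ : MulAut (FreeGroup (Fin k))) :
    jj h' (jj h φ) = jj (h.trans h') φ := by
  have e : ∀ x, inc h' (inc h x) = inc (h.trans h') x := by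
    intro x
    have : (inc h').comp (inc h) = inc (h.trans h') := by
      ext a
      simp [inc_of]
    exact DFunLike.congr_fun this x
  refine aut_ext fun i => ?_
  rcases fin_cases_castLE (h.trans h') i with ⟨a, rfl⟩ | hi
  · rw [jj_castLE, ← e, ← jj_inc h, ← jj_inc h', e, inc_of]
  · rw [jj_of_le _ _ hi]
    rcases fin_cases_castLE h' i with ⟨a, rfl⟩ | hi'
    · rw [jj_castLE, jj_of_le _ _ (by simpa using hi), inc_of]
    · rw [jj_of_le _ _ hi']

lemma mem_range_jj (h : k ≤ N) {g : MulAut (FreeGroup (Fin N))}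
    (h1 : ∀ i : Fin N, k ≤ i.1 → g (of i) = of i)
    (h2 : (inc h).range.map (MulEquiv.toMonoidHom g) = (inc h).range) : g ∈ (jj h).range := by
  have hp : ∀ a : Fin k, ∃ p, inc h p = g (inc h (of a)) := by
    intro a
    have : g (inc h (of a)) ∈ (inc h).range := h2 ▸ ⟨inc h (of a), ⟨_, rfl⟩, rfl⟩
    exact this
  have hq : ∀ a : Fin k, ∃ p, g (inc h p) = inc h (of a) := by
    intro a
    have : inc h (of a) ∈ (inc h).range.map (MulEquiv.toMonoidHom g) := h2.symm ▸ ⟨_, rfl⟩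
    obtain ⟨_, ⟨p, rfl⟩, hp⟩ := this
    exact ⟨p, hp⟩
  choose p hp using hp
  choose q hq using hq
  have hp' : ∀ x, inc h (lift p x) = g (inc h x) := by
    intro x
    have : (inc h).comp (lift p) = (MulEquiv.toMonoidHom g).comp (inc h) := by
      ext a
      simp [hp]
    exact DFunLike.congr_fun this x
  have hq' : ∀ x, g (inc h (lift q x)) = inc h x := by
    intro x
    have : ((MulEquiv.toMonoidHom g).comp (inc h)).comp (lift q) = inc h := by
      ext a
      simp [hq]
    exact DFunLike.congr_fun this x
  refine ⟨MonoidHom.toMulEquiv (lift p) (lift q) ?_ ?_, ?_⟩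
  · ext1 a
    refine inc_injective h (g.injective ?_)
    change g (inc h (lift q (lift p (of a)))) = g (inc h (of a))
    rw [hq', hp']
  · ext1 a
    refine inc_injective h ?_
    change inc h (lift p (lift q (of a))) = inc h (of a)
    rw [hp', hq']
  · refine aut_ext fun i => ?_
    rcases fin_cases_castLE h i with ⟨a, rfl⟩ | hi
    · rw [jj_castLE, ← inc_of h, ← hp' (of a)]
      rfl
    · rw [jj_of_le _ _ hi, h1 i hi]

end Stabilization

section Standard

open FreeGroup

variable {k N : ℕ}

lemma isBas_of (N : ℕ) : IsBas (of : Fin N → FreeGroup (Fin N)) :=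
  isBas_of_inverse (d := of) (by simp) (by simp)

/-- The simplex of positive generators. -/
def st (s : List (Fin N)) : List (FreeGroup (Fin N)) × Subgroup (FreeGroup (Fin N)) :=
  ev of (s.map fun i => (i, true))

lemma st_eq (s : List (Fin N)) : st s = (s.map of, Subgroup.closure (of '' {i | i ∉ s})) := by
  rw [st, ev, List.map_map, List.map_map]
  simp [Function.comp_def, lv]

lemma bdW_st {s : List (Fin N)} (hs : s.Nodup) : bdW (st s) = Finsupp.mapDomain st (lbd s) := by
  rw [st, bdW_ev (isBas_of N) (by simpa [Function.comp_def] using hs), lbd_map,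
    ← Finsupp.mapDomain_comp]
  rfl

lemma st_valid {s : List (Fin N)} (hs : s.Nodup) : st s ∈ Valid N :=
  ⟨of, _, isBas_of N, by simpa [Function.comp_def] using hs, rfl⟩

lemma smul_st (e : Fin N ≃ Fin N) (s : List (Fin N)) :
    (show MulAut (FreeGroup (Fin N)) from freeGroupCongr e) • st s = st (s.map e) := by
  rw [st_eq, st_eq, smul_simplex, MonoidHom.map_closure, Set.image_image, List.map_map,
    List.map_map]
  refine Prod.ext ?_ ?_
  · refine List.map_congr_left fun i _ => ?_
    change freeGroupCongr e (of i) = of (e i)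
    simp
  · change Subgroup.closure _ = Subgroup.closure _
    congr 1
    ext x
    constructor
    · rintro ⟨i, hi, rfl⟩
      refine ⟨e i, ?_, ?_⟩
      · intro h
        obtain ⟨j, hj, hji⟩ := List.mem_map.1 h
        exact hi (e.injective hji ▸ hj)
      · change of (e i) = freeGroupCongr e (of i)
        simp
    · rintro ⟨i, hi, rfl⟩
      refine ⟨e.symm i, fun h => hi ?_, ?_⟩
      · exact List.mem_map.2 ⟨_, h, e.apply_symm_apply i⟩
      · change freeGroupCongr e (of (e.symm i)) = of i
        simp

/-- The standard simplex with stabilizer the automorphisms of the first `k` generators. -/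
def sk (N k : ℕ) : List (Fin N) := (List.finRange N).drop k

lemma mem_sk {i : Fin N} : i ∈ sk N k ↔ k ≤ i.1 := by
  rw [sk, List.mem_iff_getElem]
  simp only [List.getElem_drop, List.getElem_finRange, List.length_drop, List.length_finRange]
  constructor
  · rintro ⟨j, hj, rfl⟩
    simp
  · intro h
    exact ⟨i.1 - k, by omega, Fin.ext (by simp; omega)⟩

lemma nodup_sk : (sk N k).Nodup := (List.nodup_finRange N).sublist (List.drop_sublist _ _)

lemma length_sk : (sk N k).length = N - k := by simp [sk]

/-- The standard simplex. -/
def xk (N k : ℕ) : List (FreeGroup (Fin N)) × Subgroup (FreeGroup (Fin N)) := st (sk N k)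

lemma length_xk : (xk N k).1.length = N - k := by simp [xk, st_eq, length_sk]

lemma xk_eq (h : k ≤ N) : xk N k = ((sk N k).map of, (inc h).range) := by
  rw [xk, st_eq]
  congr 1
  apply le_antisymm
  · rw [Subgroup.closure_le]
    rintro _ ⟨i, hi, rfl⟩
    rcases fin_cases_castLE h i with ⟨a, rfl⟩ | hi'
    · exact ⟨of a, inc_of h a⟩
    · exact absurd (mem_sk.2 hi') hi
  · rw [MonoidHom.range_eq_map, ← FreeGroup.closure_range_of, MonoidHom.map_closure]
    apply Subgroup.closure_mono
    rintro _ ⟨_, ⟨a, rfl⟩, rfl⟩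
    refine ⟨Fin.castLE h a, fun h' => ?_, (inc_of h a).symm⟩
    have := mem_sk.1 h'
    simp at this
    omega

lemma smul_xk (h : k ≤ N) (g : MulAut (FreeGroup (Fin N))) :
    g • xk N k = xk N k ↔ g ∈ (jj h).range := by
  rw [xk_eq h, smul_simplex, Prod.mk.injEq, List.map_map]
  constructor
  · rintro ⟨h1, h2⟩
    exact mem_range_jj h (fun i hi => List.map_inj_left.1 h1 i (mem_sk.2 hi)) h2
  · rintro ⟨φ, rfl⟩
    constructor
    · exact List.map_inj_left.2 fun i hi => jj_of_le h φ (mem_sk.1 hi)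
    · ext x
      constructor
      · rintro ⟨_, ⟨y, rfl⟩, rfl⟩
        exact ⟨φ y, (jj_inc h φ y).symm⟩
      · rintro ⟨y, rfl⟩
        refine ⟨inc h (φ⁻¹ y), ⟨_, rfl⟩, ?_⟩
        change jj h φ (inc h (φ⁻¹ y)) = _
        rw [jj_inc, MulAut.apply_inv_self]

lemma exists_equiv_of_nodup (M : List (Fin N)) (hM : M.Nodup) (hl : M.length = N) :
    ∃ e : Fin N ≃ Fin N, (List.finRange N).map e = M ∧ ∀ i : Fin N, M[i.1]'(by omega) = e i := by
  have hinj : Function.Injective fun i : Fin N => M[i.1]'(by omega) := by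
    intro i j h
    exact Fin.ext ((hM.getElem_inj_iff).1 h)
  refine ⟨Equiv.ofBijective _ (Finite.injective_iff_bijective.1 hinj), ?_, fun i => rfl⟩
  refine List.ext_getElem (by simp [hl]) fun i h1 h2 => ?_
  simp

lemma isBas_lv (e : Fin N ≃ Fin N) (ε : Fin N → Bool) :
    IsBas fun i => lv (of : Fin N → FreeGroup (Fin N)) (e i, ε i) := by
  refine isBas_of_inverse (d := fun j => lv of (e.symm j, ε (e.symm j))) (fun j => ?_)
    fun i => ?_
  · cases h : ε (e.symm j) <;> simp [lv, h]
  · cases h : ε i <;> simp [lv, h]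

lemma exists_smul_xk (h : k ≤ N) {τ : List (FreeGroup (Fin N)) × Subgroup (FreeGroup (Fin N))}
    (hτ : τ ∈ Valid N) (hl : τ.1.length = N - k) :
    ∃ g : MulAut (FreeGroup (Fin N)), g • xk N k = τ := by
  classical
  obtain ⟨y, w, hy, hw, rfl⟩ := hτ
  have hl' : w.length = N - k := by simpa [ev] using hl
  set u := (List.finRange N).filter (fun i => i ∉ w.map Prod.fst) with hu
  have hmu : ∀ i, i ∈ u ↔ i ∉ w.map Prod.fst := by
    intro i
    simp only [hu, List.mem_filter, List.mem_finRange, true_and, decide_eq_true_eq]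
  have hnd : (u ++ w.map Prod.fst).Nodup := by
    refine List.nodup_append.2 ⟨(List.nodup_finRange N).filter _, hw, ?_⟩
    rintro i hi _ hj rfl
    exact (hmu i).1 hi hj
  have hlen : (u ++ w.map Prod.fst).length = N := by
    rw [← List.toFinset_card_of_nodup hnd]
    have : (u ++ w.map Prod.fst).toFinset = Finset.univ := by
      ext i
      by_cases hi : i ∈ w.map Prod.fst
      · simp only [List.toFinset_append, Finset.mem_union, List.mem_toFinset, hi, or_true,
          Finset.mem_univ]
      · simp only [List.toFinset_append, Finset.mem_union, List.mem_toFinset, (hmu i).2 hi, true_or,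
          Finset.mem_univ]
    rw [this, Finset.card_univ, Fintype.card_fin]
  have hulen : u.length = k := by
    rw [List.length_append, List.length_map] at hlen
    omega
  set L : List (Fin N × Bool) := u.map (fun i => (i, true)) ++ w with hL
  have hL1 : L.map Prod.fst = u ++ w.map Prod.fst := by
    simp [hL, Function.comp_def]
  have hLl : L.length = N := by rw [← List.length_map (f := Prod.fst), hL1, hlen]
  obtain ⟨e, he, he'⟩ := exists_equiv_of_nodup _ hnd hlen
  set y' : Fin N → FreeGroup (Fin N) := fun i => lv y (L[i.1]'(by omega)) with hy'
  have hbas : IsBas y' := by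
    have h1 := hy.comp_lift (isBas_lv e fun i => (L[i.1]'(by omega)).2)
    convert h1 using 2 with i
    have h2 : (L[i.1]'(by omega)).1 = e i := by
      rw [← he' i]
      simp only [← hL1, List.getElem_map]
    rw [← h2, hy']
    cases hb : (L[i.1]'(by omega)).2 <;> simp [lv, hb]
  have hmap : (List.finRange N).map y' = L.map (lv y) := by
    refine List.ext_getElem (by simp [hLl]) fun i h1 h2 => ?_
    simp [hy']
  refine ⟨MulEquiv.ofBijective (lift y') hbas, ?_⟩
  rw [xk, st, smul_ev]
  have hof : (fun i => (MulEquiv.ofBijective (lift y') hbas : MulAut (FreeGroup (Fin N))) (of i)) =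
      y' := by
    funext i
    change lift y' (of i) = y' i
    simp
  rw [hof, ev, ev, List.map_map, List.map_map]
  have e1 : lv y' ∘ (fun i => (i, true)) = y' := rfl
  have e2 : Prod.fst ∘ (fun i : Fin N => (i, true)) = id := rfl
  rw [e1, e2, List.map_id]
  refine Prod.ext ?_ ?_
  · change ((List.finRange N).drop k).map y' = _
    rw [List.map_drop, hmap, hL, List.map_append, List.drop_left' (by simpa using hulen)]
  · change Subgroup.closure _ = Subgroup.closure _
    congr 1
    have e3 : {i | i ∉ w.map Prod.fst} = {i | i ∈ u} := by
      ext i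
      exact (hmu i).symm
    rw [e3]
    have e4 : {i | i ∉ sk N k} = {i | i ∈ (List.finRange N).take k} := by
      ext i
      simp only [Set.mem_ofPred_eq, mem_sk, List.mem_take_iff_getElem, List.getElem_finRange,
        List.length_finRange]
      constructor
      · intro hi
        exact ⟨i.1, by omega, rfl⟩
      · rintro ⟨j, hj, rfl⟩
        simp at hj ⊢
        omega
    rw [e4]
    have e5 : ((List.finRange N).take k).map y' = u.map y := by
      rw [List.map_take, hmap, hL, List.map_append, List.take_left' (by simpa using hulen),
        List.map_map]
      rfl
    ext x
    have := congrArg (x ∈ ·) e5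
    simpa only [List.mem_map, Set.mem_image, Set.mem_ofPred_eq, eq_iff_iff] using this

lemma exists_face_equiv (h : k + 1 ≤ N) {s : List (Fin N)} (hs : lbd (sk N k) s ≠ 0) :
    ∃ e : Fin N ≃ Fin N, (sk N (k + 1)).map e = s ∧ ∀ i : Fin N, i.1 < k → e i = i := by
  obtain ⟨a, r, b, h1, rfl⟩ := exists_of_lbd_ne_zero hs
  have hp : ((List.finRange N).take k ++ r :: (a ++ b)).Perm (List.finRange N) := by
    have h2 : (r :: (a ++ b)).Perm (sk N k) := by
      rw [h1]
      exact List.perm_middle.symm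
    conv_rhs => rw [← List.take_append_drop k (List.finRange N)]
    exact List.Perm.append_left _ h2
  have hl : ((List.finRange N).take k).length = k := by
    simp
    omega
  obtain ⟨e, he, he'⟩ := exists_equiv_of_nodup _ (hp.nodup_iff.2 (List.nodup_finRange N))
    (by simpa using hp.length_eq)
  refine ⟨e, ?_, fun i hi => ?_⟩
  · rw [sk, List.map_drop, he, ← List.drop_drop, List.drop_left' hl]
    rfl
  · rw [← he', List.getElem_append_left (by omega)]
    simp

end Standard

section DoubleComplex

variable {k m q N : ℕ}

/-- The automorphism group of the free group of rank `k`. -/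
abbrev AF (k : ℕ) : Type := MulAut (FreeGroup (Fin k))

/-- The valid simplices with `m` vertices. -/
def TT (N m : ℕ) : Set (List (FreeGroup (Fin N)) × Subgroup (FreeGroup (Fin N))) :=
  {τ | τ ∈ Valid N ∧ τ.1.length = m}

/-- The double complex. -/
abbrev AA (N m q : ℕ) : Submodule ℤ
    ((List (FreeGroup (Fin N)) × Subgroup (FreeGroup (Fin N))) × List (AF N) →₀ ℤ) :=
  Ch (AF N) (TT N m) q

/-- The chains of the automorphism group of the free group of rank `k`. -/
abbrev DD (k q : ℕ) : Submodule ℤ (PUnit.{1} × List (AF k) →₀ ℤ) :=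
  Ch (AF k) (Set.univ : Set PUnit.{1}) q

/-- The inclusion of the chains of a stabilizer. -/
def ik (h : k ≤ N) := io (xk N k) (jj h)

/-- The stabilization map on chains. -/
def sg (k : ℕ) : (PUnit.{1} × List (AF k) →₀ ℤ) →ₗ[ℤ] (PUnit.{1} × List (AF (k + 1)) →₀ ℤ) :=
  io PUnit.unit (jj k.le_succ)

lemma TT_smul (g : AF N) : ∀ s ∈ TT N m, g • s ∈ TT N m := by
  rintro s ⟨h1, h2⟩
  refine ⟨Valid.smul h1 g, ?_⟩
  rw [smul_simplex]
  simpa using h2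

lemma ik_mem (h : k + m = N) {c : PUnit.{1} × List (AF k) →₀ ℤ} (hc : c ∈ DD k q) :
    ik (h ▸ Nat.le_add_right k m) c ∈ AA N m q := by
  rw [ik, io_eq]
  refine mapDomain_mem_Sp ?_ hc
  rintro x ⟨-, hx⟩
  refine ⟨⟨st_valid nodup_sk, ?_⟩, ?_⟩
  · rw [length_xk]
    omega
  · simpa using hx

lemma dl_ik (h : k ≤ N) (c : PUnit.{1} × List (AF k) →₀ ℤ) : dl (ik h c) = ik h (dl c) :=
  dl_io (fun φ => (smul_xk h _).2 ⟨φ, rfl⟩) c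

theorem stabilizer_surj (h : k + m = N)
    {t : (List (FreeGroup (Fin N)) × Subgroup (FreeGroup (Fin N))) × List (AF N) →₀ ℤ}
    (ht : t ∈ AA N m q) (hd : dl t = 0) : ∃ c ∈ DD k q, dl c = 0 ∧
      ∃ v ∈ AA N m (q + 1), t = ik (h ▸ Nat.le_add_right k m) c + dl v :=
  shapiro_surj (smul_xk (by omega)) (jj_injective _) TT_smul
    (fun _ hs => exists_smul_xk (by omega) hs.1 (by rw [hs.2]; omega)) ht hd

theorem stabilizer_inj (h : k + m = N) {c : PUnit.{1} × List (AF k) →₀ ℤ}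
    (hc : ∃ v ∈ AA N m (q + 1), ik (h ▸ Nat.le_add_right k m) c = dl v) :
    ∃ c' ∈ DD k (q + 1), c = dl c' :=
  shapiro_inj (smul_xk (by omega)) (jj_injective _)
    (fun _ hs => exists_smul_xk (by omega) hs.1 (by rw [hs.2]; omega)) hc

/-- The boundary in the direction of the simplices. -/
def pp (N : ℕ) := pd (G := AF N) (bdW (F := FreeGroup (Fin N)))

lemma pp_mem {x : (List (FreeGroup (Fin N)) × Subgroup (FreeGroup (Fin N))) × List (AF N) →₀ ℤ}
    (hx : x ∈ AA N (m + 1) q) : pp N x ∈ AA N m q := by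
  refine pd_mem (T := TT N (m + 1)) (fun s hs => mem_Sp.2 fun s' hs' => ?_) hx
  refine ⟨Valid.face hs.1 hs', ?_⟩
  have h1 := length_of_bdW_ne_zero s s' hs'
  have h2 := hs.2
  omega

lemma pp_zero {x : (List (FreeGroup (Fin N)) × Subgroup (FreeGroup (Fin N))) × List (AF N) →₀ ℤ}
    (hx : x ∈ AA N 0 q) : pp N x = 0 := by
  rw [pp, pd, lx_congr (g := fun _ => 0) _ hx, lx_zero]
  intro x hx
  rw [bdW, List.length_eq_zero_iff.1 hx.1.2, lbd, Finsupp.mapDomain_zero, Finsupp.mapDomain_zero]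

lemma pp_pp (x : (List (FreeGroup (Fin N)) × Subgroup (FreeGroup (Fin N))) × List (AF N) →₀ ℤ) :
    pp N (pp N x) = 0 :=
  pd_pd _ bdLin_bdW x

lemma dl_pp (x : (List (FreeGroup (Fin N)) × Subgroup (FreeGroup (Fin N))) × List (AF N) →₀ ℤ) :
    dl (pp N x) = pp N (dl x) :=
  dl_pd _ bdW_smul x

lemma dl_AA {x : (List (FreeGroup (Fin N)) × Subgroup (FreeGroup (Fin N))) × List (AF N) →₀ ℤ}
    (hx : x ∈ AA N m (q + 1)) : dl x ∈ AA N m q :=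
  dl_mem TT_smul hx

/-- The sum of the coefficients. -/
def csum {X : Type*} : (X →₀ ℤ) →ₗ[ℤ] ℤ := Finsupp.linearCombination ℤ fun _ => 1

lemma csum_lbd {A : Type*} (l : List A) : csum (lbd l) = if Odd l.length then 1 else 0 := by
  have h : ∀ (f : List A → List A) (z : List A →₀ ℤ), csum (Finsupp.mapDomain f z) = csum z := by
    intro f z
    rw [csum, Finsupp.linearCombination_mapDomain]
    rfl
  induction l with
  | nil => simp [lbd]
  | cons a l ih =>
    rw [lbd, map_sub, h, ih, csum, Finsupp.linearCombination_single]
    simp only [List.length_cons, Nat.odd_add_one]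
    split_ifs <;> simp

lemma face_homology (h : k + (m + 1) = N) {c : PUnit.{1} × List (AF k) →₀ ℤ} (hc : c ∈ DD k q)
    (hd : dl c = 0) {s : List (Fin N)} (hs : lbd (sk N k) s ≠ 0) :
    ∃ v ∈ AA N m (q + 1), Finsupp.mapDomain
        (fun x : PUnit.{1} × List (AF k) => (st s, x.2.map (jj (h ▸ Nat.le_add_right k _)))) c =
      ik (k := k + 1) (N := N) (by omega) (sg k c) + dl v := by
  have hkN : k ≤ N := by omega
  have hkN' : k + 1 ≤ N := by omega
  obtain ⟨e, he, hek⟩ := exists_face_equiv hkN' hs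
  let p : AF N := FreeGroup.freeGroupCongr e
  have hp : p • xk N (k + 1) = st s := by rw [← he]; exact smul_st e _
  have hpof : ∀ i, p (FreeGroup.of i) = FreeGroup.of (e i) := by
    intro i
    change FreeGroup.freeGroupCongr e (FreeGroup.of i) = _
    simp
  have hpinc : ∀ x, p (inc hkN x) = inc hkN x := by
    intro x
    have : (MulEquiv.toMonoidHom p).comp (inc hkN) = inc hkN := by
      ext a
      change p (inc hkN (FreeGroup.of a)) = inc hkN (FreeGroup.of a)
      rw [inc_of, hpof, hek _ (by simp)]
    exact DFunLike.congr_fun this x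
  have hek' : ∀ i : Fin N, k ≤ i.1 → k ≤ (e i).1 := by
    intro i hi
    by_contra hlt
    have := hek (e i) (by omega)
    have := e.injective this
    rw [this] at hlt
    exact hlt hi
  have hcomm : ∀ φ : AF k, jj hkN φ * p = p * jj hkN φ := by
    intro φ
    refine aut_ext fun i => ?_
    rw [MulAut.mul_apply, MulAut.mul_apply, hpof]
    rcases fin_cases_castLE hkN i with ⟨a, rfl⟩ | hi
    · rw [hek _ (by simp), jj_castLE, hpinc]
    · rw [jj_of_le _ _ hi, jj_of_le _ _ (hek' i hi), hpof]
  have hfix : ∀ φ : AF k, jj hkN φ • st s = st s := by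
    intro φ
    rw [← hp, ← mul_smul, hcomm, mul_smul]
    congr 1
    rw [smul_xk hkN']
    exact ⟨jj k.le_succ φ, jj_jj _ _ φ⟩
  have hE : VEqui (S := PUnit.{1}) (jj hkN) (fun _ => st s) fun _ v => jj hkN v :=
    vequi_io hfix
  have hE' : VEqui (S := PUnit.{1}) (jj hkN) (fun _ => st s) fun _ v => jj hkN v * p :=
    ⟨fun g _ => (hfix g).symm, fun g _ v => by simp only [map_mul, mul_assoc]⟩
  have hsv : st s ∈ TT N m := by
    rw [← hp]
    refine TT_smul p _ ⟨st_valid nodup_sk, ?_⟩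
    rw [length_xk]
    omega
  refine ⟨hm (fun _ => st s) (fun _ v => jj hkN v) (fun _ v => jj hkN v * p) c,
    hm_mem TT_smul (fun _ _ => hsv) hc, ?_⟩
  have h3 := hm_homotopy hE hE' c
  rw [hd, map_zero, add_zero] at h3
  rw [h3]
  have h4 : Finsupp.mapDomain
        (fun x : PUnit.{1} × List (AF k) => (st s, x.2.map (jj (h ▸ Nat.le_add_right k _)))) c =
      vm (fun _ => st s) (fun _ v => jj hkN v) c := (io_eq (st s) (jj hkN) c).symm
  have h5 : vm (S := PUnit.{1}) (fun _ => st s) (fun _ v => jj hkN v * p) c =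
      ik hkN' (sg k c) := by
    rw [ik, sg, io_eq, io_eq, ← Finsupp.mapDomain_comp, vm_eq_mapDomain]
    congr 1
    ext1 x
    simp only [Function.comp_apply, map_one, one_mul, List.map_map]
    refine Prod.ext ?_ ?_
    · rw [← hp, inv_smul_smul]
    · refine List.map_congr_left fun v _ => ?_
      simp only [Function.comp_apply]
      rw [hcomm, inv_mul_cancel_left, jj_jj]
  rw [h4, h5]
  abel

theorem pp_ik (h : k + (m + 1) = N) {c : PUnit.{1} × List (AF k) →₀ ℤ} (hc : c ∈ DD k q)
    (hd : dl c = 0) : ∃ v ∈ AA N m (q + 1),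
      pp N (ik (h ▸ Nat.le_add_right k _) c) =
        (if Odd (m + 1) then 1 else 0 : ℤ) • ik (k := k + 1) (N := N) (by omega) (sg k c) + dl v := by
  classical
  have hv : ∀ s : List (Fin N), ∃ v ∈ AA N m (q + 1), lbd (sk N k) s ≠ 0 → Finsupp.mapDomain
        (fun x : PUnit.{1} × List (AF k) => (st s, x.2.map (jj (h ▸ Nat.le_add_right k _)))) c =
      ik (k := k + 1) (N := N) (by omega) (sg k c) + dl v := by
    intro s
    by_cases hs : lbd (sk N k) s ≠ 0
    · obtain ⟨v, hv, hv'⟩ := face_homology h hc hd hs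
      exact ⟨v, hv, fun _ => hv'⟩
    · exact ⟨0, Submodule.zero_mem _, fun h => absurd h hs⟩
  choose v hv1 hv2 using hv
  refine ⟨(lbd (sk N k)).sum fun s a => a • v s,
    Submodule.sum_mem _ fun s _ => Submodule.smul_mem _ _ (hv1 s), ?_⟩
  have h1 : (if Odd (m + 1) then 1 else 0 : ℤ) = csum (lbd (sk N k)) := by
    rw [csum_lbd, length_sk]
    rw [show N - k = m + 1 by omega]
  have h2 : pp N (ik (h ▸ Nat.le_add_right k _) c) = (lbd (sk N k)).sum fun s a =>
      a • Finsupp.mapDomain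
        (fun x : PUnit.{1} × List (AF k) => (st s, x.2.map (jj (h ▸ Nat.le_add_right k _)))) c := by
    rw [pp, pd, ik, io_eq, lx_mapDomain]
    simp only [xk, bdW_st nodup_sk, ← Finsupp.mapDomain_comp]
    simp only [mapDomain_eq_lx, lx, Finsupp.linearCombination_apply, Finsupp.smul_sum]
    rw [Finsupp.sum_comm]
    simp only [smul_smul, mul_comm, Function.comp_apply]
  rw [h1, h2, csum, Finsupp.linearCombination_apply, map_finsuppSum, Finsupp.sum, Finsupp.sum,
    Finsupp.sum, Finset.sum_smul, ← Finset.sum_add_distrib]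
  refine Finset.sum_congr rfl fun s hs => ?_
  rw [hv2 s (Finsupp.mem_support_iff.1 hs), map_smul, smul_add, smul_eq_mul, mul_one]

lemma pd_mapDomain_mk {G S : Type*} (bd : S → S →₀ ℤ) (l : List G) (z : S →₀ ℤ) :
    pd bd (Finsupp.mapDomain (fun s => (s, l)) z) =
      Finsupp.mapDomain (fun s => (s, l)) (bdLin bd z) := by
  rw [pd, lx_mapDomain, bdLin, mapDomain_lx]

lemma mapDomain_mk_apply {G S : Type*} [DecidableEq G] (l l' : G) (z : S →₀ ℤ) (s : S) :
    Finsupp.mapDomain (fun s => (s, l)) z (s, l') = if l = l' then z s else 0 := by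
  have hinj : Function.Injective fun s : S => (s, l) := fun a b h => (Prod.ext_iff.1 h).1
  split_ifs with h
  · subst h
    exact Finsupp.mapDomain_apply hinj z s
  · refine Finsupp.mapDomain_of_notMem_range _ _ ?_
    rintro ⟨a, ha⟩
    exact h (Prod.ext_iff.1 ha).2

theorem row_exact (hm : 2 * m + 1 ≤ N)
    {x : (List (FreeGroup (Fin N)) × Subgroup (FreeGroup (Fin N))) × List (AF N) →₀ ℤ}
    (hx : x ∈ AA N m q) (hd : pp N x = 0) : ∃ y ∈ AA N (m + 1) q, pp N y = x := by
  classical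
  let xl : List (AF N) → (List (FreeGroup (Fin N)) × Subgroup (FreeGroup (Fin N)) →₀ ℤ) :=
    fun l => x.comapDomain (fun s => (s, l)) (fun a _ b _ h => (Prod.ext_iff.1 h).1)
  have hxl : ∀ l s, xl l s = x (s, l) := fun l s => rfl
  let Ls := x.support.image Prod.snd
  have hsum : x = ∑ l ∈ Ls, Finsupp.mapDomain (fun s => (s, l)) (xl l) := by
    ext ⟨s, l⟩
    rw [Finsupp.finsetSum_apply]
    simp only [mapDomain_mk_apply, hxl, Finset.sum_ite_eq']
    split_ifs with h
    · rfl
    · by_contra hne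
      exact h (Finset.mem_image.2 ⟨(s, l), Finsupp.mem_support_iff.2 hne, rfl⟩)
  have hd' : ∀ l ∈ Ls, ∀ s, bdLin bdW (xl l) s = 0 := by
    intro l hl s
    rw [hsum, map_sum] at hd
    have := DFunLike.congr_fun hd (s, l)
    rw [Finsupp.finsetSum_apply] at this
    simpa only [pp, pd_mapDomain_mk, mapDomain_mk_apply, Finset.sum_ite_eq', if_pos hl,
      Finsupp.coe_zero, Pi.zero_apply] using this
  have hy : ∀ l, ∃ y : List (FreeGroup (Fin N)) × Subgroup (FreeGroup (Fin N)) →₀ ℤ, l ∈ Ls →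
      y ∈ Sp (TT N (m + 1)) ∧ bdLin bdW y = xl l := by
    intro l
    by_cases hl : l ∈ Ls
    · obtain ⟨y, hy1, hy2⟩ := Ex_Valid m hm (xl l) (fun s hs => (mem_Sp.1 hx (s, l) hs).1)
        fun s _ => hd' l hl s
      refine ⟨y, fun _ => ⟨mem_Sp.2 hy1, ?_⟩⟩
      ext1 s
      by_cases hs : s ∈ Valid N
      · exact hy2 s hs
      · rw [hxl]
        have e1 : x (s, l) = 0 := by
          by_contra hne
          exact hs (mem_Sp.1 hx _ hne).1.1
        rw [e1]
        by_contra hne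
        obtain ⟨a, ha, ha'⟩ := exists_of_bdLin_ne_zero hne
        exact hs (Valid.face (hy1 a ha).1 ha')
    · exact ⟨0, fun h => absurd h hl⟩
  choose y hy using hy
  have hql : ∀ l ∈ Ls, l.length = q := by
    intro l hl
    obtain ⟨a, ha, rfl⟩ := Finset.mem_image.1 hl
    exact (mem_Sp.1 hx _ (Finsupp.mem_support_iff.1 ha)).2
  refine ⟨∑ l ∈ Ls, Finsupp.mapDomain (fun s => (s, l)) (y l), Submodule.sum_mem _ fun l hl => ?_, ?_⟩
  · refine mapDomain_mem_Sp ?_ (hy l hl).1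
    exact fun s hs => ⟨hs, hql l hl⟩
  · rw [map_sum]
    conv_rhs => rw [hsum]
    refine Finset.sum_congr rfl fun l hl => ?_
    rw [pp, pd_mapDomain_mk, (hy l hl).2]

end DoubleComplex

section Stability

variable {k m q N : ℕ}

/-- Surjectivity of stabilization on homology. -/
def SSurj (i n : ℕ) : Prop := ∀ c ∈ DD (n + 1) i, dl c = 0 →
  ∃ b ∈ DD n i, dl b = 0 ∧ ∃ e ∈ DD (n + 1) (i + 1), c = sg n b + dl e

/-- Injectivity of stabilization on homology. -/
def SInj (i n : ℕ) : Prop := ∀ b ∈ DD n i, dl b = 0 →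
  (∃ e ∈ DD (n + 1) (i + 1), sg n b = dl e) → ∃ e ∈ DD n (i + 1), b = dl e

/-- Exactness of the rows on homology. -/
lemma row_homology_exact (hN : k + (m + 1) = N) (hk : 1 ≤ k)
    (h1 : Odd (m + 1) → SInj q k) (h2 : Even (m + 1) → SSurj q (k - 1))
    {t : (List (FreeGroup (Fin N)) × Subgroup (FreeGroup (Fin N))) × List (AF N) →₀ ℤ}
    (ht : t ∈ AA N (m + 1) q) (hd : dl t = 0) (hp : ∃ y ∈ AA N m (q + 1), pp N t = dl y) :
    ∃ u ∈ AA N (m + 2) q, dl u = 0 ∧ ∃ v ∈ AA N (m + 1) (q + 1), t = pp N u + dl v := by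
  obtain ⟨c, hc, hdc, v0, hv0, rfl⟩ := stabilizer_surj hN ht hd
  rcases Nat.even_or_odd (m + 1) with hm | hm
  · obtain ⟨k, rfl⟩ : ∃ k', k = k' + 1 := ⟨k - 1, by omega⟩
    replace h2 : SSurj q k := h2 hm
    obtain ⟨b, hb, hdb, e, he, rfl⟩ := h2 c hc hdc
    have hN' : k + (m + 1 + 1) = N := by omega
    obtain ⟨w, hw, hw'⟩ := pp_ik hN' hb hdb
    rw [if_pos hm.add_one, one_smul] at hw'
    refine ⟨ik (by omega) b, ik_mem hN' hb, by rw [dl_ik, hdb, map_zero],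
      ik (by omega) e + v0 - w, Submodule.sub_mem _ (Submodule.add_mem _ (ik_mem hN he) hv0) hw, ?_⟩
    rw [hw', map_add, map_sub, map_add, dl_ik]
    abel
  · obtain ⟨y, hy, hy'⟩ := hp
    obtain ⟨w, hw, hw'⟩ := pp_ik hN hc hdc
    rw [if_pos hm, one_smul] at hw'
    rw [map_add, hw', ← dl_pp] at hy'
    obtain ⟨e', he', hce'⟩ := stabilizer_inj (k := k + 1) (m := m) (N := N) (by omega)
      (c := sg k c) ⟨y - w - pp N v0, Submodule.sub_mem _ (Submodule.sub_mem _ hy hw) (pp_mem hv0), by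
        rw [map_sub, map_sub, ← hy']
        abel⟩
    obtain ⟨e, he, rfl⟩ := h1 hm c hc hdc ⟨e', he', hce'⟩
    refine ⟨0, Submodule.zero_mem _, map_zero _, ik (by omega) e + v0,
      Submodule.add_mem _ (ik_mem hN he) hv0, ?_⟩
    rw [map_zero, map_add, dl_ik, zero_add]

/-- Exactness of the complex of cycles. -/
lemma cycles_exact (N q : ℕ) (hS : ∀ i < q, ∀ n, 2 * i + 1 ≤ n → SSurj i n)
    (hI : ∀ i < q, ∀ n, 2 * i + 2 ≤ n → SInj i n) : ∀ m, 2 * (m + q) + 1 ≤ N → 2 * q + m + 2 ≤ N →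
    ∀ x ∈ AA N m q, pp N x = 0 → dl x = 0 → ∃ y ∈ AA N (m + 1) q, pp N y = x ∧ dl y = 0 := by
  induction q with
  | zero =>
    intro m hm _ x hx hp _
    obtain ⟨y, hy, hy'⟩ := row_exact (by omega) hx hp
    exact ⟨y, hy, hy', dl_zero hy⟩
  | succ q ih =>
    intro m hm hm' x hx hp hd
    obtain ⟨y, hy, hy'⟩ := row_exact (by omega) hx hp
    obtain ⟨t, ht, htz, hdt⟩ := ih (fun i hi => hS i (by omega)) (fun i hi => hI i (by omega)) (m + 1)
      (by omega) (by omega) (dl y) (dl_AA hy) (by rw [← dl_pp, hy', hd]) (dl_dl y)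
    obtain ⟨u, -, -, v, hv, rfl⟩ := row_homology_exact (k := N - (m + 2)) (m := m + 1) (by omega)
      (by omega) (fun _ => hI q (by omega) _ (by omega)) (fun _ => hS q (by omega) _ (by omega))
      ht hdt ⟨y, hy, htz⟩
    refine ⟨y - pp N v, Submodule.sub_mem _ hy (pp_mem hv), ?_, ?_⟩
    · rw [map_sub, pp_pp, hy', sub_zero]
    · rw [map_add, pp_pp, zero_add] at htz
      rw [map_sub, dl_pp, htz, sub_self]

lemma stability_step (i : ℕ) (hS : ∀ i' < i, ∀ n, 2 * i' + 1 ≤ n → SSurj i' n)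
    (hI : ∀ i' < i, ∀ n, 2 * i' + 2 ≤ n → SInj i' n) :
    (∀ n, 2 * i + 1 ≤ n → SSurj i n) ∧ ∀ n, 2 * i + 2 ≤ n → SInj i n := by
  constructor
  · intro n hn c hc hdc
    have hN0 : n + 1 + 0 = n + 1 := rfl
    have hN1 : n + (0 + 1) = n + 1 := rfl
    have hx := ik_mem hN0 hc
    obtain ⟨y, hy, hyx, hdy⟩ := cycles_exact (n + 1) i hS hI 0 (by omega) (by omega) _ hx (pp_zero hx)
      (by rw [dl_ik, hdc, map_zero])
    obtain ⟨b, hb, hdb, v, hv, rfl⟩ := stabilizer_surj hN1 hy hdy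
    obtain ⟨w, hw, hw'⟩ := pp_ik hN1 hb hdb
    rw [if_pos (by decide), one_smul] at hw'
    rw [map_add, hw', ← dl_pp] at hyx
    obtain ⟨e, he, hce⟩ := stabilizer_inj hN0 (c := c - sg n b) ⟨w + pp _ v,
      Submodule.add_mem _ hw (pp_mem hv), by
        rw [map_sub, map_add, ← hyx]
        abel⟩
    exact ⟨b, hb, hdb, e, he, by rw [← hce]; abel⟩
  · intro n hn b hb hdb hbe
    obtain ⟨e, he, hbe⟩ := hbe
    have hN0 : n + 1 + 0 = n + 1 := rfl
    have hN1 : n + (0 + 1) = n + 1 := rfl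
    have hN2 : n - 1 + (1 + 1) = n + 1 := by omega
    obtain ⟨w, hw, hw'⟩ := pp_ik hN1 hb hdb
    rw [if_pos (by decide), one_smul, hbe, ← dl_ik, ← map_add] at hw'
    have hs' := Submodule.add_mem _ (ik_mem hN0 he) hw
    obtain ⟨v, hv, hvs⟩ := row_exact (by omega) hs' (pp_zero hs')
    obtain ⟨u, hu, hux, hdu⟩ := cycles_exact (n + 1) i hS hI 1 (by omega) (by omega)
      (ik (by omega) b - dl v) (Submodule.sub_mem _ (ik_mem hN1 hb) (dl_AA hv))
      (by rw [map_sub, hw', ← dl_pp, hvs, sub_self]) (by rw [map_sub, dl_ik, hdb, map_zero, dl_dl, sub_self])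
    obtain ⟨b', hb', hdb', w', hw'', rfl⟩ := stabilizer_surj hN2 hu hdu
    obtain ⟨z, hz, hz'⟩ := pp_ik hN2 hb' hdb'
    rw [if_neg (by decide), zero_smul, zero_add] at hz'
    rw [map_add, hz', ← dl_pp, ← map_add] at hux
    exact stabilizer_inj hN1 ⟨z + pp _ w' + v, Submodule.add_mem _ (Submodule.add_mem _ hz (pp_mem hw''))
      hv, by rw [map_add, hux, sub_add_cancel]⟩

theorem stability (i : ℕ) : (∀ n, 2 * i + 1 ≤ n → SSurj i n) ∧ ∀ n, 2 * i + 2 ≤ n → SInj i n := by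
  induction i using Nat.strong_induction_on with
  | _ i ih => exact stability_step i (fun i' h => (ih i' h).1) fun i' h => (ih i' h).2

end Stability

section Bridge

variable {G H : Type} [Group G] [Group H] {i k : ℕ}

/-- The word of nontrivial partial products. -/
def wd {q : ℕ} (t : Fin q → G) : PUnit.{1} × List G :=
  (PUnit.unit, List.ofFn fun s : Fin q => Fin.partialProd t s.succ)

lemma wd_injective {q : ℕ} : Function.Injective (wd : (Fin q → G) → PUnit.{1} × List G) := by
  intro t t' h
  have h2 : (fun s : Fin q => Fin.partialProd t s.succ) = fun s => Fin.partialProd t' s.succ :=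
    List.ofFn_injective (Prod.mk.inj h).2
  have h3 : ∀ s, Fin.partialProd t s = Fin.partialProd t' s := by
    intro s
    cases s using Fin.cases with
    | zero => simp
    | succ s => exact congrFun h2 s
  ext s
  rw [← Fin.partialProd_right_inv t, ← Fin.partialProd_right_inv t', h3, h3]

lemma exists_wd (p : PUnit.{1} × List G) : ∃ t : Fin p.2.length → G, wd t = p := by
  obtain ⟨u, l⟩ := p
  let f : Fin (l.length + 1) → G := Fin.cons 1 l.get
  refine ⟨fun s => (f s.castSucc)⁻¹ * f s.succ, Prod.ext rfl ?_⟩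
  have := Fin.partialProd_left_inv f
  have h0 : f 0 = 1 := rfl
  rw [h0, one_smul] at this
  simp only [wd, this]
  exact List.ofFn_get l

/-- The passage from inhomogeneous chains to words. -/
def hom (q : ℕ) (x : (Fin q → G) →₀ ℤ) : PUnit.{1} × List G →₀ ℤ := Finsupp.mapDomain wd x

lemma hom_injective (q : ℕ) : Function.Injective (hom q : ((Fin q → G) →₀ ℤ) → _) :=
  Finsupp.mapDomain_injective wd_injective

lemma hom_mem (q : ℕ) (x : (Fin q → G) →₀ ℤ) : hom q x ∈ Ch G (Set.univ : Set PUnit.{1}) q := by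
  refine mapDomain_mem_Sp (T := Set.univ) ?_ (mem_Sp.2 fun _ _ => Set.mem_univ _)
  exact fun t _ => ⟨Set.mem_univ _, by simp [wd]⟩

lemma exists_hom (q : ℕ) {z : PUnit.{1} × List G →₀ ℤ}
    (hz : z ∈ Ch G (Set.univ : Set PUnit.{1}) q) : ∃ x, hom q x = z := by
  have : ∀ p : PUnit.{1} × List G, ∃ t : Fin q → G, p.2.length = q → wd t = p := by
    intro p
    by_cases h : p.2.length = q
    · subst h
      obtain ⟨t, ht⟩ := exists_wd p
      exact ⟨t, fun _ => ht⟩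
    · exact ⟨1, fun h' => absurd h' h⟩
  choose g hg using this
  refine ⟨Finsupp.mapDomain g z, ?_⟩
  rw [hom, ← Finsupp.mapDomain_comp]
  refine (mapDomain_congr_Sp (g := id) (fun p hp => hg p hp.2) hz).trans ?_
  exact Finsupp.mapDomain_id

lemma lbd_ofFn {A : Type*} {n : ℕ} (f : Fin (n + 1) → A) : lbd (List.ofFn f) =
    ∑ a : Fin (n + 1), (-1 : ℤ) ^ (a : ℕ) •
      Finsupp.single (List.ofFn fun s => f (a.succAbove s)) (1 : ℤ) := by
  induction n with
  | zero => simp [lbd]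
  | succ n ih =>
    rw [List.ofFn_succ, lbd, ih, Fin.sum_univ_succ (n := n + 1), Finsupp.mapDomain_finsetSum, sub_eq_add_neg,
      ← Finset.sum_neg_distrib]
    congr 1
    · simp
    · refine Finset.sum_congr rfl fun a _ => ?_
      rw [Finsupp.mapDomain_smul, Finsupp.mapDomain_single, List.ofFn_succ, Fin.val_succ, pow_succ]
      simp

lemma dl_wd (t : Fin (i + 1) → G) : dl (Finsupp.single (wd t) 1) = hom i (bword t) := by
  have h0 : List.ofFn (fun s : Fin (i + 1) => Fin.partialProd t s.succ) =
      t 0 :: List.ofFn fun s : Fin i => t 0 * Fin.partialProd (Fin.tail t) s.succ := by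
    rw [List.ofFn_succ]
    simp only [Fin.partialProd_succ' t, Fin.partialProd_zero, mul_one]
  have h1 : ∀ a : Fin (i + 1), (PUnit.unit, List.ofFn fun s : Fin i =>
      Fin.partialProd t (a.succAbove s).succ) = wd (Fin.contractNth a (· * ·) t) := by
    intro a
    rw [wd, Fin.partialProd_contractNth]
    simp
  have h2 : Fin.contractNth (Fin.last i) (· * ·) t = fun s => t s.castSucc := by
    ext s
    rw [Fin.contractNth_apply_of_lt _ _ _ _ (by simp)]
  have h3 : ∀ z : List G →₀ ℤ, Finsupp.mapDomain (nm PUnit.unit) (Finsupp.mapDomain (Prod.mk 1) z) =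
      Finsupp.mapDomain (Prod.mk PUnit.unit) z := by
    intro z
    rw [← Finsupp.mapDomain_comp]
    congr 1
    ext1 l
    simp [nm]
  rw [dl, op, lx_single, wd, tb, Finsupp.mapDomain_sub, id]
  rw [h3, lbd_ofFn, Finsupp.mapDomain_finsetSum]
  simp only [Finsupp.mapDomain_smul, Finsupp.mapDomain_single, h1]
  rw [h0, hd, Finsupp.mapDomain_single, Fin.sum_univ_castSucc, h2, hom, bword,
    Finsupp.mapDomain_add, Finsupp.mapDomain_add, Finsupp.mapDomain_finsetSum]
  simp only [Finsupp.mapDomain_smul, Finsupp.mapDomain_single]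
  simp only [pow_succ, Fin.val_castSucc,
    Fin.val_last, mul_neg, mul_one, neg_smul, Finset.sum_neg_distrib]
  have h4 : nm PUnit.unit (t 0, List.ofFn fun s : Fin i => t 0 * Fin.partialProd (Fin.tail t) s.succ)
      = wd fun s => t s.succ := by
    simp [nm, wd, Function.comp_def, Fin.tail_def]
  rw [h4]
  abel

lemma dl_hom (x : (Fin (i + 1) → G) →₀ ℤ) : dl (hom (i + 1) x) = hom i (bdry (i + 1) x) := by
  have h : bdry (i + 1) x = lx bword x := by
    rw [lx, Finsupp.linearCombination_apply]
    rfl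
  rw [h, hom, hom, mapDomain_lx, mapDomain_eq_lx, dl, op, lx_lx]
  congr 2
  ext1 t
  exact dl_wd t

lemma dl_hom_eq_zero (x : (Fin i → G) →₀ ℤ) : dl (hom i x) = 0 ↔ bdry i x = 0 := by
  cases i with
  | zero => exact ⟨fun _ => rfl, fun _ => dl_zero (hom_mem 0 x)⟩
  | succ i =>
    rw [dl_hom, ← (hom_injective (G := G) i).eq_iff]
    exact Eq.congr_right Finsupp.mapDomain_zero.symm

lemma exists_bdry {z : (Fin i → G) →₀ ℤ} :
    (∃ e ∈ Ch G (Set.univ : Set PUnit.{1}) (i + 1), hom i z = dl e) ↔ IsBdry z := by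
  constructor
  · rintro ⟨e, he, h⟩
    obtain ⟨y, rfl⟩ := exists_hom _ he
    rw [dl_hom] at h
    exact ⟨y, (hom_injective i h).symm⟩
  · rintro ⟨y, rfl⟩
    exact ⟨_, hom_mem _ y, (dl_hom y).symm⟩

lemma partialProd_map (f : G →* H) {q : ℕ} (t : Fin q → G) (s : Fin (q + 1)) :
    Fin.partialProd (fun s => f (t s)) s = f (Fin.partialProd t s) := by
  induction s using Fin.induction with
  | zero => simp
  | succ s ih => rw [Fin.partialProd_succ, Fin.partialProd_succ, ih, map_mul]

lemma sg_hom (x : (Fin i → AF k) →₀ ℤ) : sg k (hom i x) = hom i (cmap (jj k.le_succ) x) := by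
  rw [sg, io_eq, hom, hom, cmap, ← Finsupp.mapDomain_comp, ← Finsupp.mapDomain_comp]
  congr 1
  ext1 t
  simp [wd, partialProd_map, Function.comp_def]

end Bridge

lemma eq_jj {n : ℕ} (J : MulAut (FreeGroup (Fin n)) →* MulAut (FreeGroup (Fin (n + 1))))
    (hJ : ∀ (φ : MulAut (FreeGroup (Fin n))) (a : Fin n),
      (J φ) (FreeGroup.of a.castSucc)
        = (FreeGroup.lift (fun b : Fin n => FreeGroup.of b.castSucc)) (φ (FreeGroup.of a)))
    (hJlast : ∀ φ : MulAut (FreeGroup (Fin n)),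
      (J φ) (FreeGroup.of (Fin.last n)) = FreeGroup.of (Fin.last n)) : J = jj n.le_succ := by
  refine MonoidHom.ext fun φ => aut_ext fun a => ?_
  cases a using Fin.lastCases with
  | last =>
    rw [hJlast]
    exact (jj_of_le n.le_succ _ (by simp)).symm
  | cast a =>
    rw [hJ]
    refine Eq.trans ?_ (jj_castLE n.le_succ _ _).symm
    rw [inc, FreeGroup.map_eq_lift]
    rfl

end HV

/-- Hatcher–Vogtmann stability: for `i ≥ 0` and `n ≥ 2i+2`, the
natural homomorphism `Aut Fₙ → Aut F_{n+1}` (extending an automorphism by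
fixing the new generator) induces an isomorphism `H_i(Aut Fₙ;ℤ) ≅
H_i(Aut F_{n+1};ℤ)`:  it is injective and surjective on homology classes. -/
theorem stmt_14 (n i : ℕ) (hn : 1 ≤ n) (hni : 2 * i + 2 ≤ n)
    (J : MulAut (FreeGroup (Fin n)) →* MulAut (FreeGroup (Fin (n + 1))))
    (hJ : ∀ (φ : MulAut (FreeGroup (Fin n))) (a : Fin n),
      (J φ) (FreeGroup.of a.castSucc)
        = (FreeGroup.lift (fun b : Fin n => FreeGroup.of b.castSucc)) (φ (FreeGroup.of a)))
    (hJlast : ∀ φ : MulAut (FreeGroup (Fin n)),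
      (J φ) (FreeGroup.of (Fin.last n)) = FreeGroup.of (Fin.last n)) :
    (∀ x : Chn (MulAut (FreeGroup (Fin n))) i, bdry i x = 0 →
      IsBdry (cmap J x) → IsBdry x) ∧
    (∀ y : Chn (MulAut (FreeGroup (Fin (n + 1)))) i, bdry i y = 0 →
      ∃ x : Chn (MulAut (FreeGroup (Fin n))) i,
        bdry i x = 0 ∧ IsBdry (cmap J x - y)) := by
  obtain rfl := HV.eq_jj J hJ hJlast
  constructor
  · intro x hx h
    rw [← HV.exists_bdry, ← HV.sg_hom] at h
    exact HV.exists_bdry.1 ((HV.stability i).2 n hni _ (HV.hom_mem i x)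
      ((HV.dl_hom_eq_zero x).2 hx) h)
  · intro y hy
    obtain ⟨b, hb, hb0, e, he, h⟩ := (HV.stability i).1 n (by omega) _ (HV.hom_mem i y)
      ((HV.dl_hom_eq_zero y).2 hy)
    obtain ⟨x, rfl⟩ := HV.exists_hom i hb
    refine ⟨x, (HV.dl_hom_eq_zero x).1 hb0, HV.exists_bdry.1 ⟨-e, Submodule.neg_mem _ he, ?_⟩⟩
    have hs : HV.hom i (cmap (HV.jj n.le_succ) x - y) =
        HV.hom i (cmap (HV.jj n.le_succ) x) - HV.hom i y := Finsupp.mapDomain_sub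
    rw [hs, h, HV.sg_hom, map_neg]
    abel

end
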